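/- Let g ≥ 2 and n ≥ 1 be integers. Suppose P ∈ ℚ[X] is a polynomial such that for every prime power q with n dividing q−1 there is an element ζ ∈ F_q^× of multiplicative order exactly n for which the number of 2g-tuples (A_1,B_1,…,A_g,B_g) ∈ GL(n,F_q)^{2g} with [A_1,B_1]⋯[A_g,B_g] = ζ·I_n equals (|GL(n,F_q)|/(q−1)) · P(q). Then (X−1)^{2g} divides P in ℚ[X], and the quotient polynomial Q := P/(X−1)^{2g} satisfies Q(1) = μ(n)·n^{2g−3}, where μ is the Möbius function. (Equivalently: the Euler characteristic of the twisted PGL_n-character variety of a genus-g surface is μ(n)·n^{2g−3}.) -/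

import Mathlib

open scoped MatrixGroups
set_option linter.all false



namespace HRV

section Wedd
variable (G : Type) [Group G] [Fintype G]

/-- complex group algebra -/
abbrev CG : Type := MonoidAlgebra ℂ G

instance : FiniteDimensional ℂ (CG G) :=
  Module.Finite.equiv (MonoidAlgebra.coeffLinearEquiv ℂ).symm

instance : IsSemisimpleRing (CG G) := by
  haveI : NeZero (Nat.card G : ℂ) := ⟨by simp⟩
  unfold IsSemisimpleRing
  infer_instance

theorem wedd : ∃ (n : ℕ) (d : Fin n → ℕ), (∀ i, NeZero (d i)) ∧
      Nonempty (CG G ≃ₐ[ℂ] Π i, Matrix (Fin (d i)) (Fin (d i)) ℂ) :=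
  IsSemisimpleRing.exists_algEquiv_pi_matrix_of_isAlgClosed ℂ (CG G)

/-- index set of irreducibles -/
abbrev Irr : Type := Fin (wedd G).choose

/-- degree -/
noncomputable def dm (k : Irr G) : ℕ := (wedd G).choose_spec.choose k

instance dm_neZero (k : Irr G) : NeZero (dm G k) := (wedd G).choose_spec.choose_spec.1 k

noncomputable def phi : CG G ≃ₐ[ℂ] Π i : Irr G, Matrix (Fin (dm G i)) (Fin (dm G i)) ℂ :=
  (wedd G).choose_spec.choose_spec.2.some

variable {G}

noncomputable def rep (k : Irr G) : CG G →ₐ[ℂ] Matrix (Fin (dm G k)) (Fin (dm G k)) ℂ :=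
  (Pi.evalAlgHom ℂ (fun i : Irr G => Matrix (Fin (dm G i)) (Fin (dm G i)) ℂ) k).comp
    (phi G).toAlgHom

theorem rep_apply (k : Irr G) (x : CG G) : rep k x = phi G x k := rfl

theorem rep_surj (k : Irr G) : Function.Surjective (rep k) := by
  intro M
  refine ⟨(phi G).symm (Pi.single k M), ?_⟩
  simp [rep_apply]

theorem eq_of_rep {x y : CG G} (h : ∀ k, rep k x = rep k y) : x = y := by
  apply (phi G).injective
  funext k
  exact h k

theorem exists_rep_ne_zero {x : CG G} (h : x ≠ 0) : ∃ k, rep k x ≠ 0 := by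
  by_contra hc
  push Not at hc
  exact h (eq_of_rep (fun k => by simp [hc k]))

/-- central idempotents -/
noncomputable def zz (k : Irr G) : CG G := (phi G).symm (Pi.single k 1)

theorem rep_zz_self (k : Irr G) : rep k (zz k) = 1 := by simp [rep_apply, zz]

theorem rep_zz_ne {k l : Irr G} (h : l ≠ k) : rep l (zz k) = 0 := by
  simp [rep_apply, zz, Pi.single_eq_of_ne h]

theorem zz_comm (k : Irr G) (x : CG G) : zz k * x = x * zz k := by
  apply eq_of_rep
  intro l
  by_cases h : l = k
  · subst h; simp [rep_zz_self]
  · simp [rep_zz_ne h]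

theorem zz_mul_self (k : Irr G) : zz k * zz k = zz k := by
  apply eq_of_rep
  intro l
  by_cases h : l = k
  · subst h; simp [rep_zz_self]
  · simp [rep_zz_ne h]

theorem zz_mul_ne {k l : Irr G} (h : k ≠ l) : zz k * zz l = 0 := by
  apply eq_of_rep
  intro m
  by_cases h1 : m = k
  · subst h1; simp [rep_zz_ne h]
  · simp [rep_zz_ne h1]

theorem sum_zz : ∑ k : Irr G, zz k = 1 := by
  apply eq_of_rep
  intro l
  rw [map_sum, Finset.sum_eq_single l]
  · simp [rep_zz_self]
  · intro b _ hb; exact rep_zz_ne hb.symm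
  · simp

theorem zz_mul_ne_zero_iff (k : Irr G) (x : CG G) : zz k * x ≠ 0 ↔ rep k x ≠ 0 := by
  constructor
  · intro h hc
    apply h
    apply eq_of_rep
    intro l
    by_cases hl : l = k
    · subst hl; simp [hc]
    · simp [rep_zz_ne hl]
  · intro h hc
    apply h
    have := congrArg (rep k) hc
    simpa [rep_zz_self] using this

theorem zz_ne_zero (k : Irr G) : zz k ≠ 0 := by
  intro h
  have := congrArg (rep k) h
  rw [rep_zz_self, map_zero] at this
  exact one_ne_zero this

theorem rep_mul_zz (k : Irr G) (x : CG G) : rep k (x * zz k) = rep k x := by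
  simp [rep_zz_self]

/-- group elements inside the group algebra -/
noncomputable abbrev gg (g : G) : CG G := MonoidAlgebra.of ℂ G g

theorem gg_mul (g h : G) : gg (g * h) = gg g * gg h := map_mul _ _ _

theorem CG_span (x : CG G) : x = ∑ g : G, x.coeff g • gg g := by
  classical
  ext h
  simp [MonoidAlgebra.coeff_sum, MonoidAlgebra.of_apply, Finsupp.single_apply]

theorem CG_induction {p : CG G → Prop} (x : CG G) (h1 : ∀ g, p (gg g))
    (h2 : ∀ x y, p x → p y → p (x + y)) (h3 : ∀ (c : ℂ) x, p x → p (c • x)) : p x := by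
  have h0 : p 0 := by simpa using h3 0 _ (h1 1)
  rw [CG_span x]
  exact Finset.sum_induction _ p h2 h0 (fun g _ => h3 _ _ (h1 g))

/-- If two elements act nontrivially on `k`, they are linked by a group element. -/
theorem sandwich (k : Irr G) {x y : CG G} (hx : rep k x ≠ 0) (hy : rep k y ≠ 0) :
    ∃ g : G, rep k (x * gg g * y) ≠ 0 := by
  by_contra hc
  push Not at hc
  have h : ∀ a : CG G, rep k (x * a * y) = 0 := by
    intro a
    induction a using CG_induction with
    | h1 g => exact hc g
    | h2 a b ha hb => rw [mul_add, add_mul, map_add, ha, hb, add_zero]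
    | h3 c a ha => rw [mul_smul_comm, smul_mul_assoc, map_smul, ha, smul_zero]
  have h' : ∀ M, rep k x * M * rep k y = 0 := by
    intro M
    obtain ⟨a, rfl⟩ := rep_surj k M
    rw [← map_mul, ← map_mul, h]
  obtain ⟨i, j, hij⟩ : ∃ i j, rep k x i j ≠ 0 := by
    by_contra hh; push Not at hh; exact hx (by ext i j; simp [hh])
  obtain ⟨i', j', hij'⟩ : ∃ i j, rep k y i j ≠ 0 := by
    by_contra hh; push Not at hh; exact hy (by ext i j; simp [hh])
  have := congrFun (congrFun (h' (Matrix.single j i' 1)) i) j'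
  rw [Matrix.mul_assoc] at this
  simp [Matrix.mul_apply, Matrix.single_apply, Finset.sum_ite_eq, ite_and] at this
  tauto

/-- rank one idempotent -/
noncomputable def ep (k : Irr G) : CG G := (phi G).symm (Pi.single k (Matrix.single 0 0 1))

theorem rep_ep_self (k : Irr G) : rep k (ep k) = Matrix.single 0 0 1 := by simp [rep_apply, ep]

theorem rep_ep_ne {k l : Irr G} (h : l ≠ k) : rep l (ep k) = 0 := by
  simp [rep_apply, ep, Pi.single_eq_of_ne h]

theorem rep_ep_self_ne_zero (k : Irr G) : rep k (ep k) ≠ 0 := by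
  rw [rep_ep_self]
  intro h
  have := congrFun (congrFun h 0) 0
  simp at this

/-- `zz k` is in the two-sided ideal generated by anything acting nontrivially -/
theorem zz_mem_ideal (k : Irr G) {x : CG G} (hx : rep k x ≠ 0) :
    ∃ (s : Finset (Fin (dm G k))) (a b : Fin (dm G k) → CG G), zz k = ∑ r ∈ s, a r * x * b r := by
  obtain ⟨i, j, hij⟩ : ∃ i j, rep k x i j ≠ 0 := by
    by_contra hh; push Not at hh; exact hx (by ext i j; simp [hh])
  refine ⟨Finset.univ, fun r => (phi G).symm (Pi.single k (Matrix.single r i (rep k x i j)⁻¹)),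
    fun r => (phi G).symm (Pi.single k (Matrix.single j r 1)), ?_⟩
  apply eq_of_rep
  intro l
  by_cases h : l = k
  · subst h
    rw [rep_zz_self]
    ext p q
    simp only [map_sum, map_mul, Matrix.sum_apply]
    simp only [rep_apply, AlgEquiv.apply_symm_apply, Pi.single_eq_same]
    simp only [← rep_apply]
    simp [Matrix.mul_apply, Matrix.single_apply, ite_and, Finset.sum_ite_eq, Matrix.one_apply, hij, eq_comm]
  · rw [rep_zz_ne h]
    simp only [map_sum, map_mul]
    simp [rep_apply, Pi.single_eq_of_ne h]

theorem exists_of_zz_ne_zero (k : Irr G) {x : CG G} (hx : rep k x ≠ 0)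
    {B : Type} [Ring B] (f : CG G →+* B) (Y : B) (h : Y * f (zz k) ≠ 0) :
    ∃ a, Y * f a * f x ≠ 0 := by
  obtain ⟨s, a, b, hab⟩ := zz_mem_ideal k hx
  by_contra hc
  push Not at hc
  apply h
  rw [hab, map_sum, Finset.mul_sum]
  apply Finset.sum_eq_zero
  intro r _
  rw [map_mul, map_mul, ← mul_assoc, ← mul_assoc, hc, zero_mul]

theorem exists_group_of_zz_ne_zero (k : Irr G) {x : CG G} (hx : rep k x ≠ 0)
    {B : Type} [Ring B] [Algebra ℂ B] (f : CG G →ₐ[ℂ] B) (Y : B) (h : Y * f (zz k) ≠ 0) :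
    ∃ g : G, Y * f (gg g) * f x ≠ 0 := by
  obtain ⟨a, ha⟩ := exists_of_zz_ne_zero k hx f.toRingHom Y h
  by_contra hc
  push Not at hc
  apply ha
  simp only [AlgHom.toRingHom_eq_coe, RingHom.coe_coe]
  clear ha
  induction a using CG_induction with
  | h1 g => exact hc g
  | h2 a b ha hb => rw [map_add, mul_add, add_mul, ha, hb, add_zero]
  | h3 c a ha => rw [map_smul, mul_smul_comm, smul_mul_assoc, ha, smul_zero]

end Wedd
end HRV


namespace HRV

section Chars
variable {G : Type} [Group G] [Fintype G]

noncomputable abbrev chi (k : Irr G) (x : CG G) : ℂ := (rep k x).trace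

theorem chi_comm (k : Irr G) (x y : CG G) : chi k (x * y) = chi k (y * x) := by
  simp only [chi, map_mul]; exact Matrix.trace_mul_comm _ _

theorem scalar_of_commute (k : Irr G) (M : Matrix (Fin (dm G k)) (Fin (dm G k)) ℂ)
    (h : ∀ g : G, rep k (gg g) * M = M * rep k (gg g)) :
    M = (M.trace / dm G k) • (1 : Matrix (Fin (dm G k)) (Fin (dm G k)) ℂ) := by
  have h1 : ∀ x : CG G, rep k x * M = M * rep k x := by
    intro x
    induction x using CG_induction with
    | h1 g => exact h g
    | h2 a b ha hb => rw [map_add, add_mul, mul_add, ha, hb]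
    | h3 c a ha => rw [map_smul, smul_mul_assoc, mul_smul_comm, ha]
  have h2 : M ∈ Set.range (Matrix.scalar (Fin (dm G k)) : ℂ →+* _) := by
    rw [Matrix.mem_range_scalar_iff_commute_single']
    intro i j
    obtain ⟨x, hx⟩ := rep_surj k (Matrix.single i j 1)
    rw [← hx]
    exact h1 x
  obtain ⟨c, rfl⟩ := h2
  have : (dm G k : ℂ) ≠ 0 := NeZero.ne _
  rw [Matrix.scalar_apply, Matrix.trace_diagonal]
  ext i j
  simp [Matrix.one_apply, Matrix.diagonal_apply, this]

theorem schur (k : Irr G) (M : Matrix (Fin (dm G k)) (Fin (dm G k)) ℂ) :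
    ∑ a : G, rep k (gg a) * M * rep k (gg a⁻¹) =
      ((Fintype.card G : ℂ) / dm G k * M.trace) • 1 := by
  rw [scalar_of_commute k (∑ a : G, rep k (gg a) * M * rep k (gg a⁻¹))]
  · congr 1
    rw [Matrix.trace_sum]
    have : ∀ a : G, (rep k (gg a) * M * rep k (gg a⁻¹)).trace = M.trace := by
      intro a
      rw [Matrix.trace_mul_comm, ← Matrix.mul_assoc, ← map_mul, ← gg_mul]
      simp [MonoidAlgebra.one_def.symm]
    simp only [this, Finset.sum_const, Finset.card_univ, nsmul_eq_mul]
    ring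
  · intro g
    rw [Finset.mul_sum, Finset.sum_mul]
    refine Fintype.sum_equiv (Equiv.mulLeft g) _ _ ?_
    intro a
    have : a⁻¹ = (g * a)⁻¹ * g := by group
    simp only [Equiv.coe_mulLeft]
    conv_lhs => rw [this, gg_mul, map_mul]
    rw [gg_mul, map_mul]
    simp only [Matrix.mul_assoc]

theorem sum_chi_inv (k : Irr G) :
    ∑ a : G, chi k (gg a⁻¹) • rep k (gg a) = ((Fintype.card G : ℂ) / dm G k) • 1 := by
  ext p q
  have h : ∀ j : Fin (dm G k), ∑ a : G, rep k (gg a) p q * rep k (gg a⁻¹) j j =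
      if p = j then (if q = j then (Fintype.card G : ℂ) / dm G k else 0) else 0 := by
    intro j
    have := congrFun (congrFun (schur k (Matrix.single q j 1)) p) j
    rw [Matrix.sum_apply] at this
    simp only [Matrix.mul_assoc] at this
    simp [Matrix.mul_apply, Matrix.single_apply, ite_and, Finset.sum_ite_eq, Matrix.one_apply, Matrix.trace] at this
    simp only [MonoidAlgebra.of_apply]
    rw [this]
    by_cases h1 : p = j <;> by_cases h2 : q = j <;> simp [h1, h2, eq_comm (a := j)]
  rw [Matrix.sum_apply]
  simp only [Matrix.smul_apply, chi, Matrix.trace, Matrix.diag_apply, smul_eq_mul, Finset.sum_mul]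
  rw [Finset.sum_comm]
  simp only [mul_comm (rep k (gg _⁻¹) _ _), h]
  simp [Matrix.one_apply]
  by_cases h1 : p = q <;> simp [h1, eq_comm]

/-- commutator sum -/
noncomputable def Om (G : Type) [Group G] [Fintype G] : CG G :=
  ∑ p : G × G, gg (p.1 * p.2 * p.1⁻¹ * p.2⁻¹)

theorem rep_Om (k : Irr G) : rep k (Om G) = (((Fintype.card G : ℂ) / dm G k) ^ 2) • 1 := by
  rw [Om, map_sum, Fintype.sum_prod_type]
  have : ∀ a : G, ∑ b : G, rep k (gg (a * b * a⁻¹ * b⁻¹)) =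
      ((Fintype.card G : ℂ) / dm G k) • (chi k (gg a⁻¹) • rep k (gg a)) := by
    intro a
    have h := schur k (rep k (gg a⁻¹))
    rw [smul_smul]
    calc _ = rep k (gg a) * ∑ b : G, rep k (gg b) * rep k (gg a⁻¹) * rep k (gg b⁻¹) := by
          rw [Finset.mul_sum]
          apply Finset.sum_congr rfl
          intro b _
          rw [gg_mul, gg_mul, gg_mul, map_mul, map_mul, map_mul]
          simp only [Matrix.mul_assoc]
      _ = _ := by rw [h, mul_smul_comm, mul_one]
  simp only [this]
  rw [← Finset.smul_sum, sum_chi_inv, smul_smul, sq]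

theorem trace_lemma (a b : CG G) :
    ∑ k : Irr G, chi k a * chi k b = ∑ g : G, (a * gg g * b).coeff g := by
  classical
  let T : CG G →ₗ[ℂ] CG G := LinearMap.mulLeft ℂ a ∘ₗ LinearMap.mulRight ℂ b
  have h1 : LinearMap.trace ℂ _ T = ∑ g : G, (a * gg g * b).coeff g := by
    let B : Module.Basis G ℂ (CG G) :=
      ⟨(MonoidAlgebra.coeffLinearEquiv ℂ : CG G ≃ₗ[ℂ] _)⟩
    rw [LinearMap.trace_eq_matrix_trace ℂ B, Matrix.trace]
    apply Finset.sum_congr rfl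
    intro g _
    rw [Matrix.diag_apply, LinearMap.toMatrix_apply]
    have : B g = gg g := rfl
    rw [this]
    simp only [T, LinearMap.comp_apply, LinearMap.mulLeft_apply, LinearMap.mulRight_apply, mul_assoc]
    rfl
  rw [← h1]
  let B2 : Module.Basis (Σ k : Irr G, Fin (dm G k) × Fin (dm G k)) ℂ (CG G) :=
    (Pi.basis (fun k : Irr G => Matrix.stdBasis ℂ (Fin (dm G k)) (Fin (dm G k)))).map
      (phi G).toLinearEquiv.symm
  rw [LinearMap.trace_eq_matrix_trace ℂ B2, Matrix.trace, Fintype.sum_sigma]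
  apply Finset.sum_congr rfl
  intro k _
  rw [Fintype.sum_prod_type]
  simp only [chi, Matrix.trace, Finset.sum_mul_sum]
  apply Finset.sum_congr rfl
  intro i _
  apply Finset.sum_congr rfl
  intro j _
  rw [Matrix.diag_apply, Matrix.diag_apply, Matrix.diag_apply, LinearMap.toMatrix_apply]
  simp only [B2, Module.Basis.map_apply, Module.Basis.map_repr, LinearEquiv.trans_apply,
    LinearEquiv.symm_symm, Pi.basis_apply, Pi.basis_repr, AlgEquiv.toLinearEquiv_symm,
    AlgEquiv.toLinearEquiv_apply]
  simp only [T, LinearMap.comp_apply, LinearMap.mulLeft_apply, LinearMap.mulRight_apply, map_mul,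
    AlgEquiv.apply_symm_apply]
  simp only [Pi.mul_apply, Pi.single_eq_same, Matrix.stdBasis_eq_single, AlgEquiv.apply_symm_apply]
  have : ∀ M : Matrix (Fin (dm G k)) (Fin (dm G k)) ℂ,
    (Matrix.stdBasis ℂ (Fin (dm G k)) (Fin (dm G k))).repr M (i, j) = M i j := by
    intro M
    simp [Matrix.stdBasis]
  rw [this]
  simp [Matrix.mul_apply, Matrix.single_apply, ite_and, Finset.sum_ite_eq, rep_apply]

theorem coeff_one_formula (x : CG G) :
    ∑ k : Irr G, (dm G k : ℂ) * chi k x = Fintype.card G * x.coeff 1 := by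
  have h := trace_lemma (x) (1 : CG G)
  have h2 : ∀ g : G, (x * gg g * 1).coeff g = x.coeff 1 := by
    intro g
    rw [mul_one, gg, MonoidAlgebra.of_apply, MonoidAlgebra.coeff_mul_single_eq_coeff_mul 1]
    · simp
    · intro m _; simp
  simp only [h2, Finset.sum_const, Finset.card_univ, nsmul_eq_mul] at h
  rw [← h]
  apply Finset.sum_congr rfl
  intro k _
  simp [chi, mul_comm]

/-- central character -/
noncomputable def om (k : Irr G) (s : G) : ℂ := chi k (gg s) / dm G k

theorem rep_central (k : Irr G) {s : G} (hs : ∀ g, s * g = g * s) :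
    rep k (gg s) = om k s • 1 := by
  apply scalar_of_commute
  intro g
  rw [← map_mul, ← gg_mul, ← hs, gg_mul, map_mul]

theorem frob (g : ℕ) {s : G} (hs : ∀ x, s * x = x * s) :
    ((Om G) ^ g * gg s⁻¹).coeff 1 * Fintype.card G =
      ∑ k : Irr G, (Fintype.card G : ℂ) ^ (2 * g) / (dm G k : ℂ) ^ (2 * g) * (dm G k) ^ 2 * om k s⁻¹ := by
  rw [mul_comm, ← coeff_one_formula]
  apply Finset.sum_congr rfl
  intro k _
  have hs' : ∀ x, s⁻¹ * x = x * s⁻¹ := by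
    intro x
    rw [inv_mul_eq_iff_eq_mul, ← mul_assoc, hs, mul_assoc, mul_inv_cancel, mul_one]
  rw [chi, map_mul, map_pow, rep_Om, rep_central k hs', smul_pow, one_pow, smul_mul_smul_comm, one_mul,
    Matrix.trace_smul, Matrix.trace_one, ← pow_mul, div_pow]
  simp
  ring

theorem coeff_Om_pow (g : ℕ) (s : G) :
    ((Om G) ^ g * gg s⁻¹).coeff 1 =
      (Nat.card {p : (Fin g → G) × (Fin g → G) //
        (List.ofFn fun i => p.1 i * p.2 i * (p.1 i)⁻¹ * (p.2 i)⁻¹).prod = s} : ℂ) := by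
  classical
  have h : (Om G) ^ g = ∑ p : Fin g → G × G,
      gg (List.ofFn fun i => (p i).1 * (p i).2 * (p i).1⁻¹ * (p i).2⁻¹).prod := by
    induction g with
    | zero => simp [MonoidAlgebra.one_def]
    | succ g ih =>
      rw [pow_succ', ih, Om, Finset.sum_mul_sum, ← Fintype.sum_prod_type']
      refine Fintype.sum_equiv (Fin.consEquiv (fun _ => G × G)) _ _ ?_
      intro x
      simp [List.ofFn_succ, ← gg_mul, Fin.consEquiv, MonoidAlgebra.single_mul_single]
  rw [h, Finset.sum_mul, MonoidAlgebra.coeff_sum, Finsupp.finset_sum_apply]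
  have h2 : ∀ p : Fin g → G × G,
      (gg (List.ofFn fun i => (p i).1 * (p i).2 * (p i).1⁻¹ * (p i).2⁻¹).prod * gg s⁻¹ : CG G).coeff 1
      = if (List.ofFn fun i => (p i).1 * (p i).2 * (p i).1⁻¹ * (p i).2⁻¹).prod = s then 1 else 0 := by
    intro p
    rw [← gg_mul, gg, MonoidAlgebra.of_apply, MonoidAlgebra.coeff_single, Finsupp.single_apply]
    simp [mul_inv_eq_one]
  simp only [h2]
  rw [Finset.sum_boole, Nat.cast_inj, Nat.card_eq_fintype_card, ← Fintype.card_subtype]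
  refine Fintype.card_congr (Equiv.subtypeEquiv (Equiv.arrowProdEquivProdArrow (Fin g) (fun _ => G) (fun _ => G)) ?_)
  intro p
  rfl

/-- integrality of central elements with algebraic integer coefficients -/
theorem central_integral (k : Irr G) (x : CG G) (hx : ∀ g, IsIntegral ℤ (x.coeff g)) (l : ℂ)
    (h : rep k x = l • 1) : IsIntegral ℤ l := by
  let O := integralClosure ℤ ℂ
  let y : MonoidAlgebra O G := ∑ g : G, MonoidAlgebra.single g ⟨x.coeff g, hx g⟩
  have hfin : Module.Finite O (MonoidAlgebra O G) :=
    Module.Finite.equiv (MonoidAlgebra.coeffLinearEquiv O).symm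
  have hy : IsIntegral O y := Algebra.IsIntegral.isIntegral y
  let f : MonoidAlgebra O G →ₐ[O] CG G := MonoidAlgebra.mapAlgHom G (Algebra.ofId O ℂ)
  have hfy : f y = x := by
    rw [CG_span x]
    simp only [y, map_sum]
    apply Finset.sum_congr rfl
    intro g _
    simp [f, MonoidAlgebra.of_apply]
  have h1 : IsIntegral O (f y) := hy.map f
  rw [hfy] at h1
  have h2 : IsIntegral O (rep k x) := h1.map ((rep k).restrictScalars O)
  rw [h] at h2
  have h3 : IsIntegral O l := by
    have h4 : l • (1 : Matrix (Fin (dm G k)) (Fin (dm G k)) ℂ) = algebraMap ℂ _ l := by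
      rw [Algebra.algebraMap_eq_smul_one]
    rw [h4] at h2
    exact (isIntegral_algebraMap_iff (FaithfulSMul.algebraMap_injective _ _)).1 h2
  exact isIntegral_trans l h3

end Chars
end HRV


namespace HRV

section Avg
variable {G G' H H' : Type} [Group G] [Fintype G] [Group G'] [Fintype G']
  [Group H] [Fintype H] [Group H'] [Fintype H']

/-- averaging idempotent of a finite group with a linear character -/
noncomputable def avg (j : H →* G) (c : H →* ℂ) : CG G :=
  (Fintype.card H : ℂ)⁻¹ • ∑ h : H, c h⁻¹ • gg (j h)

theorem char_inv (c : H →* ℂ) (h : H) : c h * c h⁻¹ = 1 := by rw [← map_mul]; simp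

theorem avg_left (j : H →* G) (c : H →* ℂ) (h : H) : gg (j h) * avg j c = c h • avg j c := by
  simp only [avg]
  rw [mul_smul_comm, smul_comm]
  congr 1
  rw [Finset.mul_sum, Finset.smul_sum]
  refine Fintype.sum_equiv (Equiv.mulLeft h) _ _ ?_
  intro x
  simp only [Equiv.coe_mulLeft]
  rw [mul_smul_comm, ← gg_mul, ← map_mul, smul_smul]
  congr 1
  rw [mul_inv_rev, map_mul, mul_comm (c x⁻¹), ← mul_assoc, char_inv, one_mul]

theorem avg_right (j : H →* G) (c : H →* ℂ) (h : H) : avg j c * gg (j h) = c h • avg j c := by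
  simp only [avg]
  rw [smul_mul_assoc, smul_comm]
  congr 1
  rw [Finset.sum_mul, Finset.smul_sum]
  refine Fintype.sum_equiv (Equiv.mulRight h) _ _ ?_
  intro x
  simp only [Equiv.coe_mulRight]
  rw [smul_mul_assoc, ← gg_mul, ← map_mul, smul_smul]
  congr 1
  rw [mul_inv_rev, map_mul, ← mul_assoc, char_inv, one_mul]

theorem avg_absorb_left (j : H →* G) (c : H →* ℂ) (x : CG G)
    (hx : ∀ h, gg (j h) * x = c h • x) : avg j c * x = x := by
  simp only [avg]
  rw [smul_mul_assoc, Finset.sum_mul]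
  have : ∀ h : H, (c h⁻¹ • gg (j h)) * x = x := by
    intro h
    rw [smul_mul_assoc, hx, smul_smul, mul_comm, char_inv, one_smul]
  simp only [this, Finset.sum_const, Finset.card_univ]
  rw [← Nat.cast_smul_eq_nsmul ℂ, smul_smul, inv_mul_cancel₀ (by simp), one_smul]

theorem avg_absorb_right (j : H →* G) (c : H →* ℂ) (x : CG G)
    (hx : ∀ h, x * gg (j h) = c h • x) : x * avg j c = x := by
  simp only [avg]
  rw [mul_smul_comm, Finset.mul_sum]
  have : ∀ h : H, x * (c h⁻¹ • gg (j h)) = x := by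
    intro h
    rw [mul_smul_comm, hx, smul_smul, mul_comm, char_inv, one_smul]
  simp only [this, Finset.sum_const, Finset.card_univ]
  rw [← Nat.cast_smul_eq_nsmul ℂ, smul_smul, inv_mul_cancel₀ (by simp), one_smul]

theorem avg_idem (j : H →* G) (c : H →* ℂ) : avg j c * avg j c = avg j c :=
  avg_absorb_left _ _ _ (avg_left j c)

theorem avg_conj (j : H →* G) (c : H →* ℂ) (j' : H' →* G) (c' : H' →* ℂ) (g : G)
    (e : H ≃ H') (h1 : ∀ h, g * j h = j' (e h) * g) (h2 : ∀ h, c' (e h)⁻¹ = c h⁻¹) :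
    gg g * avg j c = avg j' c' * gg g := by
  simp only [avg]
  rw [mul_smul_comm, smul_mul_assoc, Fintype.card_congr e, Finset.mul_sum, Finset.sum_mul]
  congr 1
  refine Fintype.sum_equiv e _ _ ?_
  intro h
  rw [mul_smul_comm, smul_mul_assoc, ← gg_mul, ← gg_mul, h1, h2]

/-- functoriality of the group algebra -/
noncomputable def mp (f : G →* G') : CG G →ₐ[ℂ] CG G' := MonoidAlgebra.mapDomainAlgHom ℂ ℂ f

@[simp] theorem mp_gg (f : G →* G') (g : G) : mp f (gg g) = gg (f g) := by
  simp [mp]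

theorem mp_mp {G'' : Type} [Group G''] [Fintype G''] (f : G →* G') (f' : G' →* G'') (x : CG G) :
    mp f' (mp f x) = mp (f'.comp f) x := by
  simp [mp]

theorem mp_avg (f : G →* G') (j : H →* G) (c : H →* ℂ) : mp f (avg j c) = avg (f.comp j) c := by
  simp only [avg, map_smul, map_sum, mp_gg, MonoidHom.comp_apply]

theorem commute_mp_of (f : G →* G') (Y : CG G') (h : ∀ g, gg (f g) * Y = Y * gg (f g)) (x : CG G) :
    mp f x * Y = Y * mp f x := by
  induction x using CG_induction with
  | h1 g => rw [mp_gg]; exact h g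
  | h2 a b ha hb => rw [map_add, add_mul, mul_add, ha, hb]
  | h3 c a ha => rw [map_smul, smul_mul_assoc, mul_smul_comm, ha]

theorem mp_comm_mp {G1 G2 : Type} [Group G1] [Fintype G1] [Group G2] [Fintype G2]
    (f : G1 →* G) (f' : G2 →* G) (h : ∀ g g', f g * f' g' = f' g' * f g) (x : CG G1) (y : CG G2) :
    mp f x * mp f' y = mp f' y * mp f x := by
  apply commute_mp_of
  intro g
  symm
  apply commute_mp_of
  intro g'
  rw [← gg_mul, ← gg_mul, h]

theorem gg_one : gg (1 : G) = 1 := map_one _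

theorem gg_inv_mul (g : G) : gg g⁻¹ * gg g = 1 := by rw [← gg_mul, inv_mul_cancel, gg_one]

theorem gg_mul_inv (g : G) : gg g * gg g⁻¹ = 1 := by rw [← gg_mul, mul_inv_cancel, gg_one]

end Avg

section Emb
variable {F : Type} [Field F]

def JJ (F : Type) [Field F] {a n : ℕ} (f : Fin a ↪ Fin n) : Matrix (Fin n) (Fin a) F := (1 : Matrix (Fin n) (Fin n) F).submatrix id f

def EE {a b m n : ℕ} (f : Fin a ↪ Fin m) (g : Fin b ↪ Fin n) (X : Matrix (Fin a) (Fin b) F) :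
    Matrix (Fin m) (Fin n) F := JJ F f * X * Matrix.transpose (JJ F g)

def Disj {a b n : ℕ} (f : Fin a ↪ Fin n) (g : Fin b ↪ Fin n) : Prop := ∀ i j, f i ≠ g j

structure Cpl {a b n : ℕ} (f : Fin a ↪ Fin n) (g : Fin b ↪ Fin n) : Prop where
  disj : Disj f g
  cov : ∀ x, (∃ i, f i = x) ∨ (∃ j, g j = x)

/-- composition -/
abbrev cmp {a b n : ℕ} (f : Fin b ↪ Fin n) (p : Fin a ↪ Fin b) : Fin a ↪ Fin n := p.trans f

variable {a b c d m n : ℕ}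

theorem Disj.symm {f : Fin a ↪ Fin n} {g : Fin b ↪ Fin n} (h : Disj f g) : Disj g f :=
  fun i j => (h j i).symm

theorem Cpl.symm {f : Fin a ↪ Fin n} {g : Fin b ↪ Fin n} (h : Cpl f g) : Cpl g f :=
  ⟨h.1.symm, fun x => (h.2 x).symm⟩

theorem Disj.cmp {f : Fin a ↪ Fin n} {g : Fin b ↪ Fin n} (h : Disj f g) (p : Fin c ↪ Fin a)
    (r : Fin d ↪ Fin b) : Disj (cmp f p) (cmp g r) := fun i j => h _ _

theorem Disj.cmp_inj (f : Fin m ↪ Fin n) {p : Fin a ↪ Fin m} {r : Fin b ↪ Fin m} (h : Disj p r) :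
    Disj (HRV.cmp f p) (HRV.cmp f r) := fun i j hh => h i j (f.injective hh)

theorem JJ_t_mul_self (f : Fin a ↪ Fin n) : Matrix.transpose (JJ F f) * JJ F f = (1 : Matrix _ _ F) := by
  ext i j
  rw [Matrix.mul_apply]
  simp only [JJ, Matrix.transpose_apply, Matrix.submatrix_apply, Matrix.one_apply]
  simp [f.injective.eq_iff, eq_comm]

theorem JJ_t_mul_disj {f : Fin a ↪ Fin n} {g : Fin b ↪ Fin n} (h : Disj f g) :
    Matrix.transpose (JJ F f) * JJ F g = (0 : Matrix _ _ F) := by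
  ext i j
  rw [Matrix.mul_apply]
  simp only [JJ, Matrix.transpose_apply, Matrix.submatrix_apply, Matrix.one_apply]
  simp [(h i j).symm]

theorem JJ_cmp (f : Fin b ↪ Fin n) (p : Fin a ↪ Fin b) :
    (JJ F (cmp f p) : Matrix _ _ F) = JJ F f * JJ F p := by
  ext i j
  rw [Matrix.mul_apply]
  simp only [JJ, Matrix.submatrix_apply, Matrix.one_apply]
  simp

theorem EE_mul (f : Fin a ↪ Fin m) (g : Fin b ↪ Fin n) {k : ℕ} (h : Fin c ↪ Fin k)
    (X : Matrix (Fin a) (Fin b) F) (Y : Matrix (Fin b) (Fin c) F) :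
    EE f g X * EE g h Y = EE f h (X * Y) := by
  simp only [EE]
  calc _ = JJ F f * X * (Matrix.transpose (JJ F g) * JJ F g) * Y * Matrix.transpose (JJ F h) := by simp only [Matrix.mul_assoc]
    _ = _ := by rw [JJ_t_mul_self]; simp only [Matrix.mul_assoc, Matrix.mul_one, Matrix.one_mul]

theorem EE_mul_disj (f : Fin a ↪ Fin m) {g : Fin b ↪ Fin n} {k : ℕ} {h : Fin c ↪ Fin n} (l : Fin d ↪ Fin k)
    (hd : Disj g h)
    (X : Matrix (Fin a) (Fin b) F) (Y : Matrix (Fin c) (Fin d) F) :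
    EE f g X * EE h l Y = 0 := by
  simp only [EE]
  calc _ = JJ F f * X * (Matrix.transpose (JJ F g) * JJ F h) * Y * Matrix.transpose (JJ F l) := by simp only [Matrix.mul_assoc]
    _ = _ := by rw [JJ_t_mul_disj hd]; simp

theorem EE_add (f : Fin a ↪ Fin m) (g : Fin b ↪ Fin n) (X Y : Matrix (Fin a) (Fin b) F) :
    EE f g (X + Y) = EE f g X + EE f g Y := by
  simp [EE, Matrix.mul_add, Matrix.add_mul]

theorem EE_sub (f : Fin a ↪ Fin m) (g : Fin b ↪ Fin n) (X Y : Matrix (Fin a) (Fin b) F) :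
    EE f g (X - Y) = EE f g X - EE f g Y := by
  simp [EE, Matrix.mul_sub, Matrix.sub_mul]

theorem EE_zero (f : Fin a ↪ Fin m) (g : Fin b ↪ Fin n) :
    EE f g (0 : Matrix (Fin a) (Fin b) F) = 0 := by
  simp [EE]

theorem EE_smul (f : Fin a ↪ Fin m) (g : Fin b ↪ Fin n) (t : F) (X : Matrix (Fin a) (Fin b) F) :
    EE f g (t • X) = t • EE f g X := by
  simp [EE]

theorem EE_EE {a' b' : ℕ} (f : Fin a ↪ Fin m) (g : Fin b ↪ Fin n) (p : Fin a' ↪ Fin a) (r : Fin b' ↪ Fin b)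
    (X : Matrix (Fin a') (Fin b') F) :
    EE f g (EE p r X) = EE (cmp f p) (cmp g r) X := by
  simp only [EE, JJ_cmp, Matrix.transpose_mul, Matrix.mul_assoc]

theorem EE_apply_apply (f : Fin a ↪ Fin m) (g : Fin b ↪ Fin n) (X : Matrix (Fin a) (Fin b) F) (i j) :
    EE f g X (f i) (g j) = X i j := by
  have : Matrix.transpose (JJ F f) * EE f g X * JJ F g = X := by
    simp only [EE]
    calc _ = (Matrix.transpose (JJ F f) * JJ F f) * X * (Matrix.transpose (JJ F g) * JJ F g) := by simp only [Matrix.mul_assoc]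
      _ = _ := by rw [JJ_t_mul_self, JJ_t_mul_self]; simp
  conv_rhs => rw [← this]
  rw [Matrix.mul_apply]
  simp only [Matrix.mul_apply (M := Matrix.transpose _)]
  simp only [JJ, Matrix.transpose_apply, Matrix.submatrix_apply, Matrix.one_apply]
  simp

theorem EE_apply_left (f : Fin a ↪ Fin m) (g : Fin b ↪ Fin n) (X : Matrix (Fin a) (Fin b) F) (i j)
    (hi : ∀ x, f x ≠ i) : EE f g X i j = 0 := by
  simp only [EE, Matrix.mul_assoc]
  rw [Matrix.mul_apply]
  apply Finset.sum_eq_zero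
  intro x _
  simp [JJ, Matrix.one_apply, (hi x).symm]

theorem EE_apply_right (f : Fin a ↪ Fin m) (g : Fin b ↪ Fin n) (X : Matrix (Fin a) (Fin b) F) (i j)
    (hj : ∀ x, g x ≠ j) : EE f g X i j = 0 := by
  simp only [EE]
  rw [Matrix.mul_apply]
  apply Finset.sum_eq_zero
  intro x _
  have := (hj x).symm
  simp [JJ, Matrix.one_apply, this]

theorem EE_split_right {r1 : Fin c ↪ Fin b} {r2 : Fin d ↪ Fin b} (h : Cpl r1 r2)
    (X : Matrix (Fin a) (Fin b) F) :
    X = EE (Function.Embedding.refl _) r1 (X.submatrix id r1) +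
      EE (Function.Embedding.refl _) r2 (X.submatrix id r2) := by
  ext i j
  rw [Matrix.add_apply]
  have e1 := EE_apply_apply (Function.Embedding.refl _) r1 (X.submatrix id r1) i
  have e2 := EE_apply_apply (Function.Embedding.refl _) r2 (X.submatrix id r2) i
  simp only [Function.Embedding.refl_apply] at e1 e2
  rcases h.2 j with ⟨x, rfl⟩ | ⟨x, rfl⟩
  · rw [e1, EE_apply_right _ _ _ _ _ (fun y => (h.1 x y).symm)]; simp
  · rw [e2, EE_apply_right _ _ _ _ _ (fun y => (h.1 y x))]; simp

theorem EE_split_left {r1 : Fin c ↪ Fin a} {r2 : Fin d ↪ Fin a} (h : Cpl r1 r2)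
    (X : Matrix (Fin a) (Fin b) F) :
    X = EE r1 (Function.Embedding.refl _) (X.submatrix r1 id) +
      EE r2 (Function.Embedding.refl _) (X.submatrix r2 id) := by
  ext i j
  rw [Matrix.add_apply]
  have e1 := fun i => EE_apply_apply r1 (Function.Embedding.refl _) (X.submatrix r1 id) i j
  have e2 := fun i => EE_apply_apply r2 (Function.Embedding.refl _) (X.submatrix r2 id) i j
  simp only [Function.Embedding.refl_apply] at e1 e2
  rcases h.2 i with ⟨x, rfl⟩ | ⟨x, rfl⟩
  · rw [e1, EE_apply_left _ _ _ _ _ (fun y => (h.1 x y).symm)]; simp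
  · rw [e2, EE_apply_left _ _ _ _ _ (fun y => (h.1 y x))]; simp

theorem EE_one_add {f : Fin a ↪ Fin n} {g : Fin b ↪ Fin n} (h : Cpl f g) :
    (1 : Matrix (Fin n) (Fin n) F) = EE f f 1 + EE g g 1 := by
  ext i j
  rw [Matrix.add_apply]
  rcases h.2 i with ⟨x, rfl⟩ | ⟨x, rfl⟩
  · rw [EE_apply_left g g _ _ _ (fun y => (h.1 x y).symm), add_zero]
    rcases h.2 j with ⟨y, rfl⟩ | ⟨y, rfl⟩
    · rw [EE_apply_apply]; simp [Matrix.one_apply]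
    · rw [EE_apply_right _ _ _ _ _ (fun z => h.1 z y)]; simp [Matrix.one_apply, h.1 x y]
  · rw [EE_apply_left f f _ _ _ (fun y => (h.1 y x)), zero_add]
    rcases h.2 j with ⟨y, rfl⟩ | ⟨y, rfl⟩
    · rw [EE_apply_right _ _ _ _ _ (fun z => (h.1 y z).symm)]; simp [Matrix.one_apply, (h.1 y x).symm]
    · rw [EE_apply_apply]; simp [Matrix.one_apply]

/-- block embedding of general linear groups -/
noncomputable def io (f : Fin a ↪ Fin n) : GL (Fin a) F →* GL (Fin n) F :=
  Units.map
    { toFun := fun x => 1 + EE f f (x - 1)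
      map_one' := by simp [EE_zero]
      map_mul' := by
        intro x y
        simp only [mul_add, add_mul, one_mul, mul_one, EE_sub, mul_sub, sub_mul, EE_mul]
        abel }

theorem io_val (f : Fin a ↪ Fin n) (x : GL (Fin a) F) :
    (io f x : Matrix (Fin n) (Fin n) F) = 1 + EE f f (x.val - 1) := rfl

/-- unipotent block subgroups -/
noncomputable def uu (f : Fin a ↪ Fin n) (g : Fin b ↪ Fin n) (h : Disj f g) :
    Multiplicative (Matrix (Fin a) (Fin b) F) →* GL (Fin n) F :=
  MonoidHom.toHomUnits
    { toFun := fun X => 1 + EE f g X.toAdd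
      map_one' := by simp [EE_zero]
      map_mul' := by
        intro x y
        simp only [mul_add, add_mul, one_mul, mul_one, EE_mul_disj _ _ h.symm, toAdd_mul, EE_add]
        abel }

theorem uu_val (f : Fin a ↪ Fin n) (g : Fin b ↪ Fin n) (h : Disj f g) (X) :
    (uu f g h X : Matrix (Fin n) (Fin n) F) = 1 + EE f g X.toAdd := rfl

theorem io_io (f : Fin b ↪ Fin n) (p : Fin a ↪ Fin b) (x : GL (Fin a) F) :
    io f (io p x) = io (cmp f p) x := by
  apply Units.ext
  simp only [io_val, add_sub_cancel_left, EE_EE]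

theorem io_comp (f : Fin b ↪ Fin n) (p : Fin a ↪ Fin b) :
    (io f).comp (io p) = (io (cmp f p) : GL (Fin a) F →* _) := by
  ext1 x; exact io_io f p x

theorem io_uu (f : Fin m ↪ Fin n) (p : Fin a ↪ Fin m) (r : Fin b ↪ Fin m) (h : Disj p r)
    (X : Multiplicative (Matrix (Fin a) (Fin b) F)) :
    io f (uu p r h X) = uu (cmp f p) (cmp f r) (h.cmp_inj f) X := by
  apply Units.ext
  simp only [io_val, uu_val, add_sub_cancel_left, EE_EE]

theorem uu_cmp {f : Fin a ↪ Fin n} {g : Fin b ↪ Fin n} (h : Disj f g) (p : Fin c ↪ Fin a) (r : Fin d ↪ Fin b)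
    (X : Multiplicative (Matrix (Fin c) (Fin d) F)) :
    uu (cmp f p) (cmp g r) (h.cmp p r) X = uu f g h (Multiplicative.ofAdd (EE p r X.toAdd)) := by
  apply Units.ext
  simp only [uu_val, toAdd_ofAdd, EE_EE]

theorem io_uu_left (f : Fin a ↪ Fin n) (g : Fin b ↪ Fin n) (h : Disj f g) (x : GL (Fin a) F)
    (X : Multiplicative (Matrix (Fin a) (Fin b) F)) :
    io f x * uu f g h X = uu f g h (Multiplicative.ofAdd (x.val * X.toAdd)) * io f x := by
  apply Units.ext
  simp only [io_val, uu_val, Units.val_mul, toAdd_ofAdd, mul_add, add_mul, one_mul, mul_one,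
    EE_sub, mul_sub, sub_mul, EE_mul, EE_mul_disj _ _ h.symm, Matrix.one_mul, Matrix.mul_one]
  abel

theorem io_uu_right (f : Fin a ↪ Fin n) (g : Fin b ↪ Fin n) (h : Disj f g) (y : GL (Fin b) F)
    (X : Multiplicative (Matrix (Fin a) (Fin b) F)) :
    io g y * uu f g h X = uu f g h (Multiplicative.ofAdd (X.toAdd * (y⁻¹).val)) * io g y := by
  apply Units.ext
  simp only [io_val, uu_val, Units.val_mul, toAdd_ofAdd, mul_add, add_mul, one_mul, mul_one,
    EE_sub, mul_sub, sub_mul, EE_mul, EE_mul_disj _ _ h.symm, Matrix.mul_assoc, Matrix.mul_one, Matrix.one_mul]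
  have : ((y⁻¹).val : Matrix (Fin b) (Fin b) F) * y.val = 1 := by
    rw [← Units.val_mul]; simp
  rw [this]
  simp only [Matrix.mul_one]
  abel

theorem io_comm {f : Fin a ↪ Fin n} {g : Fin b ↪ Fin n} (h : Disj f g) (x : GL (Fin a) F) (y : GL (Fin b) F) :
    io f x * io g y = io g y * io f x := by
  apply Units.ext
  simp only [io_val, Units.val_mul, mul_add, add_mul, one_mul, mul_one, EE_sub, mul_sub, sub_mul,
    EE_mul_disj _ _ h, EE_mul_disj _ _ h.symm]
  abel

end Emb
end HRV


namespace HRV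

noncomputable instance glFintype {F : Type} [Field F] [Fintype F] {n : ℕ} : Fintype (GL (Fin n) F) :=
  Fintype.ofFinite _

section Perm
variable {F : Type} [Field F] {a b c d m n : ℕ}

/-- permutation matrices -/
noncomputable def pm : Equiv.Perm (Fin n) →* GL (Fin n) F :=
  MonoidHom.toHomUnits
    { toFun := fun r => JJ F r.toEmbedding
      map_one' := by ext i j; rfl
      map_mul' := by
        intro r s
        rw [← JJ_cmp]
        rfl }

theorem pm_val (r : Equiv.Perm (Fin n)) : ((pm r : GL (Fin n) F) : Matrix _ _ F) = JJ F r.toEmbedding := rfl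

theorem pm_mul_EE (r : Equiv.Perm (Fin n)) (f : Fin a ↪ Fin n) (g : Fin b ↪ Fin n) (X : Matrix _ _ F) :
    JJ F r.toEmbedding * (1 + EE f g X) = (1 + EE (cmp r.toEmbedding f) (cmp r.toEmbedding g) X) * JJ F r.toEmbedding := by
  simp only [EE, JJ_cmp, mul_add, add_mul, mul_one, one_mul, Matrix.transpose_mul, Matrix.mul_assoc, JJ_t_mul_self,
    Matrix.mul_one]

theorem pm_io (r : Equiv.Perm (Fin n)) (f : Fin a ↪ Fin n) (x : GL (Fin a) F) :
    pm r * io f x = io (cmp r.toEmbedding f) x * pm r := by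
  apply Units.ext
  simp only [Units.val_mul, pm_val, io_val]
  exact pm_mul_EE _ _ _ _

theorem pm_uu (r : Equiv.Perm (Fin n)) (f : Fin a ↪ Fin n) (g : Fin b ↪ Fin n) (h : Disj f g)
    (X : Multiplicative (Matrix (Fin a) (Fin b) F)) :
    pm r * uu f g h X = uu (cmp r.toEmbedding f) (cmp r.toEmbedding g) (h.cmp_inj _) X * pm r := by
  apply Units.ext
  simp only [Units.val_mul, pm_val, uu_val]
  exact pm_mul_EE _ _ _ _

theorem Cpl.bij {f : Fin a ↪ Fin n} {g : Fin b ↪ Fin n} (h : Cpl f g) :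
    Function.Bijective (Sum.elim f g) := by
  constructor
  · exact f.injective.sumElim g.injective h.1
  · intro x
    rcases h.2 x with ⟨i, hi⟩ | ⟨j, hj⟩
    · exact ⟨Sum.inl i, hi⟩
    · exact ⟨Sum.inr j, hj⟩

noncomputable def Cpl.equiv {f : Fin a ↪ Fin n} {g : Fin b ↪ Fin n} (h : Cpl f g) : Fin a ⊕ Fin b ≃ Fin n :=
  Equiv.ofBijective _ h.bij

theorem Cpl.equiv_inl {f : Fin a ↪ Fin n} {g : Fin b ↪ Fin n} (h : Cpl f g) (i) : h.equiv (Sum.inl i) = f i := rfl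
theorem Cpl.equiv_inr {f : Fin a ↪ Fin n} {g : Fin b ↪ Fin n} (h : Cpl f g) (i) : h.equiv (Sum.inr i) = g i := rfl

theorem Cpl.card {f : Fin a ↪ Fin n} {g : Fin b ↪ Fin n} (h : Cpl f g) : a + b = n := by
  have := Fintype.card_congr h.equiv
  simpa using this

theorem Cpl.exists_perm {f f' : Fin a ↪ Fin n} {g g' : Fin b ↪ Fin n} (h : Cpl f g) (h' : Cpl f' g') :
    ∃ r : Equiv.Perm (Fin n), cmp r.toEmbedding f = f' ∧ cmp r.toEmbedding g = g' := by
  refine ⟨h.equiv.symm.trans h'.equiv, ?_, ?_⟩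
  · ext i
    have : h.equiv.symm (f i) = Sum.inl i := by rw [Equiv.symm_apply_eq]; rfl
    simp [this, h'.equiv_inl]
  · ext i
    have : h.equiv.symm (g i) = Sum.inr i := by rw [Equiv.symm_apply_eq]; rfl
    simp [this, h'.equiv_inr]

theorem Cpl.map {f : Fin a ↪ Fin n} {g : Fin b ↪ Fin n} (h : Cpl f g) (r : Equiv.Perm (Fin n)) :
    Cpl (HRV.cmp r.toEmbedding f) (HRV.cmp r.toEmbedding g) := by
  refine ⟨h.1.cmp_inj _, fun x => ?_⟩
  rcases h.2 (r.symm x) with ⟨i, hi⟩ | ⟨i, hi⟩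
  · left; exact ⟨i, by simp [hi]⟩
  · right; exact ⟨i, by simp [hi]⟩

/-- existence of complements -/
theorem exists_cpl (f : Fin a ↪ Fin n) : ∃ (b : ℕ) (g : Fin b ↪ Fin n), Cpl f g ∧ StrictMono g := by
  classical
  let S : Finset (Fin n) := Finset.univ.filter (fun x => ∀ i, f i ≠ x)
  refine ⟨S.card, (S.orderEmbOfFin rfl).toEmbedding, ⟨?_, ?_⟩, (S.orderEmbOfFin rfl).strictMono⟩
  · intro i j h
    have := S.orderEmbOfFin_mem rfl j
    simp only [S, Finset.mem_filter] at this
    exact this.2 i h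
  · intro x
    by_cases hx : ∃ i, f i = x
    · exact Or.inl hx
    · right
      push Not at hx
      have : x ∈ S := by simp [S]; exact hx
      have h2 := S.range_orderEmbOfFin rfl
      have h3 : x ∈ Set.range (S.orderEmbOfFin rfl) := by rw [h2]; exact this
      obtain ⟨j, hj⟩ := h3
      exact ⟨j, hj⟩

/-- standard complementary embeddings -/
structure Std (f : Fin a ↪ Fin n) (g : Fin b ↪ Fin n) : Prop where
  cpl : Cpl f g
  mf : StrictMono f
  mg : StrictMono g
  lt : ∀ i j, f i < g j

def fI (a b : ℕ) : Fin a ↪ Fin (a + b) := ⟨Fin.castAdd b, Fin.castAdd_injective a b⟩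
def gI (a b : ℕ) : Fin b ↪ Fin (a + b) := ⟨Fin.natAdd a, Fin.natAdd_injective b a⟩

theorem std_fg (a b : ℕ) : Std (fI a b) (gI a b) := by
  refine ⟨⟨?_, ?_⟩, ?_, ?_, ?_⟩
  · intro i j h
    simp [fI, gI, Fin.ext_iff] at h
    omega
  · intro x
    refine Fin.addCases (fun i => Or.inl ⟨i, rfl⟩) (fun i => Or.inr ⟨i, rfl⟩) x
  · intro i j h; exact h
  · intro i j h; simpa [gI] using h
  · intro i j; simp [fI, gI, Fin.lt_def]; omega

theorem exists_std (h : a + b = n) : ∃ (f : Fin a ↪ Fin n) (g : Fin b ↪ Fin n), Std f g := by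
  subst h; exact ⟨_, _, std_fg a b⟩

/-- block upper triangular decomposition -/
theorem block_decomp {f : Fin a ↪ Fin n} {g : Fin b ↪ Fin n} (h : Cpl f g) (x : GL (Fin n) F)
    (hx : ∀ i j, x.val (g i) (f j) = 0) :
    ∃ (p : GL (Fin a) F) (q : GL (Fin b) F) (X : Matrix (Fin a) (Fin b) F),
      p.val = x.val.submatrix f f ∧ q.val = x.val.submatrix g g ∧ X = x.val.submatrix f g * (q⁻¹).val ∧
      x = uu f g h.1 (Multiplicative.ofAdd X) * io f p * io g q := by
  classical
  have hdet : x.val.det = (x.val.submatrix f f).det * (x.val.submatrix g g).det := by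
    rw [← Matrix.det_submatrix_equiv_self h.equiv, ← Matrix.det_fromBlocks_zero₂₁ _ (x.val.submatrix f g)]
    congr 1
    ext i j
    rcases i with i | i <;> rcases j with j | j <;> simp [h.equiv_inl, h.equiv_inr, hx]
  have hu : x.val.det ≠ 0 := by
    have := (Matrix.isUnit_iff_isUnit_det _).1 x.isUnit
    exact this.ne_zero
  rw [hdet] at hu
  have hp : IsUnit (x.val.submatrix f f) := (Matrix.isUnit_iff_isUnit_det _).2 (left_ne_zero_of_mul hu).isUnit
  have hq : IsUnit (x.val.submatrix g g) := (Matrix.isUnit_iff_isUnit_det _).2 (right_ne_zero_of_mul hu).isUnit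
  obtain ⟨p, hp⟩ := hp
  obtain ⟨q, hq⟩ := hq
  refine ⟨p, q, x.val.submatrix f g * (q⁻¹).val, hp, hq, rfl, ?_⟩
  apply Units.ext
  simp only [Units.val_mul, uu_val, io_val, toAdd_ofAdd]
  have e : (1 + EE f g (x.val.submatrix f g * (q⁻¹).val)) * (1 + EE f f (p.val - 1)) * (1 + EE g g (q.val - 1))
      = EE f f p.val + EE f g (x.val.submatrix f g) + EE g g q.val := by
    have e2 : ((q⁻¹).val : Matrix (Fin b) (Fin b) F) * q.val = 1 := by
      rw [← Units.val_mul]; simp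
    simp only [mul_add, add_mul, mul_one, one_mul, EE_mul, EE_mul_disj _ _ h.1, EE_mul_disj _ _ h.1.symm,
      EE_sub, mul_sub, sub_mul, Matrix.mul_assoc, e2, Matrix.mul_one]
    nth_rewrite 1 [EE_one_add (F := F) h]
    abel
  rw [e]
  ext i j
  simp only [Matrix.add_apply]
  rcases h.2 i with ⟨i, rfl⟩ | ⟨i, rfl⟩ <;> rcases h.2 j with ⟨j, rfl⟩ | ⟨j, rfl⟩
  · rw [EE_apply_apply, EE_apply_right _ _ _ _ _ (fun z => (h.1 j z).symm), EE_apply_right _ _ _ _ _ (fun z => (h.1 j z).symm), hp]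
    simp
  · rw [EE_apply_apply, EE_apply_right _ _ _ _ _ (fun z => (h.1 z j)), EE_apply_left _ _ _ _ _ (fun z => (h.1 i z).symm)]
    simp
  · rw [EE_apply_left _ _ _ _ _ (fun z => (h.1 z i)), EE_apply_left _ _ _ _ _ (fun z => (h.1 z i)), 
      EE_apply_right _ _ _ _ _ (fun z => (h.1 j z).symm), hx]
    simp
  · rw [EE_apply_apply, EE_apply_left _ _ _ _ _ (fun z => (h.1 z i)), EE_apply_left _ _ _ _ _ (fun z => (h.1 z i)), hq]
    simp

end Perm

section Eu
variable {F : Type} [Field F] [Fintype F] {a b c d m n : ℕ}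

noncomputable def eu (f : Fin a ↪ Fin n) (g : Fin b ↪ Fin n) (h : Disj f g) : CG (GL (Fin n) F) :=
  avg (uu f g h) 1

theorem eu_left (f : Fin a ↪ Fin n) (g : Fin b ↪ Fin n) (h : Disj f g) (X : Multiplicative (Matrix (Fin a) (Fin b) F)) :
    gg (uu f g h X) * eu f g h = eu f g h := by
  rw [eu, avg_left]; simp

theorem eu_right (f : Fin a ↪ Fin n) (g : Fin b ↪ Fin n) (h : Disj f g) (X : Multiplicative (Matrix (Fin a) (Fin b) F)) :
    eu f g h * gg (uu f g h X) = eu f g h := by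
  rw [eu, avg_right]; simp

theorem eu_abs_left (f : Fin a ↪ Fin n) (g : Fin b ↪ Fin n) (h : Disj f g) (x : CG (GL (Fin n) F))
    (hx : ∀ X, gg (uu f g h X) * x = x) : eu f g h * x = x := by
  apply avg_absorb_left; intro X; rw [hx]; simp

theorem eu_abs_right (f : Fin a ↪ Fin n) (g : Fin b ↪ Fin n) (h : Disj f g) (x : CG (GL (Fin n) F))
    (hx : ∀ X, x * gg (uu f g h X) = x) : x * eu f g h = x := by
  apply avg_absorb_right; intro X; rw [hx]; simp

theorem eu_idem (f : Fin a ↪ Fin n) (g : Fin b ↪ Fin n) (h : Disj f g) :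
    eu f g h * eu f g h = (eu f g h : CG (GL (Fin n) F)) := avg_idem _ _

theorem io_eu_left (f : Fin a ↪ Fin n) (g : Fin b ↪ Fin n) (h : Disj f g) (x : GL (Fin a) F) :
    gg (io f x) * eu f g h = eu f g h * gg (io f x) := by
  refine avg_conj _ _ _ _ _
    { toFun := fun X => Multiplicative.ofAdd (x.val * X.toAdd)
      invFun := fun X => Multiplicative.ofAdd ((x⁻¹).val * X.toAdd)
      left_inv := fun X => ?_
      right_inv := fun X => ?_ } ?_ ?_
  · simp [← Matrix.mul_assoc]
  · simp [← Matrix.mul_assoc]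
  · intro X; exact io_uu_left f g h x X
  · intro X; rfl

theorem io_eu_right (f : Fin a ↪ Fin n) (g : Fin b ↪ Fin n) (h : Disj f g) (y : GL (Fin b) F) :
    gg (io g y) * eu f g h = eu f g h * gg (io g y) := by
  refine avg_conj _ _ _ _ _
    { toFun := fun X => Multiplicative.ofAdd (X.toAdd * (y⁻¹).val)
      invFun := fun X => Multiplicative.ofAdd (X.toAdd * y.val)
      left_inv := fun X => ?_
      right_inv := fun X => ?_ } ?_ ?_
  · simp [Matrix.mul_assoc]
  · simp [Matrix.mul_assoc]
  · intro X; exact io_uu_right f g h y X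
  · intro X; rfl

theorem mp_eu_left (f : Fin a ↪ Fin n) (g : Fin b ↪ Fin n) (h : Disj f g) (x : CG (GL (Fin a) F)) :
    mp (io f) x * eu f g h = eu f g h * mp (io f) x :=
  commute_mp_of _ _ (io_eu_left f g h) x

theorem mp_eu_right (f : Fin a ↪ Fin n) (g : Fin b ↪ Fin n) (h : Disj f g) (x : CG (GL (Fin b) F)) :
    mp (io g) x * eu f g h = eu f g h * mp (io g) x :=
  commute_mp_of _ _ (io_eu_right f g h) x

theorem mp_io_comm {f : Fin a ↪ Fin n} {g : Fin b ↪ Fin n} (h : Disj f g) (x : CG (GL (Fin a) F)) (y : CG (GL (Fin b) F)) :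
    mp (io f) x * mp (io g) y = mp (io g) y * mp (io f) x :=
  mp_comm_mp _ _ (fun x y => io_comm h x y) x y

theorem pm_eu (r : Equiv.Perm (Fin n)) (f : Fin a ↪ Fin n) (g : Fin b ↪ Fin n) (h : Disj f g) :
    gg (pm r : GL (Fin n) F) * eu f g h = eu (cmp r.toEmbedding f) (cmp r.toEmbedding g) (h.cmp_inj _) * gg (pm r) := by
  refine avg_conj _ _ _ _ _ (Equiv.refl _) (fun X => pm_uu r f g h X) (fun _ => rfl)

theorem pm_mp (r : Equiv.Perm (Fin n)) (f : Fin a ↪ Fin n) (x : CG (GL (Fin a) F)) :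
    gg (pm r : GL (Fin n) F) * mp (io f) x = mp (io (cmp r.toEmbedding f)) x * gg (pm r) := by
  induction x using CG_induction with
  | h1 g => rw [mp_gg, mp_gg, ← gg_mul, ← gg_mul, pm_io]
  | h2 a b ha hb => rw [map_add, map_add, add_mul, mul_add, ha, hb]
  | h3 c a ha => rw [map_smul, map_smul, smul_mul_assoc, mul_smul_comm, ha]

/-- the basic element -/
noncomputable def eta (f : Fin a ↪ Fin n) (g : Fin b ↪ Fin n) (h : Disj f g)
    (x : CG (GL (Fin a) F)) (y : CG (GL (Fin b) F)) : CG (GL (Fin n) F) :=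
  eu f g h * mp (io f) x * mp (io g) y

theorem pm_eta (r : Equiv.Perm (Fin n)) (f : Fin a ↪ Fin n) (g : Fin b ↪ Fin n) (h : Disj f g)
    (x : CG (GL (Fin a) F)) (y : CG (GL (Fin b) F)) :
    gg (pm r : GL (Fin n) F) * eta f g h x y =
      eta (cmp r.toEmbedding f) (cmp r.toEmbedding g) (h.cmp_inj _) x y * gg (pm r) := by
  simp only [eta]
  rw [← mul_assoc, ← mul_assoc, pm_eu, mul_assoc (eu _ _ _) (gg _), pm_mp, mul_assoc, mul_assoc, mul_assoc, pm_mp]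
  simp only [mul_assoc]

theorem eta_mul (f : Fin a ↪ Fin n) (g : Fin b ↪ Fin n) (h : Disj f g)
    (x x' : CG (GL (Fin a) F)) (y y' : CG (GL (Fin b) F)) :
    eta f g h x y * (mp (io f) x' * mp (io g) y') = eta f g h (x * x') (y * y') := by
  simp only [eta, map_mul]
  calc _ = eu f g h * mp (io f) x * (mp (io g) y * mp (io f) x') * mp (io g) y' := by simp only [mul_assoc]
    _ = _ := by rw [← mp_io_comm h]; simp only [mul_assoc]

theorem mul_eta (f : Fin a ↪ Fin n) (g : Fin b ↪ Fin n) (h : Disj f g)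
    (x x' : CG (GL (Fin a) F)) (y y' : CG (GL (Fin b) F)) :
    (mp (io f) x' * mp (io g) y') * eta f g h x y = eta f g h (x' * x) (y' * y) := by
  simp only [eta, map_mul]
  calc _ = mp (io f) x' * (mp (io g) y' * eu f g h) * mp (io f) x * mp (io g) y := by simp only [mul_assoc]
    _ = (mp (io f) x' * eu f g h) * (mp (io g) y' * mp (io f) x) * mp (io g) y := by
      rw [mp_eu_right]; simp only [mul_assoc]
    _ = _ := by rw [mp_eu_left, ← mp_io_comm h]; simp only [mul_assoc]

theorem eu_mul_eta (f : Fin a ↪ Fin n) (g : Fin b ↪ Fin n) (h : Disj f g)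
    (x : CG (GL (Fin a) F)) (y : CG (GL (Fin b) F)) :
    eu f g h * eta f g h x y = eta f g h x y := by
  simp only [eta, ← mul_assoc, eu_idem]

theorem eta_mul_eu (f : Fin a ↪ Fin n) (g : Fin b ↪ Fin n) (h : Disj f g)
    (x : CG (GL (Fin a) F)) (y : CG (GL (Fin b) F)) :
    eta f g h x y * eu f g h = eta f g h x y := by
  simp only [eta]
  rw [mul_assoc, mp_eu_right, ← mul_assoc, mul_assoc (eu f g h), mp_eu_left, ← mul_assoc, eu_idem]

theorem eta_sum_left {ι : Type} (s : Finset ι) (f : Fin a ↪ Fin n) (g : Fin b ↪ Fin n) (h : Disj f g)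
    (x : ι → CG (GL (Fin a) F)) (y : CG (GL (Fin b) F)) :
    eta f g h (∑ i ∈ s, x i) y = ∑ i ∈ s, eta f g h (x i) y := by
  simp only [eta, map_sum, Finset.mul_sum, Finset.sum_mul]

theorem eta_sum_right {ι : Type} (s : Finset ι) (f : Fin a ↪ Fin n) (g : Fin b ↪ Fin n) (h : Disj f g)
    (x : CG (GL (Fin a) F)) (y : ι → CG (GL (Fin b) F)) :
    eta f g h x (∑ i ∈ s, y i) = ∑ i ∈ s, eta f g h x (y i) := by
  simp only [eta, map_sum, Finset.mul_sum, Finset.sum_mul]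

theorem eta_one_one (f : Fin a ↪ Fin n) (g : Fin b ↪ Fin n) (h : Disj f g) :
    eta f g h 1 1 = (eu f g h : CG (GL (Fin n) F)) := by simp [eta]

/-- the constituent relation -/
def Rel (k : Irr (GL (Fin n) F)) (i : Irr (GL (Fin a) F)) (j : Irr (GL (Fin b) F)) : Prop :=
  ∃ (f : Fin a ↪ Fin n) (g : Fin b ↪ Fin n) (h : Cpl f g), rep k (eta f g h.1 (zz i) (zz j)) ≠ 0

theorem rep_gg_mul_ne {G : Type} [Group G] [Fintype G] (k : Irr G) (g : G) (x : CG G) :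
    rep k (gg g * x) ≠ 0 ↔ rep k x ≠ 0 := by
  rw [not_iff_not]
  constructor
  · intro h
    have : rep k (gg g⁻¹ * (gg g * x)) = 0 := by rw [map_mul, h, mul_zero]
    rwa [← mul_assoc, gg_inv_mul, one_mul] at this
  · intro h
    rw [map_mul, h, mul_zero]

theorem rep_mul_gg_ne {G : Type} [Group G] [Fintype G] (k : Irr G) (g : G) (x : CG G) :
    rep k (x * gg g) ≠ 0 ↔ rep k x ≠ 0 := by
  rw [not_iff_not]
  constructor
  · intro h
    have : rep k ((x * gg g) * gg g⁻¹) = 0 := by rw [map_mul, h, zero_mul]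
    rwa [mul_assoc, gg_mul_inv, mul_one] at this
  · intro h
    rw [map_mul, h, zero_mul]

theorem rep_eta_indep {f f' : Fin a ↪ Fin n} {g g' : Fin b ↪ Fin n} (h : Cpl f g) (h' : Cpl f' g')
    (k : Irr (GL (Fin n) F)) (x : CG (GL (Fin a) F)) (y : CG (GL (Fin b) F))
    (hk : rep k (eta f g h.1 x y) ≠ 0) : rep k (eta f' g' h'.1 x y) ≠ 0 := by
  obtain ⟨r, rfl, rfl⟩ := h.exists_perm h'
  rw [← rep_mul_gg_ne k (pm r), ← pm_eta, rep_gg_mul_ne]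
  exact hk

theorem Rel.all {k : Irr (GL (Fin n) F)} {i : Irr (GL (Fin a) F)} {j : Irr (GL (Fin b) F)} (h : Rel k i j)
    {f : Fin a ↪ Fin n} {g : Fin b ↪ Fin n} (hc : Cpl f g) : rep k (eta f g hc.1 (zz i) (zz j)) ≠ 0 := by
  obtain ⟨f', g', h', hk⟩ := h
  exact rep_eta_indep h' hc k _ _ hk

theorem Rel.card {k : Irr (GL (Fin n) F)} {i : Irr (GL (Fin a) F)} {j : Irr (GL (Fin b) F)} (h : Rel k i j) :
    a + b = n := by
  obtain ⟨f, g, h, _⟩ := h; exact h.card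

theorem exists_rel_of_eu {k : Irr (GL (Fin n) F)} {f : Fin a ↪ Fin n} {g : Fin b ↪ Fin n} (hc : Cpl f g)
    (x : CG (GL (Fin a) F)) (y : CG (GL (Fin b) F))
    (h : rep k (eta f g hc.1 x y) ≠ 0) : ∃ i j, Rel k i j ∧ rep i x ≠ 0 ∧ rep j y ≠ 0 := by
  by_contra! hcon
  apply h
  have hx : x = ∑ i, zz i * x := by rw [← Finset.sum_mul, sum_zz, one_mul]
  have hy : y = ∑ i, zz i * y := by rw [← Finset.sum_mul, sum_zz, one_mul]
  rw [hx, hy, eta_sum_left, map_sum]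
  refine Finset.sum_eq_zero fun i _ => ?_
  rw [eta_sum_right, map_sum]
  refine Finset.sum_eq_zero fun j _ => ?_
  by_cases hi : zz i * x = 0
  · simp [hi, eta]
  by_cases hj : zz j * y = 0
  · simp [hj, eta]
  have hR : ¬ Rel k i j := fun hr => (zz_mul_ne_zero_iff j y).1 hj (hcon i j hr ((zz_mul_ne_zero_iff i x).1 hi))
  rw [← eta_mul, map_mul]
  have : rep k (eta f g hc.1 (zz i) (zz j)) = 0 := by
    by_contra h0; exact hR ⟨f, g, hc, h0⟩
  rw [this, zero_mul]

/-- replacing central idempotents by arbitrary elements acting nontrivially -/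
theorem Rel.eta_ne {k : Irr (GL (Fin n) F)} {i : Irr (GL (Fin a) F)} {j : Irr (GL (Fin b) F)} (h : Rel k i j)
    {f : Fin a ↪ Fin n} {g : Fin b ↪ Fin n} (hc : Cpl f g) {x : CG (GL (Fin a) F)} {y : CG (GL (Fin b) F)}
    (hx : rep i x ≠ 0) (hy : rep j y ≠ 0) : rep k (eta f g hc.1 x y) ≠ 0 := by
  have h0 := h.all hc
  have h1 : rep k (eu f g hc.1 * mp (io f) (zz i)) * ((rep k).comp (mp (io g))) (zz j) ≠ 0 := by
    rw [AlgHom.comp_apply, ← map_mul]; exact h0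
  obtain ⟨b', hb⟩ := exists_group_of_zz_ne_zero j hy _ _ h1
  simp only [AlgHom.comp_apply, ← map_mul, mp_gg] at hb
  have h2 : rep k (eu f g hc.1 * mp (io f) (zz i) * gg (io g b') * mp (io g) y) =
      rep k (gg (io g b') * (mp (io g) y * eu f g hc.1 * mp (io f) (zz i))) := by
    congr 1
    rw [← mp_gg, mul_assoc (eu f g hc.1), mp_io_comm hc.1, ← mul_assoc (eu f g hc.1), ← mp_eu_right]
    simp only [mul_assoc]
    congr 1
    rw [mp_io_comm hc.1, ← mul_assoc, ← mul_assoc, mp_eu_right]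
  rw [h2, rep_gg_mul_ne, map_mul] at hb
  obtain ⟨a', ha⟩ := exists_group_of_zz_ne_zero i hx ((rep k).comp (mp (io f))) _ hb
  simp only [AlgHom.comp_apply, ← map_mul, mp_gg] at ha
  have h3 : mp (io g) y * eu f g hc.1 * gg (io f a') * mp (io f) x = gg (io f a') * eta f g hc.1 x y := by
    rw [mul_assoc (mp (io g) y), ← io_eu_left]
    rw [← mp_gg, ← mul_assoc, ← mp_io_comm hc.1]
    simp only [mul_assoc, eta]
    congr 1
    rw [← mul_assoc, mp_eu_right, mul_assoc, ← mp_io_comm hc.1]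
  rw [h3, rep_gg_mul_ne] at ha
  exact ha

end Eu
end HRV


namespace HRV

section Assoc
variable {F : Type} [Field F] [Fintype F] {a b c d m n : ℕ}

def sumEmb (g : Fin b ↪ Fin n) (h : Fin c ↪ Fin n) (hd : Disj g h) : Fin (b + c) ↪ Fin n :=
  ⟨fun i => Sum.elim g h (finSumFinEquiv.symm i),
    (g.injective.sumElim h.injective hd).comp finSumFinEquiv.symm.injective⟩

theorem sumEmb_f (g : Fin b ↪ Fin n) (h : Fin c ↪ Fin n) (hd : Disj g h) :
    cmp (sumEmb g h hd) (fI b c) = g := by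
  ext i; simp [sumEmb, fI]

theorem sumEmb_g (g : Fin b ↪ Fin n) (h : Fin c ↪ Fin n) (hd : Disj g h) :
    cmp (sumEmb g h hd) (gI b c) = h := by
  ext i; simp [sumEmb, gI]

theorem Disj.rr {f : Fin a ↪ Fin n} {g : Fin b ↪ Fin n} (h : Disj f g) (p : Fin c ↪ Fin b) : Disj f (HRV.cmp g p) :=
  fun i j => h i (p j)
theorem Disj.ll {f : Fin a ↪ Fin n} {g : Fin b ↪ Fin n} (h : Disj f g) (p : Fin c ↪ Fin a) : Disj (HRV.cmp f p) g :=
  fun i j => h (p i) j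

theorem uu_split_right {f : Fin a ↪ Fin n} {K : Fin m ↪ Fin n} (hd : Disj f K) {p : Fin b ↪ Fin m} {r : Fin c ↪ Fin m}
    (hc : Cpl p r) (X : Multiplicative (Matrix (Fin a) (Fin m) F)) :
    ∃ Y Z, uu f K hd X = uu f (cmp K p) (hd.rr p) Y *
      uu f (cmp K r) (hd.rr r) Z := by
  refine ⟨Multiplicative.ofAdd (X.toAdd.submatrix id p), Multiplicative.ofAdd (X.toAdd.submatrix id r), ?_⟩
  apply Units.ext
  simp only [Units.val_mul, uu_val, toAdd_ofAdd]
  conv_lhs => rw [EE_split_right hc X.toAdd]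
  rw [EE_add, EE_EE, EE_EE]
  have : Disj (cmp K p) f := fun i j h => hd j (p i) h.symm
  have e : ∀ (f : Fin a ↪ Fin n), cmp f (Function.Embedding.refl _) = f := fun f => rfl
  simp only [e, mul_add, add_mul, mul_one, one_mul, EE_mul_disj _ _ this]
  abel

theorem uu_split_left {K : Fin m ↪ Fin n} {h : Fin a ↪ Fin n} (hd : Disj K h) {p : Fin b ↪ Fin m} {r : Fin c ↪ Fin m}
    (hc : Cpl p r) (X : Multiplicative (Matrix (Fin m) (Fin a) F)) :
    ∃ Y Z, uu K h hd X = uu (cmp K p) h (hd.ll p) Y *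
      uu (cmp K r) h (hd.ll r) Z := by
  refine ⟨Multiplicative.ofAdd (X.toAdd.submatrix p id), Multiplicative.ofAdd (X.toAdd.submatrix r id), ?_⟩
  apply Units.ext
  simp only [Units.val_mul, uu_val, toAdd_ofAdd]
  conv_lhs => rw [EE_split_left hc X.toAdd]
  rw [EE_add, EE_EE, EE_EE]
  have : Disj h (cmp K r) := fun i j hh => hd (r j) i hh.symm
  have e : ∀ (f : Fin a ↪ Fin n), cmp f (Function.Embedding.refl _) = f := fun f => rfl
  simp only [e, mul_add, add_mul, mul_one, one_mul, EE_mul_disj _ _ this]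
  abel

theorem mp_io_eu (f : Fin m ↪ Fin n) (p : Fin a ↪ Fin m) (r : Fin b ↪ Fin m) (h : Disj p r) :
    mp (io f) (eu p r h : CG (GL (Fin m) F)) = eu (cmp f p) (cmp f r) (h.cmp_inj f) := by
  rw [eu, mp_avg, eu]
  congr 1
  exact MonoidHom.ext fun X => io_uu f p r h X

theorem mp_io_io (f : Fin m ↪ Fin n) (p : Fin a ↪ Fin m) (x : CG (GL (Fin a) F)) :
    mp (io f) (mp (io p) x) = mp (io (cmp f p)) x := by
  rw [mp_mp, io_comp]

theorem mp_io_eta (f : Fin m ↪ Fin n) (p : Fin a ↪ Fin m) (r : Fin b ↪ Fin m) (h : Disj p r)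
    (x : CG (GL (Fin a) F)) (y : CG (GL (Fin b) F)) :
    mp (io f) (eta p r h x y) = eta (cmp f p) (cmp f r) (h.cmp_inj f) x y := by
  simp only [eta, map_mul, mp_io_eu, mp_io_io]

theorem eu_sub_left {f : Fin a ↪ Fin n} {g : Fin b ↪ Fin n} (h : Disj f g) (p : Fin c ↪ Fin a) (r : Fin d ↪ Fin b)
    (X : Multiplicative (Matrix (Fin c) (Fin d) F)) :
    gg (uu (cmp f p) (cmp g r) (h.cmp p r) X) * eu f g h = eu f g h := by
  rw [uu_cmp h, eu_left]

theorem eu_sub_right {f : Fin a ↪ Fin n} {g : Fin b ↪ Fin n} (h : Disj f g) (p : Fin c ↪ Fin a) (r : Fin d ↪ Fin b)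
    (X : Multiplicative (Matrix (Fin c) (Fin d) F)) :
    eu f g h * gg (uu (cmp f p) (cmp g r) (h.cmp p r) X) = eu f g h := by
  rw [uu_cmp h, eu_right]

/-- the two iterated unipotent averages agree -/
theorem eu_assoc {P : Fin m ↪ Fin n} {K : Fin d ↪ Fin n} {f : Fin a ↪ Fin n} {g : Fin b ↪ Fin n} {h : Fin c ↪ Fin n}
    (hPh : Disj P h) (hfK : Disj f K) {p : Fin a ↪ Fin m} {r : Fin b ↪ Fin m} (hpr : Cpl p r)
    {p' : Fin b ↪ Fin d} {r' : Fin c ↪ Fin d} (hpr' : Cpl p' r')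
    (e1 : cmp P p = f) (e2 : cmp P r = g) (e3 : cmp K p' = g) (e4 : cmp K r' = h) (hfg : Disj f g) (hgh : Disj g h) :
    (eu P h hPh * eu f g hfg : CG (GL (Fin n) F)) = eu f K hfK * eu g h hgh := by
  have hfh : Disj f h := by rw [← e1]; exact hPh.cmp p (Function.Embedding.refl _)
  have c1 : (eu P h hPh * eu f g hfg : CG (GL (Fin n) F)) = eu f g hfg * eu P h hPh := by
    subst e1 e2
    rw [← mp_io_eu P p r hpr.1, mp_eu_left]
  have c2 : (eu f K hfK * eu g h hgh : CG (GL (Fin n) F)) = eu g h hgh * eu f K hfK := by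
    have : (eu g h hgh : CG (GL (Fin n) F)) = mp (io K) (eu p' r' hpr'.1) := by
      subst e3 e4
      rw [mp_io_eu]
    rw [this, mp_eu_right]
  have a1 : ∀ X, (eu P h hPh * eu f g hfg : CG (GL (Fin n) F)) * gg (uu f g hfg X) = eu P h hPh * eu f g hfg := by
    intro X; rw [mul_assoc, eu_right]
  have a2 : ∀ X, (eu P h hPh * eu f g hfg : CG (GL (Fin n) F)) * gg (uu f h hfh X) = eu P h hPh * eu f g hfg := by
    intro X; rw [c1, mul_assoc]; congr 1
    subst e1; exact eu_sub_right hPh p (Function.Embedding.refl _) X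
  have a3 : ∀ X, (eu P h hPh * eu f g hfg : CG (GL (Fin n) F)) * gg (uu g h hgh X) = eu P h hPh * eu f g hfg := by
    intro X; rw [c1, mul_assoc]; congr 1
    subst e2; exact eu_sub_right hPh r (Function.Embedding.refl _) X
  have b1 : ∀ X, gg (uu g h hgh X) * (eu f K hfK * eu g h hgh : CG (GL (Fin n) F)) = eu f K hfK * eu g h hgh := by
    intro X; rw [c2, ← mul_assoc, eu_left]
  have b2 : ∀ X, gg (uu f h hfh X) * (eu f K hfK * eu g h hgh : CG (GL (Fin n) F)) = eu f K hfK * eu g h hgh := by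
    intro X; rw [← mul_assoc]; congr 1
    subst e4; exact eu_sub_left hfK (Function.Embedding.refl _) r' X
  have b3 : ∀ X, gg (uu f g hfg X) * (eu f K hfK * eu g h hgh : CG (GL (Fin n) F)) = eu f K hfK * eu g h hgh := by
    intro X; rw [← mul_assoc]; congr 1
    subst e3; exact eu_sub_left hfK (Function.Embedding.refl _) p' X
  have r1 : (eu P h hPh * eu f g hfg : CG (GL (Fin n) F)) * (eu f K hfK * eu g h hgh) = eu P h hPh * eu f g hfg := by
    rw [← mul_assoc]
    rw [eu_abs_right f K hfK _ ?_]
    · exact eu_abs_right g h hgh _ a3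
    · intro X
      obtain ⟨Y, Z, hYZ⟩ := uu_split_right hfK hpr' X
      subst e3 e4
      rw [hYZ, gg_mul, ← mul_assoc, a1, a2]
  have r2 : (eu P h hPh * eu f g hfg : CG (GL (Fin n) F)) * (eu f K hfK * eu g h hgh) = eu f K hfK * eu g h hgh := by
    rw [mul_assoc]
    rw [eu_abs_left f g hfg _ b3]
    · apply eu_abs_left
      intro X
      obtain ⟨Y, Z, hYZ⟩ := uu_split_left hPh hpr X
      subst e1 e2
      rw [hYZ, gg_mul, mul_assoc, b1, b2]
  rw [← r1, r2]

theorem irr_eq_of_rep_zz {G : Type} [Group G] [Fintype G] {i j : Irr G} (h : rep i (zz j) ≠ 0) : i = j := by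
  by_contra h0; exact h (rep_zz_ne h0)

theorem Rel.assoc {k : Irr (GL (Fin n) F)} {s : Irr (GL (Fin m) F)} {l : Irr (GL (Fin c) F)}
    {i : Irr (GL (Fin a) F)} {j : Irr (GL (Fin b) F)} (h1 : Rel k s l) (h2 : Rel s i j) :
    ∃ t : Irr (GL (Fin (b + c)) F), Rel k i t ∧ Rel t j l := by
  obtain ⟨P, h, hc, -⟩ := id h1
  obtain ⟨p, r, hpr, h2⟩ := h2
  have hT := h1.eta_ne hc h2 (y := zz l) (by rw [rep_zz_self]; exact one_ne_zero)
  have hgh : Disj (cmp P r) h := hc.1.cmp r (Function.Embedding.refl _)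
  set K := sumEmb (cmp P r) h hgh with hK
  have hfK : Cpl (cmp P p) K := by
    constructor
    · intro x y
      obtain ⟨z, rfl⟩ := finSumFinEquiv.surjective y
      rcases z with z | z
      · have : K (finSumFinEquiv (Sum.inl z)) = cmp P r z := by simp [hK, sumEmb]
        rw [this]; exact hpr.1.cmp_inj P x z
      · have : K (finSumFinEquiv (Sum.inr z)) = h z := by simp [hK, sumEmb]
        rw [this]; exact hc.1 _ _
    · intro x
      rcases hc.2 x with ⟨y, rfl⟩ | ⟨y, rfl⟩
      · rcases hpr.2 y with ⟨z, rfl⟩ | ⟨z, rfl⟩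
        · exact Or.inl ⟨z, rfl⟩
        · exact Or.inr ⟨finSumFinEquiv (Sum.inl z), by simp [hK, sumEmb]⟩
      · exact Or.inr ⟨finSumFinEquiv (Sum.inr y), by simp [hK, sumEmb]⟩
  have e3 : cmp K (fI b c) = cmp P r := sumEmb_f _ _ _
  have e4 : cmp K (gI b c) = h := sumEmb_g _ _ _
  have hs := (std_fg b c).cpl
  have key : eta P h hc.1 (eta p r hpr.1 (zz i) (zz j)) (zz l) =
      eta (cmp P p) K hfK.1 (zz i) (eta (fI b c) (gI b c) hs.1 (zz j) (zz l)) := by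
    rw [eta.eq_1 P h, eta.eq_1 (cmp P p) K, mp_io_eta, mp_io_eta]
    have hA := eu_assoc (F := F) hc.1 hfK.1 hpr hs rfl rfl e3 e4 (hpr.1.cmp_inj P) hgh
    have hgen : ∀ (g' : Fin b ↪ Fin n) (h' : Fin c ↪ Fin n) (hh : Disj g' h'), g' = cmp P r → h' = h →
        mp (io (cmp P p)) (zz i) * eta g' h' hh (zz j) (zz l) =
          eta (cmp P r) h hgh (zz j) (zz l) * mp (io (cmp P p)) (zz i) := by
      rintro g' h' hh rfl rfl
      have hfh : Disj (cmp P p) h' := hc.1.cmp p (Function.Embedding.refl _)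
      have hfg : Disj (cmp P p) (cmp P r) := hpr.1.cmp_inj P
      have : (eu (cmp P r) h' hh : CG (GL (Fin n) F)) = mp (io K) (eu (fI b c) (gI b c) hs.1) := by
        rw [mp_io_eu]; congr 1 <;> [exact e3.symm; exact e4.symm]
      rw [eta, this, ← mul_assoc, ← mul_assoc, mp_io_comm hfK.1, mul_assoc (mp (io K) _), mp_io_comm hfg, mul_assoc,
        mul_assoc, mp_io_comm hfh]
      simp only [mul_assoc]
    rw [mul_assoc (eu (cmp P p) K _), hgen _ _ _ e3 e4]
    rw [eta, eta, ← mul_assoc, ← mul_assoc, ← mul_assoc, ← mul_assoc, hA]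
    have hfh : Disj (cmp P p) h := hc.1.cmp p (Function.Embedding.refl _)
    have hfg : Disj (cmp P p) (cmp P r) := hpr.1.cmp_inj P
    simp only [mul_assoc]
    congr 2
    rw [← mul_assoc, mp_io_comm hfg, mul_assoc, mp_io_comm hfh]
  rw [key] at hT
  obtain ⟨i', t, hr, hi', ht⟩ := exists_rel_of_eu hfK _ _ hT
  rw [irr_eq_of_rep_zz hi'] at hr
  exact ⟨t, hr, _, _, hs, ht⟩

end Assoc
end HRV


namespace HRV

section UT
variable {F : Type} [Field F] [Fintype F] {a b c d m n : ℕ}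

/-- unitriangular matrices -/
def ut (M : Matrix (Fin n) (Fin n) F) : Prop := ∀ i j, j ≤ i → M i j = (1 : Matrix (Fin n) (Fin n) F) i j

theorem ut_mul_aux {x y : Matrix (Fin n) (Fin n) F} (hx : ut x) (hy : ut y) {i j : Fin n} (hij : j ≤ i) :
    (x * y) i j = y i j := by
  rw [Matrix.mul_apply, Finset.sum_eq_single i]
  · rw [hx i i le_rfl]; simp
  · intro k _ hk
    rcases lt_or_gt_of_ne hk with h | h
    · rw [hx i k h.le, Matrix.one_apply_ne h.ne', zero_mul]
    · rw [hy k j (hij.trans h.le), Matrix.one_apply_ne (lt_of_le_of_lt hij h).ne', mul_zero]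
  · simp

theorem ut_mul {x y : Matrix (Fin n) (Fin n) F} (hx : ut x) (hy : ut y) : ut (x * y) := by
  intro i j hij
  rw [ut_mul_aux hx hy hij, hy i j hij]

theorem ut_one : ut (1 : Matrix (Fin n) (Fin n) F) := fun i j _ => rfl

/-- the unitriangular group -/
def NN (F : Type) [Field F] [Fintype F] (n : ℕ) : Subgroup (GL (Fin n) F) where
  carrier := {x | ut x.val}
  mul_mem' := fun hx hy => ut_mul hx hy
  one_mem' := ut_one
  inv_mem' := by
    intro x hx
    have h1 : ∀ k : ℕ, ut (x ^ k).val := by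
      intro k
      induction k with
      | zero => simpa using ut_one
      | succ k ih => rw [pow_succ]; exact ut_mul ih hx
    have h2 : x⁻¹ = x ^ (orderOf x - 1) := by
      rw [inv_eq_iff_mul_eq_one, ← pow_succ', Nat.sub_add_cancel (orderOf_pos x), pow_orderOf_eq_one]
    show ut (x⁻¹).val
    rw [h2]; exact h1 _

theorem mem_NN {x : GL (Fin n) F} : x ∈ NN F n ↔ ut x.val := Iff.rfl

noncomputable instance : Fintype (NN F n) := Fintype.ofFinite _

theorem io_apply (f : Fin a ↪ Fin n) (x : GL (Fin a) F) (i j : Fin a) :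
    (io f x).val (f i) (f j) = x.val i j := by
  rw [io_val, Matrix.add_apply, EE_apply_apply]
  simp [Matrix.one_apply]

theorem io_apply_left (f : Fin a ↪ Fin n) (x : GL (Fin a) F) (i j : Fin n) (hi : ∀ y, f y ≠ i) :
    (io f x).val i j = (1 : Matrix (Fin n) (Fin n) F) i j := by
  rw [io_val, Matrix.add_apply, EE_apply_left _ _ _ _ _ hi]; simp

theorem io_apply_right (f : Fin a ↪ Fin n) (x : GL (Fin a) F) (i j : Fin n) (hi : ∀ y, f y ≠ j) :
    (io f x).val i j = (1 : Matrix (Fin n) (Fin n) F) i j := by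
  rw [io_val, Matrix.add_apply, EE_apply_right _ _ _ _ _ hi]; simp

theorem io_NN {f : Fin a ↪ Fin n} (hf : StrictMono f) {x : GL (Fin a) F} (hx : x ∈ NN F a) : io f x ∈ NN F n := by
  intro i j hij
  by_cases hi : ∃ y, f y = i
  · by_cases hj : ∃ y, f y = j
    · obtain ⟨y, rfl⟩ := hi
      obtain ⟨z, rfl⟩ := hj
      rw [io_apply, hx y z (hf.le_iff_le.1 hij)]
      simp [Matrix.one_apply]
    · push Not at hj; exact io_apply_right _ _ _ _ hj
  · push Not at hi; exact io_apply_left _ _ _ _ hi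

theorem uu_apply (f : Fin a ↪ Fin n) (g : Fin b ↪ Fin n) (h : Disj f g) (X : Multiplicative (Matrix (Fin a) (Fin b) F)) (i j) :
    (uu f g h X).val (f i) (g j) = X.toAdd i j := by
  rw [uu_val, Matrix.add_apply, EE_apply_apply]
  simp [Matrix.one_apply, h i j]

theorem uu_apply_left (f : Fin a ↪ Fin n) (g : Fin b ↪ Fin n) (h : Disj f g) (X : Multiplicative (Matrix (Fin a) (Fin b) F)) (i j)
    (hi : ∀ y, f y ≠ i) : (uu f g h X).val i j = (1 : Matrix (Fin n) (Fin n) F) i j := by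
  rw [uu_val, Matrix.add_apply, EE_apply_left _ _ _ _ _ hi]; simp

theorem uu_apply_right (f : Fin a ↪ Fin n) (g : Fin b ↪ Fin n) (h : Disj f g) (X : Multiplicative (Matrix (Fin a) (Fin b) F)) (i j)
    (hi : ∀ y, g y ≠ j) : (uu f g h X).val i j = (1 : Matrix (Fin n) (Fin n) F) i j := by
  rw [uu_val, Matrix.add_apply, EE_apply_right _ _ _ _ _ hi]; simp

/-- `X` only has entries above the diagonal -/
theorem uu_NN {f : Fin a ↪ Fin n} {g : Fin b ↪ Fin n} (h : Disj f g) {X : Multiplicative (Matrix (Fin a) (Fin b) F)}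
    (hX : ∀ i j, g j < f i → X.toAdd i j = 0) : uu f g h X ∈ NN F n := by
  intro i j hij
  by_cases hi : ∃ y, f y = i
  · by_cases hj : ∃ y, g y = j
    · obtain ⟨y, rfl⟩ := hi
      obtain ⟨z, rfl⟩ := hj
      rw [uu_apply, hX y z (lt_of_le_of_ne hij (h y z).symm), Matrix.one_apply_ne (h y z)]
    · push Not at hj; exact uu_apply_right _ _ _ _ _ _ hj
  · push Not at hi; exact uu_apply_left _ _ _ _ _ _ hi

theorem NN_block_zero {f : Fin a ↪ Fin n} {g : Fin b ↪ Fin n} (h : Std f g) {x : GL (Fin n) F} (hx : x ∈ NN F n) (i j) :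
    x.val (g i) (f j) = 0 := by
  rw [hx _ _ (h.lt j i).le, Matrix.one_apply_ne (h.lt j i).ne']

/-- monomial matrices -/
def Mon (r : Equiv.Perm (Fin n)) (x : GL (Fin n) F) : Prop := ∀ i j, i ≠ r j → x.val i j = 0

theorem Mon.mul {r s : Equiv.Perm (Fin n)} {x y : GL (Fin n) F} (hx : Mon r x) (hy : Mon s y) : Mon (r * s) (x * y) := by
  intro i j hij
  rw [Units.val_mul, Matrix.mul_apply]
  refine Finset.sum_eq_zero fun k _ => ?_
  by_cases hk : k = s j
  · rw [hx i k (by rw [hk]; exact hij), zero_mul]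
  · rw [hy k j hk, mul_zero]

theorem mon_pm (r : Equiv.Perm (Fin n)) : Mon r (pm r : GL (Fin n) F) := by
  intro i j hij
  rw [pm_val]
  simp [JJ, Matrix.one_apply, hij]

theorem pm_mul_apply (w : Equiv.Perm (Fin n)) (y : GL (Fin n) F) (p q) : (pm w * y).val (w p) q = y.val p q := by
  rw [Units.val_mul, Matrix.mul_apply, Finset.sum_eq_single p]
  · have : (pm w : GL (Fin n) F).val (w p) p = 1 := by
      rw [pm_val]; simp [JJ, Matrix.one_apply]
    rw [this, one_mul]
  · intro b _ hb
    rw [mon_pm w _ _ (fun h => hb (w.injective h).symm), zero_mul]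
  · simp

theorem Mon.io {r : Equiv.Perm (Fin a)} {x : GL (Fin a) F} (hx : Mon r x) (f : Fin a ↪ Fin n) :
    Mon (r.viaFintypeEmbedding f) (io f x) := by
  intro i j hij
  by_cases hi : ∃ y, f y = i
  · by_cases hj : ∃ y, f y = j
    · obtain ⟨y, rfl⟩ := hi
      obtain ⟨z, rfl⟩ := hj
      rw [io_apply]
      apply hx
      rintro rfl
      exact hij (by rw [Equiv.Perm.viaFintypeEmbedding_apply_image])
    · push Not at hj
      rw [io_apply_right _ _ _ _ hj]
      rw [Equiv.Perm.viaFintypeEmbedding_apply_notMem_range _ _ (by rintro ⟨y, hy⟩; exact hj y hy)] at hij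
      exact Matrix.one_apply_ne hij
  · push Not at hi
    rw [io_apply_left _ _ _ _ hi]
    apply Matrix.one_apply_ne
    rintro rfl
    rw [Equiv.Perm.viaFintypeEmbedding_apply_notMem_range _ _ (by rintro ⟨y, hy⟩; exact hi y hy)] at hij
    exact hij rfl

theorem Mon.ne_zero {r : Equiv.Perm (Fin n)} {x : GL (Fin n) F} (hx : Mon r x) (j) : x.val (r j) j ≠ 0 := by
  intro h0
  have h1 : x.val.det ≠ 0 := ((Matrix.isUnit_iff_isUnit_det _).1 x.isUnit).ne_zero
  apply h1
  apply Matrix.det_eq_zero_of_column_eq_zero j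
  intro i
  by_cases hi : i = r j
  · rw [hi, h0]
  · exact hx i j hi

def succE (n : ℕ) : Fin n ↪ Fin (n + 1) := ⟨Fin.succ, Fin.succ_injective n⟩
def ptE (i : Fin n) : Fin 1 ↪ Fin n := ⟨fun _ => i, fun _ _ _ => Subsingleton.elim _ _⟩
def sabE (i : Fin (n + 1)) : Fin n ↪ Fin (n + 1) := ⟨i.succAbove, Fin.succAbove_right_injective⟩

theorem cpl_sab (i : Fin (n + 1)) : Cpl (sabE i) (ptE i) := by
  refine ⟨fun x y => Fin.succAbove_ne i x, fun x => ?_⟩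
  by_cases h : x = i
  · exact Or.inr ⟨0, h.symm⟩
  · left
    obtain ⟨y, hy⟩ := Fin.exists_succAbove_eq h
    exact ⟨y, hy⟩

theorem succE_eq : succE n = sabE 0 := by ext; simp [succE, sabE]

theorem bruhat : ∀ {n : ℕ} (x : GL (Fin n) F), ∃ u v : GL (Fin n) F, ∃ r m, u ∈ NN F n ∧ v ∈ NN F n ∧ Mon r m ∧
    x = u * m * v := by
  intro n
  induction n with
  | zero =>
    intro x
    exact ⟨1, 1, 1, x, one_mem _, one_mem _, fun i => i.elim0, by simp⟩
  | succ n ih =>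
    intro x
    classical
    -- pivot
    have hne : (Finset.univ.filter fun i => x.val i 0 ≠ 0).Nonempty := by
      by_contra h
      rw [Finset.not_nonempty_iff_eq_empty] at h
      have h1 : x.val.det ≠ 0 := ((Matrix.isUnit_iff_isUnit_det _).1 x.isUnit).ne_zero
      apply h1
      apply Matrix.det_eq_zero_of_column_eq_zero 0
      intro i
      by_contra hi
      have : i ∈ (Finset.univ.filter fun i => x.val i 0 ≠ 0) := by simpa using hi
      rw [h] at this
      simp at this
    set i := (Finset.univ.filter fun i => x.val i 0 ≠ 0).max' hne with hi
    have hi0 : x.val i 0 ≠ 0 := by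
      have := Finset.max'_mem _ hne
      simpa using this
    have himax : ∀ j, i < j → x.val j 0 = 0 := by
      intro j hj
      by_contra h
      have : j ≤ i := Finset.le_max' _ _ (by simpa using h)
      exact absurd hj this.not_gt
    -- clear column
    let X : Matrix (Fin n) (Fin 1) F := fun y _ => - x.val (i.succAbove y) 0 / x.val i 0
    let u := uu (sabE i) (ptE i) (cpl_sab i).1 (Multiplicative.ofAdd X)
    have hu : u ∈ NN F (n + 1) := by
      apply uu_NN
      intro y z hyz
      show - x.val (i.succAbove y) 0 / x.val i 0 = 0
      rw [himax _ (show i < i.succAbove y from hyz)]; simp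
    have huval : ∀ p q, (u * x).val p q = x.val p q + ∑ y, (if p = i.succAbove y then X y 0 * x.val i q else 0) := by
      intro p q
      rw [Units.val_mul, uu_val, Matrix.add_mul, Matrix.one_mul, Matrix.add_apply]
      congr 1
      rw [EE, Matrix.mul_assoc, Matrix.mul_assoc, Matrix.mul_apply]
      refine Finset.sum_congr rfl fun y _ => ?_
      simp only [JJ, Matrix.mul_apply, Matrix.submatrix_apply, Matrix.one_apply, Matrix.transpose_apply, toAdd_ofAdd, sabE, ptE]
      simp
      rfl
    have hcol : ∀ p, p ≠ i → (u * x).val p 0 = 0 := by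
      intro p hp
      obtain ⟨y, rfl⟩ := Fin.exists_succAbove_eq hp
      rw [huval]
      rw [Finset.sum_eq_single y]
      · simp only [X, if_true]; field_simp; ring
      · intro z _ hz; rw [if_neg]; intro h; exact hz (Fin.succAbove_right_injective h).symm
      · simp
    have hrow : ∀ q, (u * x).val i q = x.val i q := by
      intro q
      rw [huval, Finset.sum_eq_zero, add_zero]
      intro y _
      rw [if_neg (Fin.succAbove_ne i y).symm]
    set x1 := u * x with hx1
    let Y : Matrix (Fin 1) (Fin n) F := fun _ y => - x.val i y.succ / x.val i 0
    let v := uu (ptE 0) (succE n) (by rw [succE_eq]; exact (cpl_sab 0).1.symm) (Multiplicative.ofAdd Y)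
    have hv : v ∈ NN F (n + 1) := by
      apply uu_NN
      intro y z hyz
      exact absurd hyz (by show ¬ (Fin.succ z < 0); exact Fin.not_lt_zero _)
    have hvval : ∀ p q, (x1 * v).val p q = x1.val p q + ∑ y, (if q = Fin.succ y then x1.val p 0 * Y 0 y else 0) := by
      intro p q
      rw [Units.val_mul, uu_val, Matrix.mul_add, Matrix.mul_one, Matrix.add_apply]
      congr 1
      rw [EE, ← Matrix.mul_assoc, ← Matrix.mul_assoc, Matrix.mul_apply]
      refine Finset.sum_congr rfl fun y _ => ?_
      simp only [JJ, Matrix.mul_apply, Matrix.submatrix_apply, Matrix.one_apply, Matrix.transpose_apply, toAdd_ofAdd, succE, ptE]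
      simp
      rfl
    have hcol2 : ∀ p, p ≠ i → (x1 * v).val p 0 = 0 := by
      intro p hp
      rw [hvval, hcol p hp]
      simp
    have hrow2 : ∀ q, q ≠ 0 → (x1 * v).val i q = 0 := by
      intro q hq
      obtain ⟨y, rfl⟩ := Fin.exists_succ_eq.2 hq
      rw [hvval, hrow, hrow]
      rw [Finset.sum_eq_single y]
      · simp only [Y, if_true]; field_simp; ring
      · intro z _ hz; rw [if_neg]; intro h; exact hz (Fin.succ_injective _ h).symm
      · simp
    obtain ⟨w, hw1, hw2⟩ := (cpl_sab (0 : Fin (n + 1))).exists_perm (cpl_sab i)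
    have hw1' : ∀ y, w ((0 : Fin (n+1)).succAbove y) = i.succAbove y := fun y => DFunLike.congr_fun hw1 y
    have hw2' : w 0 = i := DFunLike.congr_fun hw2 0
    have hy : ∀ p q, ((pm w)⁻¹ * (x1 * v)).val p q = (x1 * v).val (w p) q := by
      intro p q
      have e := pm_mul_apply w ((pm w)⁻¹ * (x1 * v)) p q
      rw [← e, mul_inv_cancel_left]
    obtain ⟨p, q, Z, hp, hq, hZ, hdec⟩ := block_decomp (cpl_sab (0 : Fin (n+1))) ((pm w)⁻¹ * (x1 * v)) (by
      intro y z
      rw [hy]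
      show (x1 * v).val (w 0) _ = 0
      rw [hw2']
      exact hrow2 _ (Fin.succAbove_ne 0 z))
    have hZ0 : Z = 0 := by
      rw [hZ]
      convert Matrix.zero_mul _
      ext y z
      rw [Matrix.submatrix_apply, hy]
      show (x1 * v).val (w ((0 : Fin (n+1)).succAbove y)) 0 = 0
      rw [hw1']
      exact hcol2 _ (Fin.succAbove_ne i y)
    obtain ⟨u', v', r, m, hu', hv', hm, rfl⟩ := ih p
    have hmq : ∃ s, Mon s (io (ptE (0 : Fin (n+1))) q) := by
      refine ⟨_, Mon.io (r := 1) ?_ _⟩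
      intro i j hij
      exact absurd (Subsingleton.elim _ _) hij
    obtain ⟨s, hs⟩ := hmq
    have hmono : ∀ i : Fin (n + 1), StrictMono (sabE i) := fun i => Fin.strictMono_succAbove i
    refine ⟨u⁻¹ * io (sabE i) u', io (sabE 0) v' * v⁻¹, _, pm w * io (sabE 0) m * io (ptE 0) q,
      mul_mem (inv_mem hu) (io_NN (hmono i) hu'), mul_mem (io_NN (hmono 0) hv') (inv_mem hv),
      ((mon_pm w).mul (hm.io _)).mul hs, ?_⟩
    have e1 : x1 * v = pm w * (io (sabE 0) (u' * m * v') * io (ptE 0) q) := by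
      rw [hZ0] at hdec
      have : uu (sabE (0 : Fin (n+1))) (ptE 0) (cpl_sab 0).1 (Multiplicative.ofAdd (0 : Matrix (Fin n) (Fin 1) F)) = 1 := by
        rw [ofAdd_zero, map_one]
      rw [this, one_mul] at hdec
      rw [← hdec]; simp
    have e2 : x = u⁻¹ * (x1 * v) * v⁻¹ := by rw [hx1]; group
    rw [e2, e1, map_mul, map_mul]
    have e3 : io (sabE 0) v' * io (ptE 0) q = io (ptE 0) q * io (sabE (0 : Fin (n+1))) v' := io_comm (cpl_sab 0).1 _ _
    have e4 : pm w * io (sabE 0) u' = io (sabE i) u' * (pm w : GL (Fin (n+1)) F) := by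
      rw [pm_io, hw1]
    calc _ = u⁻¹ * (pm w * io (sabE 0) u') * io (sabE 0) m * (io (sabE 0) v' * io (ptE 0) q) * v⁻¹ := by
          simp only [mul_assoc]
      _ = _ := by rw [e3, e4]; simp only [mul_assoc]

end UT
end HRV


namespace HRV

section DC
variable {F : Type} [Field F] [Fintype F] {a b c d a' b' m n : ℕ}

theorem bruhat_std {f : Fin a ↪ Fin n} {g : Fin b ↪ Fin n} (h : Std f g) (x : GL (Fin n) F) :
    ∃ u ∈ NN F n, ∃ (r : Equiv.Perm (Fin n)) (y : GL (Fin n) F), (∀ i j, y.val (g i) (f j) = 0) ∧ x = u * pm r * y := by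
  obtain ⟨u, v, r, m, hu, hv, hm, rfl⟩ := bruhat x
  refine ⟨u, hu, r, (pm r)⁻¹ * m * v, ?_, by group⟩
  have h1 : Mon 1 ((pm r)⁻¹ * m) := by
    have := (mon_pm (F := F) r⁻¹).mul hm
    rwa [inv_mul_cancel, map_inv] at this
  intro i j
  rw [Units.val_mul, Matrix.mul_apply]
  refine Finset.sum_eq_zero fun k _ => ?_
  by_cases hk : g i = k
  · rw [← hk, NN_block_zero h hv, mul_zero]
  · rw [h1 _ _ hk, zero_mul]

theorem gg_eta {f : Fin a ↪ Fin n} {g : Fin b ↪ Fin n} (h : Cpl f g) (y : GL (Fin n) F)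
    (hy : ∀ i j, y.val (g i) (f j) = 0) : ∃ p q, ∀ x z, gg y * eta f g h.1 x z = eta f g h.1 (gg p * x) (gg q * z) := by
  obtain ⟨p, q, X, -, -, -, rfl⟩ := block_decomp h y hy
  refine ⟨p, q, fun x z => ?_⟩
  rw [mul_assoc, gg_mul, gg_mul, ← mp_gg (io f), ← mp_gg (io g), mul_assoc, mul_eta, ← eu_mul_eta, ← mul_assoc, eu_left]

theorem eta_gg {f : Fin a ↪ Fin n} {g : Fin b ↪ Fin n} (h : Cpl f g) (y : GL (Fin n) F)
    (hy : ∀ i j, y.val (g i) (f j) = 0) : ∃ p q, ∀ x z, eta f g h.1 x z * gg y = eta f g h.1 (x * gg p) (z * gg q) := by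
  obtain ⟨p, q, X, -, -, -, rfl⟩ := block_decomp h y hy
  refine ⟨p, q, fun x z => ?_⟩
  rw [mul_assoc, gg_mul, gg_mul, ← mp_gg (io f), ← mp_gg (io g), ← mul_assoc, ← eta_mul_eu, mul_assoc (eta _ _ _ _ _),
    eu_right, eta_mul_eu, eta_mul]

theorem exists_pullback (f : Fin a ↪ Fin n) (g : Fin b ↪ Fin n) : ∃ (c : ℕ) (p : Fin c ↪ Fin a) (q : Fin c ↪ Fin b),
    cmp f p = cmp g q ∧ ∀ x y, f x = g y → ∃ z, p z = x ∧ q z = y := by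
  classical
  let T := {t : Fin a × Fin b // f t.1 = g t.2}
  let e : T ≃ Fin (Fintype.card T) := Fintype.equivFin T
  refine ⟨Fintype.card T, ⟨fun z => (e.symm z).1.1, ?_⟩, ⟨fun z => (e.symm z).1.2, ?_⟩, ?_, ?_⟩
  · intro z w h
    apply e.symm.injective
    have h1 := (e.symm z).2; have h2 := (e.symm w).2
    apply Subtype.ext
    refine Prod.ext h (g.injective ?_)
    rw [← h1, ← h2]; exact congrArg f h
  · intro z w h
    apply e.symm.injective
    have h1 := (e.symm z).2; have h2 := (e.symm w).2
    apply Subtype.ext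
    refine Prod.ext (f.injective ?_) h
    rw [h1, h2]; exact congrArg g h
  · ext z; exact congrArg Fin.val (e.symm z).2
  · intro x y h
    refine ⟨e ⟨(x, y), h⟩, ?_, ?_⟩
    · show (e.symm (e ⟨(x, y), h⟩)).1.1 = x; rw [e.symm_apply_apply]
    · show (e.symm (e ⟨(x, y), h⟩)).1.2 = y; rw [e.symm_apply_apply]

theorem abs_ring {R : Type} [Ring R] {e' e1 Z L S A B : R} (hL : L = Z*A) (hS : S = B*Z) (hA : A*e1=e1) (hB : e'*B=e')
    (cL : L*e' = e'*L) (cS : S*e1=e1*S) (cZ1 : Z*e1=e1*Z) (cZ' : Z*e'=e'*Z) (hZ : Z*Z=Z) : L*e'*e1*S = e'*e1*Z := by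
  calc L*e'*e1*S = e' * L * e1 * S := by rw [cL]
    _ = e' * Z * (A * e1) * S := by rw [hL]; simp only [mul_assoc]
    _ = Z * e' * (e1 * S) := by rw [hA, cZ']; simp only [mul_assoc]
    _ = Z * (e' * B) * Z * e1 := by rw [← cS, hS]; simp only [mul_assoc]
    _ = e' * (Z * Z) * e1 := by rw [hB, cZ']; simp only [mul_assoc]
    _ = _ := by rw [hZ, mul_assoc, cZ1, mul_assoc]

theorem rep_ins {k : Irr (GL (Fin n) F)} (f : Fin a ↪ Fin n) (A B : CG (GL (Fin n) F)) (h : rep k (A * B) ≠ 0) :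
    ∃ p, rep k (A * mp (io f) (zz p) * B) ≠ 0 := by
  have : A * B = ∑ p, A * mp (io f) (zz p) * B := by
    rw [← Finset.sum_mul, ← Finset.mul_sum, ← map_sum, sum_zz, map_one, mul_one]
  rw [this, map_sum] at h
  obtain ⟨p, -, hp⟩ := Finset.exists_ne_zero_of_sum_ne_zero h
  exact ⟨p, hp⟩

theorem refine_aux {k : Irr (GL (Fin n) F)} {i : Irr (GL (Fin a) F)} {j : Irr (GL (Fin b) F)}
    {i' : Irr (GL (Fin a') F)} {j' : Irr (GL (Fin b') F)} {f : Fin a ↪ Fin n} {g : Fin b ↪ Fin n} (hc : Cpl f g)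
    {f' : Fin a' ↪ Fin n} {g' : Fin b' ↪ Fin n} (hc' : Cpl f' g')
    (h : rep k (eta f' g' hc'.1 (zz i') (zz j') * eta f g hc.1 (zz i) (zz j)) ≠ 0) :
    ∃ (α β γ δ : ℕ) (p : Irr (GL (Fin α) F)) (q : Irr (GL (Fin β) F)) (r : Irr (GL (Fin γ) F)) (s : Irr (GL (Fin δ) F)),
      Rel i p q ∧ Rel j r s ∧ Rel i' p r ∧ Rel j' q s := by
  obtain ⟨α, aP, bP, eP, cP⟩ := exists_pullback f' f
  obtain ⟨β, aQ, bQ, eQ, cQ⟩ := exists_pullback g' f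
  obtain ⟨γ, aR, bR, eR, cR⟩ := exists_pullback f' g
  obtain ⟨δ, aS, bS, eS, cS⟩ := exists_pullback g' g
  have eP' : ∀ z, f' (aP z) = f (bP z) := fun z => DFunLike.congr_fun eP z
  have eQ' : ∀ z, g' (aQ z) = f (bQ z) := fun z => DFunLike.congr_fun eQ z
  have eR' : ∀ z, f' (aR z) = g (bR z) := fun z => DFunLike.congr_fun eR z
  have eS' : ∀ z, g' (aS z) = g (bS z) := fun z => DFunLike.congr_fun eS z
  have aPR : Cpl aP aR := by
    refine ⟨fun x y hxy => hc.1 (bP x) (bR y) (by rw [← eP', ← eR', hxy]), fun x => ?_⟩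
    rcases hc.2 (f' x) with ⟨y, hy⟩ | ⟨y, hy⟩
    · obtain ⟨z, hz, -⟩ := cP x y hy.symm; exact Or.inl ⟨z, hz⟩
    · obtain ⟨z, hz, -⟩ := cR x y hy.symm; exact Or.inr ⟨z, hz⟩
  have aQS : Cpl aQ aS := by
    refine ⟨fun x y hxy => hc.1 (bQ x) (bS y) (by rw [← eQ', ← eS', hxy]), fun x => ?_⟩
    rcases hc.2 (g' x) with ⟨y, hy⟩ | ⟨y, hy⟩
    · obtain ⟨z, hz, -⟩ := cQ x y hy.symm; exact Or.inl ⟨z, hz⟩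
    · obtain ⟨z, hz, -⟩ := cS x y hy.symm; exact Or.inr ⟨z, hz⟩
  have bPQ : Cpl bP bQ := by
    refine ⟨fun x y hxy => hc'.1 (aP x) (aQ y) (by rw [eP', eQ', hxy]), fun x => ?_⟩
    rcases hc'.2 (f x) with ⟨y, hy⟩ | ⟨y, hy⟩
    · obtain ⟨z, -, hz⟩ := cP y x hy; exact Or.inl ⟨z, hz⟩
    · obtain ⟨z, -, hz⟩ := cQ y x hy; exact Or.inr ⟨z, hz⟩
  have bRS : Cpl bR bS := by
    refine ⟨fun x y hxy => hc'.1 (aR x) (aS y) (by rw [eR', eS', hxy]), fun x => ?_⟩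
    rcases hc'.2 (g x) with ⟨y, hy⟩ | ⟨y, hy⟩
    · obtain ⟨z, -, hz⟩ := cR y x hy; exact Or.inl ⟨z, hz⟩
    · obtain ⟨z, -, hz⟩ := cS y x hy; exact Or.inr ⟨z, hz⟩
  set e' : CG (GL (Fin n) F) := eu f' g' hc'.1 with he'
  set e1 : CG (GL (Fin n) F) := eu f g hc.1 with he1
  have hM : eta f' g' hc'.1 (zz i') (zz j') * eta f g hc.1 (zz i) (zz j) =
      mp (io f') (zz i') * mp (io g') (zz j') * e' * e1 * (mp (io f) (zz i) * mp (io g) (zz j)) := by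
    have := mul_eta f' g' hc'.1 1 (zz i') 1 (zz j')
    rw [mul_one, mul_one, eta_one_one] at this
    rw [← this]
    simp only [eta, mul_assoc, he', he1]
  rw [hM] at h
  obtain ⟨p, h⟩ := rep_ins (cmp f' aP) _ _ h
  obtain ⟨r, h⟩ := rep_ins (cmp f' aR) _ _ h
  obtain ⟨q, h⟩ := rep_ins (cmp g' aQ) _ _ h
  obtain ⟨s, h⟩ := rep_ins (cmp g' aS) _ _ h
  refine ⟨α, β, γ, δ, p, q, r, s, ?_⟩
  set Z : CG (GL (Fin n) F) := mp (io f') (mp (io aP) (zz p) * mp (io aR) (zz r)) *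
    mp (io g') (mp (io aQ) (zz q) * mp (io aS) (zz s)) with hZ
  have dRQ : Disj (cmp f' aR) (cmp g' aQ) := hc'.1.cmp _ _
  have hZ2 : Z = mp (io f) (mp (io bP) (zz p) * mp (io bQ) (zz q)) *
    mp (io g) (mp (io bR) (zz r) * mp (io bS) (zz s)) := by
    rw [hZ]
    simp only [map_mul, mp_io_io, ← eP, ← eQ, ← eR, ← eS]
    calc _ = mp (io (cmp f' aP)) (zz p) * (mp (io (cmp f' aR)) (zz r) * mp (io (cmp g' aQ)) (zz q)) *
          mp (io (cmp g' aS)) (zz s) := by simp only [mul_assoc]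
      _ = _ := by rw [mp_io_comm dRQ]; simp only [mul_assoc]
  set L : CG (GL (Fin n) F) := mp (io f') (eta aP aR aPR.1 (zz p) (zz r)) * mp (io g') (eta aQ aS aQS.1 (zz q) (zz s)) with hL
  set S : CG (GL (Fin n) F) := mp (io f) (eta bP bQ bPQ.1 (zz p) (zz q)) * mp (io g) (eta bR bS bRS.1 (zz r) (zz s)) with hS
  set A : CG (GL (Fin n) F) := mp (io f') (eu aP aR aPR.1) * mp (io g') (eu aQ aS aQS.1) with hA
  set B : CG (GL (Fin n) F) := mp (io f) (eu bP bQ bPQ.1) * mp (io g) (eu bR bS bRS.1) with hB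
  have etaL : ∀ {u v w : ℕ} {x : Fin u ↪ Fin w} {y : Fin v ↪ Fin w} (hd : Disj x y) (zx : CG (GL (Fin u) F)) (zy : CG (GL (Fin v) F)),
      eta x y hd zx zy = mp (io x) zx * mp (io y) zy * eu x y hd := by
    intro u v w x y hd zx zy
    rw [← eta_one_one, mul_eta, mul_one, mul_one]
  have key : L*e'*e1*S = e'*e1*Z := by
    apply abs_ring (A := A) (B := B)
    · rw [hL, hZ, hA, etaL, etaL, map_mul, map_mul (mp (io g'))]
      have := mp_io_comm hc'.1 (eu aP aR aPR.1) (mp (io aQ) (zz q) * mp (io aS) (zz s))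
      set X1 := mp (io f') (mp (io aP) (zz p) * mp (io aR) (zz r))
      set X2 := mp (io g') (mp (io aQ) (zz q) * mp (io aS) (zz s))
      calc _ = X1 * (mp (io f') (eu aP aR aPR.1) * X2) * mp (io g') (eu aQ aS aQS.1) := by simp only [mul_assoc]
        _ = _ := by rw [this]; simp only [mul_assoc]
    · rw [hS, hZ2, hB, eta, eta, mul_assoc, mul_assoc, map_mul, map_mul (mp (io g))]
      have := mp_io_comm hc.1 (mp (io bP) (zz p) * mp (io bQ) (zz q)) (eu bR bS bRS.1)
      set X1 := mp (io f) (mp (io bP) (zz p) * mp (io bQ) (zz q))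
      set X2 := mp (io g) (mp (io bR) (zz r) * mp (io bS) (zz s))
      calc _ = mp (io f) (eu bP bQ bPQ.1) * (X1 * mp (io g) (eu bR bS bRS.1)) * X2 := by simp only [mul_assoc]
        _ = _ := by rw [this]; simp only [mul_assoc]
    · rw [hA, mp_io_eu, mp_io_eu, mul_assoc]
      have h1 : eu (cmp g' aQ) (cmp g' aS) (aQS.1.cmp_inj g') * e1 = e1 := by
        apply eu_abs_left; intro X
        have := eu_sub_left hc.1 bQ bS X
        simp only [← eQ, ← eS] at this
        exact this
      rw [h1]
      apply eu_abs_left; intro X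
      have := eu_sub_left hc.1 bP bR X
      simp only [← eP, ← eR] at this
      exact this
    · rw [hB, mp_io_eu, mp_io_eu, ← mul_assoc]
      have h1 : e' * eu (cmp f bP) (cmp f bQ) (bPQ.1.cmp_inj f) = e' := by
        apply eu_abs_right; intro X
        have := eu_sub_right hc'.1 aP aQ X
        simp only [eP, eQ] at this
        exact this
      rw [h1]
      apply eu_abs_right; intro X
      have := eu_sub_right hc'.1 aR aS X
      simp only [eR, eS] at this
      exact this
    · rw [hL, mul_assoc, he', mp_eu_right, ← mul_assoc, mp_eu_left, mul_assoc]
    · rw [hS, mul_assoc, he1, mp_eu_right, ← mul_assoc, mp_eu_left, mul_assoc]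
    · rw [hZ2, mul_assoc, he1, mp_eu_right, ← mul_assoc, mp_eu_left, mul_assoc]
    · rw [hZ, mul_assoc, he', mp_eu_right, ← mul_assoc, mp_eu_left, mul_assoc]
    · have zz2 : ∀ {u v w : ℕ} {x : Fin u ↪ Fin w} {y : Fin v ↪ Fin w} (hd : Disj x y) (zx : CG (GL (Fin u) F)) (zy : CG (GL (Fin v) F))
        (h1 : zx * zx = zx) (h2 : zy * zy = zy), (mp (io x) zx * mp (io y) zy) * (mp (io x) zx * mp (io y) zy) = mp (io x) zx * mp (io y) zy := by
        intro u v w x y hd zx zy h1 h2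
        calc _ = mp (io x) zx * (mp (io y) zy * mp (io x) zx) * mp (io y) zy := by simp only [mul_assoc]
          _ = mp (io x) (zx * zx) * mp (io y) (zy * zy) := by rw [← mp_io_comm hd, map_mul, map_mul]; simp only [mul_assoc]
          _ = _ := by rw [h1, h2]
      rw [hZ]
      apply zz2 hc'.1
      · exact zz2 aPR.1 _ _ (zz_mul_self _) (zz_mul_self _)
      · exact zz2 aQS.1 _ _ (zz_mul_self _) (zz_mul_self _)
  have h5 : rep k (mp (io f') (zz i') * mp (io g') (zz j') * (L * e' * e1 * S) * (mp (io f) (zz i) * mp (io g) (zz j))) ≠ 0 := by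
    rw [key]
    convert h using 2
    rw [hZ]
    simp only [map_mul, mp_io_io, mul_assoc]
  have h6 : mp (io f') (zz i') * mp (io g') (zz j') * L ≠ 0 := by
    intro h0
    apply h5
    have : mp (io f') (zz i') * mp (io g') (zz j') * (L * e' * e1 * S) * (mp (io f) (zz i) * mp (io g) (zz j)) =
      (mp (io f') (zz i') * mp (io g') (zz j') * L) * (e' * e1 * S * (mp (io f) (zz i) * mp (io g) (zz j))) := by
      simp only [mul_assoc]
    rw [this, h0, zero_mul, map_zero]
  have h7 : S * (mp (io f) (zz i) * mp (io g) (zz j)) ≠ 0 := by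
    intro h0
    apply h5
    have : mp (io f') (zz i') * mp (io g') (zz j') * (L * e' * e1 * S) * (mp (io f) (zz i) * mp (io g) (zz j)) =
      (mp (io f') (zz i') * mp (io g') (zz j') * (L * e' * e1)) * (S * (mp (io f) (zz i) * mp (io g) (zz j))) := by
      simp only [mul_assoc]
    rw [this, h0, mul_zero, map_zero]
  have h6' : mp (io f') (zz i' * eta aP aR aPR.1 (zz p) (zz r)) * mp (io g') (zz j' * eta aQ aS aQS.1 (zz q) (zz s)) ≠ 0 := by
    convert h6 using 1
    rw [hL, map_mul, map_mul]
    calc _ = mp (io f') (zz i') * (mp (io f') (eta aP aR aPR.1 (zz p) (zz r)) * mp (io g') (zz j')) * mp (io g') (eta aQ aS aQS.1 (zz q) (zz s)) := by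
          simp only [mul_assoc]
      _ = _ := by rw [mp_io_comm hc'.1]; simp only [mul_assoc]
  have h7' : mp (io f) (zz i * eta bP bQ bPQ.1 (zz p) (zz q)) * mp (io g) (zz j * eta bR bS bRS.1 (zz r) (zz s)) ≠ 0 := by
    convert h7 using 1
    rw [hS, zz_comm i, zz_comm j, map_mul, map_mul]
    calc _ = mp (io f) (eta bP bQ bPQ.1 (zz p) (zz q)) * (mp (io f) (zz i) * mp (io g) (eta bR bS bRS.1 (zz r) (zz s))) * mp (io g) (zz j) := by
          simp only [mul_assoc]
      _ = _ := by rw [mp_io_comm hc.1]; simp only [mul_assoc]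
  refine ⟨⟨bP, bQ, bPQ, ?_⟩, ⟨bR, bS, bRS, ?_⟩, ⟨aP, aR, aPR, ?_⟩, ⟨aQ, aS, aQS, ?_⟩⟩ <;>
    rw [← zz_mul_ne_zero_iff] <;> intro h0
  · apply h7'; rw [h0, map_zero, zero_mul]
  · apply h7'; rw [h0, map_zero, mul_zero]
  · apply h6'; rw [h0, map_zero, zero_mul]
  · apply h6'; rw [h0, map_zero, mul_zero]

theorem Rel.refine {k : Irr (GL (Fin n) F)} {i : Irr (GL (Fin a) F)} {j : Irr (GL (Fin b) F)}
    {i' : Irr (GL (Fin a') F)} {j' : Irr (GL (Fin b') F)} (h : Rel k i j) (h' : Rel k i' j') :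
    ∃ (α β γ δ : ℕ) (p : Irr (GL (Fin α) F)) (q : Irr (GL (Fin β) F)) (r : Irr (GL (Fin γ) F)) (s : Irr (GL (Fin δ) F)),
      Rel i p q ∧ Rel j r s ∧ Rel i' p r ∧ Rel j' q s := by
  obtain ⟨f, g, hs⟩ := exists_std h.card
  obtain ⟨f', g', hs'⟩ := exists_std h'.card
  obtain ⟨x, hx⟩ := sandwich k (h'.all hs'.cpl) (h.all hs.cpl)
  obtain ⟨u, hu, r, y, hy, rfl⟩ := bruhat_std hs x
  obtain ⟨p, q, hpq⟩ := gg_eta hs.cpl y hy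
  obtain ⟨p', q', hpq'⟩ := eta_gg hs'.cpl u (fun i j => NN_block_zero hs' hu i j)
  have e : eta f' g' hs'.cpl.1 (zz i') (zz j') * gg (u * pm r * y) * eta f g hs.cpl.1 (zz i) (zz j) =
     gg (io f' p' * io g' q') * (eta f' g' hs'.cpl.1 (zz i') (zz j') * (eta (cmp r.toEmbedding f) (cmp r.toEmbedding g) (hs.cpl.1.cmp_inj _) (zz i) (zz j))) *
      gg (pm r * (io f p * io g q)) := by
    rw [gg_mul, gg_mul, mul_assoc, mul_assoc, hpq, ← mul_assoc, ← mul_assoc (eta _ _ _ _ _) (gg u), hpq']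
    rw [zz_comm i', zz_comm j', ← zz_comm i, ← zz_comm j, ← mul_eta, ← eta_mul, mp_gg, mp_gg, mp_gg, mp_gg]
    rw [gg_mul, gg_mul, gg_mul, ← mul_assoc, mul_assoc _ (gg (pm r)), pm_eta]
    simp only [mul_assoc]
  rw [e, rep_mul_gg_ne, rep_gg_mul_ne] at hx
  exact refine_aux (hs.cpl.map r) hs'.cpl hx

end DC
end HRV


namespace HRV

section Wh
variable {F : Type} [Field F] [Fintype F] {a b c d a' b' m n : ℕ}

/-- admissible patterns: zero-one matrices supported on the superdiagonal -/
def Adm (C : Matrix (Fin n) (Fin n) F) : Prop := ∀ i j, C i j = 0 ∨ (C i j = 1 ∧ j.val = i.val + 1)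

/-- the full pattern -/
def Cn (F : Type) [Field F] (n : ℕ) : Matrix (Fin n) (Fin n) F := fun i j => if j.val = i.val + 1 then 1 else 0

theorem adm_Cn : Adm (Cn F n) := by
  intro i j
  by_cases h : j.val = i.val + 1
  · right; exact ⟨if_pos h, h⟩
  · left; exact if_neg h

theorem Adm.sub {C : Matrix (Fin n) (Fin n) F} (hC : Adm C) {f : Fin a ↪ Fin n} (hf : StrictMono f) :
    Adm (C.submatrix f f) := by
  intro i j
  rcases hC (f i) (f j) with h | ⟨h, h'⟩
  · exact Or.inl h
  · refine Or.inr ⟨h, ?_⟩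
    have hij : i < j := hf.lt_iff_lt.1 (by rw [Fin.lt_def]; omega)
    by_contra hne
    have hlt : i.val + 1 < j.val := by have := Fin.lt_def.1 hij; omega
    have hk : i.val + 1 < a := by omega
    have h1 : f i < f ⟨i.val + 1, hk⟩ := hf (by rw [Fin.lt_def]; simp)
    have h2 : f ⟨i.val + 1, hk⟩ < f j := hf (by rw [Fin.lt_def]; simpa using hlt)
    rw [Fin.lt_def] at h1 h2
    omega

/-- pairing with a pattern -/
def pr (C : Matrix (Fin n) (Fin n) F) (M : Matrix (Fin n) (Fin n) F) : F := ∑ i, ∑ j, C i j * M i j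

theorem pr_one {C : Matrix (Fin n) (Fin n) F} (hC : Adm C) : pr C 1 = 0 := by
  refine Finset.sum_eq_zero fun i _ => Finset.sum_eq_zero fun j _ => ?_
  rcases hC i j with h | ⟨h, h'⟩
  · rw [h, zero_mul]
  · rw [Matrix.one_apply_ne (by rintro rfl; omega), mul_zero]

theorem ut_mul_super {x y : Matrix (Fin n) (Fin n) F} (hx : ut x) (hy : ut y) {i j : Fin n} (hij : j.val = i.val + 1) :
    (x * y) i j = x i j + y i j := by
  have hne : i ≠ j := by rintro rfl; omega
  rw [Matrix.mul_apply, Finset.sum_eq_add i j hne]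
  · rw [hx i i le_rfl, hy j j le_rfl]; simp [add_comm]
  · rintro k - ⟨hk1, hk2⟩
    rcases lt_or_gt_of_ne hk1 with h | h
    · rw [hx i k h.le, Matrix.one_apply_ne h.ne', zero_mul]
    · have : j < k := by
        rw [Fin.lt_def] at h ⊢
        have : k.val ≠ j.val := fun h => hk2 (Fin.ext h)
        omega
      rw [hy k j this.le, Matrix.one_apply_ne this.ne', mul_zero]
  · simp
  · simp

theorem pr_mul {C : Matrix (Fin n) (Fin n) F} (hC : Adm C) {x y : Matrix (Fin n) (Fin n) F} (hx : ut x) (hy : ut y) :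
    pr C (x * y) = pr C x + pr C y := by
  simp only [pr, ← Finset.sum_add_distrib]
  refine Finset.sum_congr rfl fun i _ => Finset.sum_congr rfl fun j _ => ?_
  rcases hC i j with h | ⟨h, h'⟩
  · rw [h]; ring
  · rw [ut_mul_super hx hy h']; ring

/-- the character of `NN` attached to an admissible pattern -/
noncomputable def th (ψ : AddChar F ℂ) (C : Matrix (Fin n) (Fin n) F) (hC : Adm C) : NN F n →* ℂ where
  toFun x := ψ (pr C x.1.val)
  map_one' := by
    show ψ (pr C 1) = 1
    rw [pr_one hC, AddChar.map_zero_eq_one]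
  map_mul' := by
    intro x y
    show ψ (pr C (x.1.val * y.1.val)) = _
    rw [pr_mul hC x.2 y.2, AddChar.map_add_eq_mul]

noncomputable def ec (ψ : AddChar F ℂ) (C : Matrix (Fin n) (Fin n) F) (hC : Adm C) : CG (GL (Fin n) F) :=
  avg (NN F n).subtype (th ψ C hC)

theorem ec_left (ψ : AddChar F ℂ) {C : Matrix (Fin n) (Fin n) F} (hC : Adm C) {x : GL (Fin n) F} (hx : x ∈ NN F n) :
    gg x * ec ψ C hC = ψ (pr C x.val) • ec ψ C hC := avg_left (NN F n).subtype (th ψ C hC) ⟨x, hx⟩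

theorem ec_right (ψ : AddChar F ℂ) {C : Matrix (Fin n) (Fin n) F} (hC : Adm C) {x : GL (Fin n) F} (hx : x ∈ NN F n) :
    ec ψ C hC * gg x = ψ (pr C x.val) • ec ψ C hC := avg_right (NN F n).subtype (th ψ C hC) ⟨x, hx⟩

theorem ec_idem (ψ : AddChar F ℂ) {C : Matrix (Fin n) (Fin n) F} (hC : Adm C) : ec ψ C hC * ec ψ C hC = ec ψ C hC :=
  avg_idem _ _

theorem ec_abs_left (ψ : AddChar F ℂ) {C : Matrix (Fin n) (Fin n) F} (hC : Adm C) (y : CG (GL (Fin n) F))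
    (h : ∀ x ∈ NN F n, gg x * y = ψ (pr C x.val) • y) : ec ψ C hC * y = y :=
  avg_absorb_left _ _ _ fun x => h x.1 x.2

theorem ec_abs_right (ψ : AddChar F ℂ) {C : Matrix (Fin n) (Fin n) F} (hC : Adm C) (y : CG (GL (Fin n) F))
    (h : ∀ x ∈ NN F n, y * gg x = ψ (pr C x.val) • y) : y * ec ψ C hC = y :=
  avg_absorb_right _ _ _ fun x => h x.1 x.2

theorem ec_mul_avg (ψ : AddChar F ℂ) {C : Matrix (Fin n) (Fin n) F} (hC : Adm C) {H : Type} [Group H] [Fintype H]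
    (j : H →* GL (Fin n) F) (ch : H →* ℂ) (h1 : ∀ h, j h ∈ NN F n) (h2 : ∀ h, ψ (pr C (j h).val) = ch h) :
    ec ψ C hC * avg j ch = ec ψ C hC := by
  apply avg_absorb_right
  intro h
  rw [ec_right ψ hC (h1 h), h2]

theorem pr_EE (C : Matrix (Fin n) (Fin n) F) (f : Fin a ↪ Fin n) (g : Fin b ↪ Fin n) (X : Matrix (Fin a) (Fin b) F) :
    pr C (EE f g X) = ∑ i, ∑ j, C (f i) (g j) * X i j := by
  classical
  simp only [pr]
  rw [← Finset.sum_subset (Finset.subset_univ (Finset.univ.map f)), Finset.sum_map]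
  · refine Finset.sum_congr rfl fun i _ => ?_
    rw [← Finset.sum_subset (Finset.subset_univ (Finset.univ.map g)), Finset.sum_map]
    · refine Finset.sum_congr rfl fun j _ => ?_
      rw [EE_apply_apply]
    · intro j _ hj
      rw [EE_apply_right, mul_zero]
      intro x hx; apply hj; simp [← hx]
  · intro i _ hi
    refine Finset.sum_eq_zero fun j _ => ?_
    rw [EE_apply_left, mul_zero]
    intro x hx; apply hi; simp [← hx]

theorem pr_add (C : Matrix (Fin n) (Fin n) F) (x y) : pr C (x + y) = pr C x + pr C y := by
  simp only [pr, ← Finset.sum_add_distrib, Matrix.add_apply, mul_add]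

theorem pr_sub (C : Matrix (Fin n) (Fin n) F) (x y) : pr C (x - y) = pr C x - pr C y := by
  simp only [pr, ← Finset.sum_sub_distrib, Matrix.sub_apply, mul_sub]

theorem pr_io {C : Matrix (Fin n) (Fin n) F} (hC : Adm C) {f : Fin a ↪ Fin n} (hf : StrictMono f) (x : GL (Fin a) F) :
    pr C (io f x).val = pr (C.submatrix f f) x.val := by
  have : pr C (io f x).val = pr (C.submatrix f f) (x.val - 1) := by
    rw [io_val, pr_add, pr_one hC, zero_add, pr_EE]; rfl
  rw [this, pr_sub, pr_one (hC.sub hf), sub_zero]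

/-- additive character on block matrices -/
noncomputable def uc (ψ : AddChar F ℂ) (B : Matrix (Fin a) (Fin b) F) : Multiplicative (Matrix (Fin a) (Fin b) F) →* ℂ where
  toFun X := ψ (∑ i, ∑ j, B i j * X.toAdd i j)
  map_one' := by simp
  map_mul' := by
    intro X Y
    simp only [toAdd_mul, Matrix.add_apply, mul_add, Finset.sum_add_distrib, AddChar.map_add_eq_mul]

theorem pr_uu {C : Matrix (Fin n) (Fin n) F} (hC : Adm C) (ψ : AddChar F ℂ) (f : Fin a ↪ Fin n) (g : Fin b ↪ Fin n) (h : Disj f g)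
   (X) : ψ (pr C (uu f g h X).val) = uc ψ (C.submatrix f g) X := by
  rw [uu_val, pr_add, pr_one hC, zero_add, pr_EE]; rfl

theorem ec_io_left (ψ : AddChar F ℂ) {C : Matrix (Fin n) (Fin n) F} (hC : Adm C) {f : Fin a ↪ Fin n} (hf : StrictMono f) :
    ec ψ C hC * mp (io f) (ec ψ _ (hC.sub hf)) = ec ψ C hC := by
  rw [ec, ec, mp_avg]
  refine ec_mul_avg ψ hC _ _ (fun x => io_NN hf x.2) (fun x => ?_)
  show ψ (pr C (io f x.1).val) = ψ (pr _ x.1.val)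
  rw [pr_io hC hf]

/-- splitting along a block decomposition -/
theorem ec_split (ψ : AddChar F ℂ) {C : Matrix (Fin n) (Fin n) F} (hC : Adm C) {f : Fin a ↪ Fin n} {g : Fin b ↪ Fin n}
    (h : Std f g) : ec ψ C hC = avg (uu f g h.cpl.1) (uc ψ (C.submatrix f g)) *
      mp (io f) (ec ψ _ (hC.sub h.mf)) * mp (io g) (ec ψ _ (hC.sub h.mg)) := by
  set ea := ec ψ _ (hC.sub h.mf)
  set eb := ec ψ _ (hC.sub h.mg)
  have h1 : ec ψ C hC * (avg (uu f g h.cpl.1) (uc ψ (C.submatrix f g)) * mp (io f) ea * mp (io g) eb) = ec ψ C hC := by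
    rw [← mul_assoc, ← mul_assoc, ec_mul_avg ψ hC (uu f g h.cpl.1) (uc ψ (C.submatrix f g)) ?_ fun X => pr_uu hC ψ f g _ X,
      ec_io_left ψ hC h.mf, ec_io_left ψ hC h.mg]
    intro X
    apply uu_NN
    intro i j hij
    exact absurd hij (h.lt i j).not_gt
  rw [← h1]
  apply ec_abs_left
  intro x hx
  obtain ⟨p, q, X, hp, hq, -, hxe⟩ := block_decomp h.cpl x (NN_block_zero h hx)
  have hpN : p ∈ NN F a := by
    intro i j hij
    rw [hp, Matrix.submatrix_apply, hx _ _ (h.mf.monotone hij)]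
    simp [Matrix.one_apply]
  have hqN : q ∈ NN F b := by
    intro i j hij
    rw [hq, Matrix.submatrix_apply, hx _ _ (h.mg.monotone hij)]
    simp [Matrix.one_apply]
  have hXN : uu f g h.cpl.1 (Multiplicative.ofAdd X) ∈ NN F n := by
    apply uu_NN
    intro i j hij
    exact absurd hij (h.lt i j).not_gt
  have hxv : ψ (pr C x.val) = uc ψ (C.submatrix f g) (Multiplicative.ofAdd X) * ψ (pr (C.submatrix f f) p.val) * ψ (pr (C.submatrix g g) q.val) := by
    rw [hxe, Units.val_mul, Units.val_mul, pr_mul hC (ut_mul hXN (io_NN h.mf hpN)) (io_NN h.mg hqN),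
      pr_mul hC hXN (io_NN h.mf hpN), AddChar.map_add_eq_mul, AddChar.map_add_eq_mul, pr_uu hC, pr_io hC h.mf, pr_io hC h.mg]
  -- conjugating the unipotent average by the Levi part
  have e2 : ∀ (y : GL (Fin n) F), y ∈ NN F n → ∀ (e : Multiplicative (Matrix (Fin a) (Fin b) F) ≃ Multiplicative (Matrix (Fin a) (Fin b) F)),
      (∀ X, y * uu f g h.cpl.1 X = uu f g h.cpl.1 (e X) * y) →
      gg y * avg (uu f g h.cpl.1) (uc ψ (C.submatrix f g)) = avg (uu f g h.cpl.1) (uc ψ (C.submatrix f g)) * gg y := by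
    intro y hy e he
    refine avg_conj _ _ _ _ _ e he fun X => ?_
    have huN : ∀ X, uu f g h.cpl.1 X ∈ NN F n := by
      intro X
      apply uu_NN
      intro i j hij
      exact absurd hij (h.lt i j).not_gt
    have h5 : uc ψ (C.submatrix f g) (e X) = uc ψ (C.submatrix f g) X := by
      have h6 : ψ (pr C (y * uu f g h.cpl.1 X).val) = ψ (pr C (uu f g h.cpl.1 (e X) * y).val) := by rw [he]
      rw [Units.val_mul, Units.val_mul, pr_mul hC hy (huN _), pr_mul hC (huN _) hy, AddChar.map_add_eq_mul, AddChar.map_add_eq_mul,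
        pr_uu hC, pr_uu hC, mul_comm] at h6
      have h7 : ψ (pr C y.val) ≠ 0 := by
        intro h0
        have := AddChar.map_add_eq_mul ψ (pr C y.val) (- pr C y.val)
        rw [h0, zero_mul, add_neg_cancel, AddChar.map_zero_eq_one] at this
        exact one_ne_zero this
      exact (mul_right_cancel₀ h7 h6).symm
    have hinv : ∀ (c : Multiplicative (Matrix (Fin a) (Fin b) F) →* ℂ) Y, c Y⁻¹ = (c Y)⁻¹ := fun c Y => by
      have := char_inv c Y
      exact eq_inv_of_mul_eq_one_right this
    rw [hinv, hinv, h5]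
  have ef : gg (io f p) * avg (uu f g h.cpl.1) (uc ψ (C.submatrix f g)) = avg (uu f g h.cpl.1) (uc ψ (C.submatrix f g)) * gg (io f p) := by
    refine e2 _ (io_NN h.mf hpN) 
      { toFun := fun X => Multiplicative.ofAdd (p.val * X.toAdd)
        invFun := fun X => Multiplicative.ofAdd ((p⁻¹).val * X.toAdd)
        left_inv := fun X => ?_
        right_inv := fun X => ?_ } fun X => io_uu_left f g h.cpl.1 p X
    · simp
    · simp
  have eg : gg (io g q) * avg (uu f g h.cpl.1) (uc ψ (C.submatrix f g)) = avg (uu f g h.cpl.1) (uc ψ (C.submatrix f g)) * gg (io g q) := by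
    refine e2 _ (io_NN h.mg hqN) 
      { toFun := fun X => Multiplicative.ofAdd (X.toAdd * (q⁻¹).val)
        invFun := fun X => Multiplicative.ofAdd (X.toAdd * q.val)
        left_inv := fun X => ?_
        right_inv := fun X => ?_ } fun X => io_uu_right f g h.cpl.1 q X
    · simp [Matrix.mul_assoc]
    · simp [Matrix.mul_assoc]
  rw [hxv, hxe, gg_mul, gg_mul]
  set V := avg (uu f g h.cpl.1) (uc ψ (C.submatrix f g)) with hV
  have k1 : gg (io g q) * mp (io f) ea = mp (io f) ea * gg (io g q) := by
    rw [← mp_gg (io g), ← mp_io_comm h.cpl.1]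
  have k2 : gg (io f p) * mp (io f) ea = ψ (pr (C.submatrix f f) p.val) • mp (io f) ea := by
    rw [← mp_gg (io f), ← map_mul, ec_left ψ _ hpN, map_smul]
  have k3 : gg (io g q) * mp (io g) eb = ψ (pr (C.submatrix g g) q.val) • mp (io g) eb := by
    rw [← mp_gg (io g), ← map_mul, ec_left ψ _ hqN, map_smul]
  have k4 : gg (uu f g h.cpl.1 (Multiplicative.ofAdd X)) * V = uc ψ (C.submatrix f g) (Multiplicative.ofAdd X) • V := avg_left _ _ _
  calc _ = gg (uu f g h.cpl.1 (Multiplicative.ofAdd X)) * (gg (io f p) * (gg (io g q) * V) * mp (io f) ea) * mp (io g) eb := by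
        simp only [mul_assoc]
    _ = gg (uu f g h.cpl.1 (Multiplicative.ofAdd X)) * ((gg (io f p) * V) * (gg (io g q) * mp (io f) ea)) * mp (io g) eb := by
        rw [eg]; simp only [mul_assoc]
    _ = (gg (uu f g h.cpl.1 (Multiplicative.ofAdd X)) * V) * (gg (io f p) * mp (io f) ea) * (gg (io g q) * mp (io g) eb) := by
        rw [ef, k1]; simp only [mul_assoc]
    _ = _ := by
        rw [k2, k3, k4]
        simp only [smul_mul_assoc, mul_smul_comm, smul_smul]
        congr 1
        ring

theorem uc_zero (ψ : AddChar F ℂ) : uc ψ (0 : Matrix (Fin a) (Fin b) F) = 1 := by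
  ext X; simp [uc]

theorem ec_split_zero (ψ : AddChar F ℂ) {C : Matrix (Fin n) (Fin n) F} (hC : Adm C) {f : Fin a ↪ Fin n} {g : Fin b ↪ Fin n}
    (h : Std f g) (h0 : C.submatrix f g = 0) : ec ψ C hC = eta f g h.cpl.1 (ec ψ _ (hC.sub h.mf)) (ec ψ _ (hC.sub h.mg)) := by
  rw [ec_split ψ hC h, h0, uc_zero]; rfl

/-- atoms -/
def Atom (k : Irr (GL (Fin n) F)) : Prop :=
  ∀ (a b : ℕ) (i : Irr (GL (Fin a) F)) (j : Irr (GL (Fin b) F)), Rel k i j → a = 0 ∨ b = 0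

theorem Atom.eu_zero {k : Irr (GL (Fin n) F)} (hk : Atom k) {f : Fin a ↪ Fin n} {g : Fin b ↪ Fin n}
    (h : Cpl f g) (ha : a ≠ 0) (hb : b ≠ 0) : rep k (eu f g h.1) = 0 := by
  by_contra h0
  rw [← eta_one_one] at h0
  obtain ⟨i, j, hr, -, -⟩ := exists_rel_of_eu h 1 1 h0
  rcases hk _ _ _ _ hr with h | h
  · exact ha h
  · exact hb h

theorem eta_eq_zero {k : Irr (GL (Fin n) F)} (hk : Atom k) {f : Fin a ↪ Fin n} {g : Fin b ↪ Fin n}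
    (h : Cpl f g) (ha : a ≠ 0) (hb : b ≠ 0) (x y) : rep k (eta f g h.1 x y) = 0 := by
  rw [eta, map_mul, map_mul, hk.eu_zero h ha hb, zero_mul, zero_mul]

theorem Std.vals {f : Fin a ↪ Fin n} {g : Fin b ↪ Fin n} (h : Std f g) :
    (∀ x, (f x).val = x.val) ∧ (∀ y, (g y).val = a + y.val) := by
  obtain rfl := h.cpl.card
  have hm : StrictMono (Fin.addCases (motive := fun _ => Fin (a + b)) f g) := by
    intro x y hxy
    induction x using Fin.addCases with
    | left x =>
      induction y using Fin.addCases with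
      | left y => simp only [Fin.addCases_left]; exact h.mf (by rw [Fin.lt_def] at hxy ⊢; exact hxy)
      | right y => simp only [Fin.addCases_left, Fin.addCases_right]; exact h.lt _ _
    | right x =>
      induction y using Fin.addCases with
      | left y => simp [Fin.lt_def] at hxy; omega
      | right y => simp only [Fin.addCases_right]; exact h.mg (by rw [Fin.lt_def] at hxy ⊢; simpa only [Fin.val_natAdd, add_lt_add_iff_left] using hxy)
  have hs : Set.range (Fin.addCases (motive := fun _ => Fin (a + b)) f g) = Set.range (id : Fin (a + b) → Fin (a + b)) := by
    rw [Set.range_id, Set.range_eq_univ]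
    exact Finite.surjective_of_injective hm.injective
  have := (StrictMono.range_inj hm strictMono_id).1 hs
  constructor
  · intro x
    have := congrFun this (Fin.castAdd b x)
    simp only [Fin.addCases_left, id] at this
    rw [this]; rfl
  · intro x
    have := congrFun this (Fin.natAdd a x)
    simp only [Fin.addCases_right, id] at this
    rw [this]; rfl

/-- a non-full admissible pattern splits -/
theorem Adm.exists_split {C : Matrix (Fin n) (Fin n) F} (hC : Adm C) (hne : C ≠ Cn F n) :
    ∃ (a b : ℕ) (f : Fin a ↪ Fin n) (g : Fin b ↪ Fin n), a ≠ 0 ∧ b ≠ 0 ∧ Std f g ∧ C.submatrix f g = 0 := by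
  have : ∃ i j, C i j ≠ Cn F n i j := by
    by_contra h; push Not at h; exact hne (Matrix.ext h)
  obtain ⟨i, j, hij⟩ := this
  have hj : j.val = i.val + 1 ∧ C i j = 0 := by
    rcases hC i j with h | ⟨h, h'⟩
    · refine ⟨?_, h⟩
      by_contra h2
      exact hij (by rw [h, Cn, if_neg h2])
    · exact absurd (by rw [h, Cn, if_pos h']) hij
  have hlt : i.val + 1 < n := by have := j.2; omega
  obtain ⟨b, hb⟩ := Nat.exists_eq_add_of_lt hlt
  have hn : (i.val + 1) + (b + 1) = n := by omega
  obtain ⟨f, g, hs⟩ := exists_std hn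
  refine ⟨_, _, f, g, by omega, by omega, hs, ?_⟩
  ext x y
  rw [Matrix.submatrix_apply, Matrix.zero_apply]
  rcases hC (f x) (g y) with h | ⟨h, h'⟩
  · exact h
  · rw [hs.vals.1, hs.vals.2] at h'
    have hx := x.2
    have e1 : f x = i := Fin.ext (by rw [hs.vals.1]; omega)
    have e2 : g y = j := Fin.ext (by rw [hs.vals.2]; omega)
    rw [e1, e2]; exact hj.2

end Wh
end HRV


namespace HRV

section Comb
variable {n : ℕ} {K : Type}

theorem desc_ivt (s : Equiv.Perm (Fin n)) (t : Fin n → K)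
    (H : ∀ i j : Fin n, j.val = i.val + 1 → s j < s i → (s i).val = (s j).val + 1 ∧ t i = t j) (v : Fin n) :
    ∀ (d : ℕ) (i j : Fin n), j.val = i.val + d → s j ≤ v → v ≤ s i → ∃ k, i ≤ k ∧ k ≤ j ∧ s k = v := by
  intro d
  induction d with
  | zero =>
    intro i j hij h1 h2
    have : i = j := Fin.ext (by omega)
    subst this
    exact ⟨i, le_rfl, le_rfl, le_antisymm h1 h2⟩
  | succ d ih =>
    intro i j hij h1 h2
    by_cases h3 : s i = v
    · exact ⟨i, le_rfl, by rw [Fin.le_def]; omega, h3⟩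
    have hlt : v < s i := lt_of_le_of_ne h2 (Ne.symm h3)
    let i' : Fin n := ⟨i.val + 1, by have := j.2; omega⟩
    have h4 : v ≤ s i' := by
      by_cases h5 : s i' < s i
      · have := (H i i' rfl h5).1
        rw [Fin.lt_def] at hlt
        rw [Fin.le_def]; omega
      · exact hlt.le.trans (not_lt.1 h5)
    obtain ⟨k, hk1, hk2, hk3⟩ := ih i' j (by show j.val = i.val + 1 + d; omega) h1 h4
    refine ⟨k, ?_, hk2, hk3⟩
    rw [Fin.le_def] at hk1 ⊢
    have : i'.val = i.val + 1 := rfl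
    omega

theorem desc_inv (s : Equiv.Perm (Fin n)) (t : Fin n → K)
    (H : ∀ i j : Fin n, j.val = i.val + 1 → s j < s i → (s i).val = (s j).val + 1 ∧ t i = t j) :
    ∀ (d : ℕ) (i j : Fin n), j.val = i.val + d → s j < s i → (s i).val + i.val = (s j).val + j.val ∧ t i = t j := by
  intro d
  induction d with
  | zero =>
    intro i j hij h1
    have : i = j := Fin.ext (by omega)
    subst this
    exact absurd h1 (lt_irrefl _)
  | succ d ih =>
    intro i j hij h1
    let i' : Fin n := ⟨i.val + 1, by have := j.2; omega⟩
    have hi' : i'.val = i.val + 1 := rfl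
    have h5 : s i' < s i := by
      by_contra h5
      obtain ⟨k, hk1, hk2, hk3⟩ := desc_ivt s t H (s i) d i' j (by omega) h1.le (not_lt.1 h5)
      have := s.injective hk3
      rw [Fin.le_def, this] at hk1
      omega
    obtain ⟨e1, e2⟩ := H i i' rfl h5
    by_cases h6 : i' = j
    · rw [← h6]; exact ⟨by omega, e2⟩
    · have h7 : s j < s i' := by
        have hne : s i' ≠ s j := fun h => h6 (s.injective h)
        rw [Fin.lt_def] at h1 ⊢
        have : (s i').val ≠ (s j).val := fun h => hne (Fin.ext h)
        omega
      obtain ⟨e3, e4⟩ := ih i' j (by omega) h7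
      exact ⟨by omega, e2.trans e4⟩

theorem desc_invol (s : Equiv.Perm (Fin n)) (t : Fin n → K)
    (H : ∀ i j : Fin n, j.val = i.val + 1 → s j < s i → (s i).val = (s j).val + 1 ∧ t i = t j) (j : Fin n) :
    s (s j) = j ∧ t (s j) = t j := by
  have hI : ∀ i j : Fin n, i < j → s j < s i → (s i).val + i.val = (s j).val + j.val ∧ t i = t j := by
    intro i j h1 h2
    rw [Fin.lt_def] at h1
    exact desc_inv s t H (j.val - i.val) i j (by omega) h2
  have h1 : ∀ m (j : Fin n), j.val = m → s (s j) = j := by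
    intro m
    induction m using Nat.strong_induction_on with
    | _ m ih =>
      intro j hj
      rcases lt_trichotomy (s j) j with h | h | h
      · have := ih (s j).val (by rw [Fin.lt_def] at h; omega) (s j) rfl
        exact s.injective this
      · rw [h, h]
      · obtain ⟨k, hk⟩ := s.surjective j
        rcases lt_trichotomy k j with h' | h' | h'
        · have := ih k.val (by rw [Fin.lt_def] at h'; omega) k rfl
          rw [hk] at this
          rw [this] at h
          exact absurd h h'.not_gt
        · rw [h'] at hk; rw [hk, hk]
        · have := (hI j k h' (by rw [hk]; exact h)).1
          rw [hk] at this
          have e : s j = k := Fin.ext (by omega)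
          rw [e, hk]
  refine ⟨h1 _ j rfl, ?_⟩
  have h2 := h1 _ j rfl
  rcases lt_trichotomy (s j) j with h | h | h
  · exact (hI _ _ h (by rw [h2]; exact h)).2
  · rw [h]
  · exact (hI _ _ h (by rw [h2]; exact h)).2.symm

end Comb

section Sigma
variable {F : Type} [Field F] [Fintype F] {a b c d m n : ℕ}

/-- reversed transpose -/
def rt (X : Matrix (Fin a) (Fin b) F) : Matrix (Fin b) (Fin a) F := X.transpose.submatrix Fin.revPerm Fin.revPerm

theorem rt_apply (X : Matrix (Fin a) (Fin b) F) (i j) : rt X i j = X j.rev i.rev := rfl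

theorem rt_rt (X : Matrix (Fin a) (Fin b) F) : rt (rt X) = X := by
  ext i j; simp [rt_apply]

theorem rt_mul (X : Matrix (Fin a) (Fin b) F) (Y : Matrix (Fin b) (Fin c) F) : rt (X * Y) = rt Y * rt X := by
  rw [rt, Matrix.transpose_mul, ← Matrix.submatrix_mul_equiv _ _ _ Fin.revPerm _]; rfl

theorem rt_add (X Y : Matrix (Fin a) (Fin b) F) : rt (X + Y) = rt X + rt Y := rfl
theorem rt_sub (X Y : Matrix (Fin a) (Fin b) F) : rt (X - Y) = rt X - rt Y := rfl
theorem rt_one : rt (1 : Matrix (Fin a) (Fin a) F) = 1 := by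
  ext i j; rw [rt_apply]; simp [Matrix.one_apply, eq_comm]

def rv (f : Fin a ↪ Fin n) : Fin a ↪ Fin n := ⟨fun i => (f i.rev).rev, fun i j h => by simpa using h⟩

theorem rv_apply (f : Fin a ↪ Fin n) (i) : rv f i = (f i.rev).rev := rfl

theorem rv_disj {f : Fin a ↪ Fin n} {g : Fin b ↪ Fin n} (h : Disj f g) : Disj (rv g) (rv f) := by
  intro i j hij
  rw [rv_apply, rv_apply] at hij
  exact h _ _ (Fin.rev_injective hij).symm

theorem rv_cpl {f : Fin a ↪ Fin n} {g : Fin b ↪ Fin n} (h : Cpl f g) : Cpl (rv g) (rv f) := by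
  refine ⟨rv_disj h.1, fun x => ?_⟩
  rcases h.2 x.rev with ⟨i, hi⟩ | ⟨i, hi⟩
  · right; exact ⟨i.rev, by rw [rv_apply, Fin.rev_rev, hi, Fin.rev_rev]⟩
  · left; exact ⟨i.rev, by rw [rv_apply, Fin.rev_rev, hi, Fin.rev_rev]⟩

theorem rt_JJ (f : Fin a ↪ Fin n) : rt (JJ F f) = Matrix.transpose (JJ F (rv f)) := by
  ext i j
  rw [rt_apply, Matrix.transpose_apply]
  simp only [JJ, Matrix.submatrix_apply, id, Matrix.one_apply, rv_apply]
  congr 1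
  rw [Fin.rev_eq_iff]

theorem rt_JJt (f : Fin a ↪ Fin n) : rt (Matrix.transpose (JJ F f)) = JJ F (rv f) := by
  ext i j
  rw [rt_apply, Matrix.transpose_apply]
  simp only [JJ, Matrix.submatrix_apply, id, Matrix.one_apply, rv_apply]
  congr 1
  rw [Fin.rev_eq_iff]

theorem rt_EE (f : Fin a ↪ Fin m) (g : Fin b ↪ Fin n) (X : Matrix (Fin a) (Fin b) F) :
    rt (EE f g X) = EE (rv g) (rv f) (rt X) := by
  rw [EE, rt_mul, rt_mul, rt_JJ, rt_JJt, EE, Matrix.mul_assoc]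

/-- the anti-automorphism of the general linear group -/
def sg (x : GL (Fin n) F) : GL (Fin n) F :=
  ⟨rt x.val, rt (x⁻¹).val, by rw [← rt_mul, ← Units.val_mul]; simp [rt_one],
    by rw [← rt_mul, ← Units.val_mul]; simp [rt_one]⟩

theorem sg_val (x : GL (Fin n) F) : (sg x).val = rt x.val := rfl

theorem sg_mul (x y : GL (Fin n) F) : sg (x * y) = sg y * sg x := Units.ext (rt_mul _ _)
theorem sg_one : sg (1 : GL (Fin n) F) = 1 := Units.ext rt_one
theorem sg_sg (x : GL (Fin n) F) : sg (sg x) = x := Units.ext (rt_rt _)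

theorem sg_io (f : Fin a ↪ Fin n) (x : GL (Fin a) F) : sg (io f x) = io (rv f) (sg x) := by
  apply Units.ext
  rw [sg_val, io_val, io_val, rt_add, rt_one, rt_EE, rt_sub, rt_one, sg_val]

theorem sg_uu (f : Fin a ↪ Fin n) (g : Fin b ↪ Fin n) (h : Disj f g) (X : Multiplicative (Matrix (Fin a) (Fin b) F)) :
    sg (uu f g h X) = uu (rv g) (rv f) (rv_disj h) (Multiplicative.ofAdd (rt X.toAdd)) := by
  apply Units.ext
  rw [sg_val, uu_val, uu_val, rt_add, rt_one, rt_EE]; rfl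

theorem sg_NN {x : GL (Fin n) F} (hx : x ∈ NN F n) : sg x ∈ NN F n := by
  intro i j hij
  rw [sg_val, rt_apply, hx _ _ (Fin.rev_le_rev.2 hij)]
  simp [Matrix.one_apply, eq_comm]

/-- linear extension as a map to the opposite algebra -/
noncomputable def soH (F : Type) [Field F] [Fintype F] (n : ℕ) : CG (GL (Fin n) F) →ₐ[ℂ] (CG (GL (Fin n) F))ᵐᵒᵖ :=
  MonoidAlgebra.lift ℂ (CG (GL (Fin n) F))ᵐᵒᵖ (GL (Fin n) F)
    { toFun := fun x => MulOpposite.op (gg (sg x))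
      map_one' := by rw [sg_one, gg_one]; rfl
      map_mul' := fun x y => by rw [sg_mul, gg_mul, MulOpposite.op_mul] }

noncomputable def so (x : CG (GL (Fin n) F)) : CG (GL (Fin n) F) := MulOpposite.unop (soH F n x)

theorem so_gg (x : GL (Fin n) F) : so (gg x) = gg (sg x) := by
  simp [so, soH]

theorem so_mul (x y : CG (GL (Fin n) F)) : so (x * y) = so y * so x := by simp [so]
theorem so_add (x y : CG (GL (Fin n) F)) : so (x + y) = so x + so y := by simp [so]
theorem so_smul (c : ℂ) (x : CG (GL (Fin n) F)) : so (c • x) = c • so x := by simp [so]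
theorem so_zero : so (0 : CG (GL (Fin n) F)) = 0 := by simp [so]
theorem so_sum {ι : Type} (s : Finset ι) (x : ι → CG (GL (Fin n) F)) : so (∑ i ∈ s, x i) = ∑ i ∈ s, so (x i) := by
  simp [so]

theorem so_so (x : CG (GL (Fin n) F)) : so (so x) = x := by
  induction x using CG_induction with
  | h1 g => rw [so_gg, so_gg, sg_sg]
  | h2 x y hx hy => rw [so_add, so_add, hx, hy]
  | h3 c x hx => rw [so_smul, so_smul, hx]

theorem so_mp (f : Fin a ↪ Fin n) (x : CG (GL (Fin a) F)) : so (mp (io f) x) = mp (io (rv f)) (so x) := by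
  induction x using CG_induction with
  | h1 g => rw [mp_gg, so_gg, so_gg, mp_gg, sg_io]
  | h2 x y hx hy => rw [map_add, so_add, so_add, map_add, hx, hy]
  | h3 c x hx => rw [map_smul, so_smul, so_smul, map_smul, hx]

theorem so_avg {H H' : Type} [Group H] [Fintype H] [Group H'] [Fintype H'] (j : H →* GL (Fin n) F) (ch : H →* ℂ)
    (j' : H' →* GL (Fin n) F) (ch' : H' →* ℂ) (e : H ≃ H') (h1 : ∀ h, sg (j h) = j' (e h)) (h2 : ∀ h, ch' (e h)⁻¹ = ch h⁻¹) :
    so (avg j ch) = avg j' ch' := by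
  simp only [avg]
  rw [so_smul, so_sum, Fintype.card_congr e]
  congr 1
  refine Fintype.sum_equiv e _ _ fun h => ?_
  rw [so_smul, so_gg, h1, h2]

theorem so_eu (f : Fin a ↪ Fin n) (g : Fin b ↪ Fin n) (h : Disj f g) :
    so (eu f g h : CG (GL (Fin n) F)) = eu (rv g) (rv f) (rv_disj h) := by
  refine so_avg _ _ _ _
    { toFun := fun X => Multiplicative.ofAdd (rt X.toAdd)
      invFun := fun X => Multiplicative.ofAdd (rt X.toAdd)
      left_inv := fun X => by simp [rt_rt]
      right_inv := fun X => by simp [rt_rt] } (fun X => sg_uu f g h X) (fun _ => rfl)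

theorem so_eta (f : Fin a ↪ Fin n) (g : Fin b ↪ Fin n) (h : Disj f g) (x : CG (GL (Fin a) F)) (y : CG (GL (Fin b) F)) :
    so (eta f g h x y) = eta (rv g) (rv f) (rv_disj h) (so y) (so x) := by
  rw [eta, so_mul, so_mul, so_eu, so_mp, so_mp, eta, mp_eu_right, ← mul_assoc, mp_eu_left]

theorem pr_Cn (M : Matrix (Fin n) (Fin n) F) : pr (Cn F n) (rt M) = pr (Cn F n) M := by
  simp only [pr]
  rw [Finset.sum_comm]
  refine Fintype.sum_equiv Fin.revPerm _ _ fun i => Fintype.sum_equiv Fin.revPerm _ _ fun j => ?_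
  rw [rt_apply]
  simp only [Fin.revPerm_apply]
  congr 1
  simp only [Cn, Fin.val_rev]
  congr 1
  apply propext
  have := i.2
  have := j.2
  omega

noncomputable abbrev en (ψ : AddChar F ℂ) (n : ℕ) : CG (GL (Fin n) F) := ec ψ (Cn F n) adm_Cn

theorem so_en (ψ : AddChar F ℂ) : so (en ψ n) = en ψ n := by
  have hinv : ∀ x : NN F n, th ψ (Cn F n) adm_Cn x⁻¹ = (th ψ (Cn F n) adm_Cn x)⁻¹ := fun x =>
    eq_inv_of_mul_eq_one_right (char_inv _ x)
  refine so_avg _ _ _ _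
    { toFun := fun x => ⟨sg x.1, sg_NN x.2⟩
      invFun := fun x => ⟨sg x.1, sg_NN x.2⟩
      left_inv := fun X => by simp [sg_sg]
      right_inv := fun X => by simp [sg_sg] } (fun X => rfl) fun X => ?_
  rw [hinv, hinv]
  congr 1
  show ψ (pr _ (rt X.1.val)) = ψ (pr _ X.1.val)
  rw [pr_Cn]

end Sigma
end HRV


namespace HRV

section Gel
variable {F : Type} [Field F] [Fintype F] {a b c d m n : ℕ}

theorem pt_disj {i j : Fin n} (hij : i ≠ j) : Disj (ptE i) (ptE j) := fun _ _ => hij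

/-- elementary unipotent -/
noncomputable def el (i j : Fin n) (hij : i ≠ j) (x : F) : GL (Fin n) F :=
  uu (ptE i) (ptE j) (pt_disj hij) (Multiplicative.ofAdd (Matrix.of fun _ _ => x))

theorem el_val (i j : Fin n) (hij : i ≠ j) (x : F) : (el i j hij x).val = 1 + Matrix.single i j x := by
  rw [el, uu_val]
  congr 1
  ext p q
  by_cases hp : p = i
  · by_cases hq : q = j
    · subst hp; subst hq
      rw [Matrix.single_apply_same]
      exact EE_apply_apply (ptE p) (ptE q) _ 0 0
    · rw [EE_apply_right, Matrix.single_apply_of_col_ne _ _ (Ne.symm hq)]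
      exact fun _ h => hq h.symm
  · rw [EE_apply_left, Matrix.single_apply_of_row_ne (Ne.symm hp)]
    exact fun _ h => hp h.symm

theorem el_NN {i j : Fin n} (hij : i < j) (x : F) : el i j hij.ne x ∈ NN F n := by
  apply uu_NN
  intro _ _ h
  exact absurd h hij.not_gt

theorem pr_el {C : Matrix (Fin n) (Fin n) F} (hC : Adm C) (i j : Fin n) (hij : i ≠ j) (x : F) :
    pr C (el i j hij x).val = C i j * x := by
  rw [el, uu_val, pr_add, pr_one hC, zero_add, pr_EE]
  simp only [Finset.univ_unique, Finset.sum_singleton]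
  rfl

theorem Mon.val {r : Equiv.Perm (Fin n)} {x : GL (Fin n) F} (hx : Mon r x) (i j) :
    x.val i j = if i = r j then x.val (r j) j else 0 := by
  split_ifs with h
  · rw [h]
  · exact hx i j h

theorem Mon.el {r : Equiv.Perm (Fin n)} {m : GL (Fin n) F} (hm : Mon r m) (i j : Fin n) (hij : i ≠ j) (x : F) :
    m * el i j hij x = el (r i) (r j) (fun h => hij (r.injective h)) (m.val (r i) i * x * (m.val (r j) j)⁻¹) * m := by
  apply Units.ext
  rw [Units.val_mul, Units.val_mul, el_val, el_val, mul_add, add_mul, mul_one, one_mul]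
  congr 1
  ext p q
  rw [Matrix.mul_apply, Matrix.mul_apply, Finset.sum_eq_single i, Finset.sum_eq_single (r j)]
  · by_cases hq : q = j
    · subst hq
      rw [Matrix.single_apply_same]
      by_cases hp : p = r i
      · subst hp
        rw [Matrix.single_apply_same, inv_mul_cancel_right₀ (hm.ne_zero _)]
      · rw [hm _ _ hp, Matrix.single_apply_of_row_ne (Ne.symm hp), zero_mul, zero_mul]
    · rw [Matrix.single_apply_of_col_ne _ _ (Ne.symm hq), hm _ _ (fun h => hq (r.injective h).symm), mul_zero, mul_zero]
  · intro k _ hk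
    rw [Matrix.single_apply_of_col_ne _ _ (Ne.symm hk), zero_mul]
  · simp
  · intro k _ hk
    rw [Matrix.single_apply_of_row_ne (Ne.symm hk), mul_zero]
  · simp

theorem psi_eq {ψ : AddChar F ℂ} (hψ : ψ ≠ 1) {c d : F} (h : ∀ x, ψ (c * x) = ψ (d * x)) : c = d := by
  by_contra hcd
  apply hψ
  ext x
  have h1 := h ((c - d)⁻¹ * x)
  have h2 : c * ((c - d)⁻¹ * x) = d * ((c - d)⁻¹ * x) + x := by
    field_simp [sub_ne_zero.2 hcd]
    ring
  rw [h2, AddChar.map_add_eq_mul] at h1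
  have h3 : ψ (d * ((c - d)⁻¹ * x)) ≠ 0 := by
    intro h0
    have := AddChar.map_add_eq_mul ψ (d * ((c - d)⁻¹ * x)) (- (d * ((c - d)⁻¹ * x)))
    rw [h0, zero_mul, add_neg_cancel, AddChar.map_zero_eq_one] at this
    exact one_ne_zero this
  rw [AddChar.one_apply]
  exact mul_left_cancel₀ h3 (by rw [h1, mul_one])

theorem gel_cond {ψ : AddChar F ℂ} (hψ : ψ ≠ 1) {r : Equiv.Perm (Fin n)} {m : GL (Fin n) F} (hm : Mon r m)
    (hne : en ψ n * gg m * en ψ n ≠ 0) (i j : Fin n) (hij : j.val = i.val + 1) (hr : r i < r j) :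
    (r j).val = (r i).val + 1 ∧ m.val (r i) i = m.val (r j) j := by
  have hlt : i < j := by rw [Fin.lt_def]; omega
  have key : ∀ x, ψ (Cn F n (r i) (r j) * (m.val (r i) i * x * (m.val (r j) j)⁻¹)) = ψ (Cn F n i j * x) := by
    intro x
    have h1 : en ψ n * gg (m * el i j hlt.ne x) * en ψ n = ψ (Cn F n i j * x) • (en ψ n * gg m * en ψ n) := by
      rw [gg_mul, mul_assoc, mul_assoc, ec_left ψ adm_Cn (el_NN hlt x), pr_el adm_Cn, mul_smul_comm, mul_smul_comm, mul_assoc]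
    have h2 : en ψ n * gg (m * el i j hlt.ne x) * en ψ n =
        ψ (Cn F n (r i) (r j) * (m.val (r i) i * x * (m.val (r j) j)⁻¹)) • (en ψ n * gg m * en ψ n) := by
      rw [hm.el, gg_mul, ← mul_assoc, ec_right ψ adm_Cn (el_NN hr _), pr_el adm_Cn, smul_mul_assoc, smul_mul_assoc]
    rw [h1] at h2
    exact (smul_left_injective ℂ hne h2).symm
  have hk : Cn F n (r i) (r j) * (m.val (r i) i * (m.val (r j) j)⁻¹) = Cn F n i j := by
    apply psi_eq hψ
    intro x
    rw [← key x]
    congr 1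
    ring
  have h1 : Cn F n i j = 1 := if_pos hij
  rw [h1] at hk
  by_cases h2 : (r j).val = (r i).val + 1
  · refine ⟨h2, ?_⟩
    have h3 : Cn F n (r i) (r j) = 1 := if_pos h2
    rw [h3, one_mul] at hk
    exact eq_of_div_eq_one (by rw [div_eq_mul_inv]; exact hk)
  · have h3 : Cn F n (r i) (r j) = 0 := if_neg h2
    rw [h3, zero_mul] at hk
    exact absurd hk zero_ne_one

theorem gel_fix {ψ : AddChar F ℂ} (hψ : ψ ≠ 1) {r : Equiv.Perm (Fin n)} {m : GL (Fin n) F} (hm : Mon r m)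
    (hne : en ψ n * gg m * en ψ n ≠ 0) : sg m = m := by
  have H := desc_invol (r.trans Fin.revPerm) (fun j => m.val (r j) j) (by
    intro i j hij hs
    simp only [Equiv.trans_apply, Fin.revPerm_apply, Fin.rev_lt_rev] at hs ⊢
    obtain ⟨h1, h2⟩ := gel_cond hψ hm hne i j hij hs
    refine ⟨?_, h2⟩
    rw [Fin.val_rev, Fin.val_rev]
    have := (r j).2
    omega)
  simp only [Equiv.trans_apply, Fin.revPerm_apply] at H
  apply Units.ext
  ext i j
  rw [sg_val, rt_apply]
  have H1 : ∀ j, m.val j.rev (r j).rev = m.val (r j) j := by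
    intro j
    rw [← (H j).2]
    have := congrArg Fin.rev (H j).1
    rw [Fin.rev_rev] at this
    rw [this]
  by_cases hi : i = r j
  · rw [hi, H1]
  · rw [hm i j hi, hm]
    intro h
    apply hi
    have h1 := (H i.rev).1
    rw [← h, Fin.rev_rev] at h1
    have := congrArg Fin.rev h1
    rw [Fin.rev_rev, Fin.rev_rev] at this
    exact this.symm

theorem so_hecke {ψ : AddChar F ℂ} (hψ : ψ ≠ 1) (x : CG (GL (Fin n) F)) :
    so (en ψ n * x * en ψ n) = en ψ n * x * en ψ n := by
  induction x using CG_induction with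
  | h1 g =>
    obtain ⟨u, v, r, m, hu, hv, hm, rfl⟩ := bruhat g
    have h1 : en ψ n * gg (u * m * v) * en ψ n = (ψ (pr (Cn F n) u.val) * ψ (pr (Cn F n) v.val)) • (en ψ n * gg m * en ψ n) := by
      rw [gg_mul, gg_mul, ← mul_assoc, ← mul_assoc, ec_right ψ adm_Cn hu, mul_assoc _ (gg v), ec_left ψ adm_Cn hv]
      simp only [smul_mul_assoc, mul_smul_comm, smul_smul, mul_comm]
    rw [h1, so_smul]
    congr 1
    by_cases h0 : en ψ n * gg m * en ψ n = 0
    · rw [h0, so_zero]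
    · rw [so_mul, so_mul, so_en, so_gg, gel_fix hψ hm h0, mul_assoc]
  | h2 x y hx hy => rw [mul_add, add_mul, so_add, hx, hy]
  | h3 c x hx => rw [mul_smul_comm, smul_mul_assoc, so_smul, hx]

theorem hecke_comm {ψ : AddChar F ℂ} (hψ : ψ ≠ 1) (x y : CG (GL (Fin n) F)) :
    (en ψ n * x * en ψ n) * (en ψ n * y * en ψ n) = (en ψ n * y * en ψ n) * (en ψ n * x * en ψ n) := by
  have h : (en ψ n * x * en ψ n) * (en ψ n * y * en ψ n) = en ψ n * (x * en ψ n * en ψ n * y) * en ψ n := by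
    simp only [mul_assoc]
  rw [h, ← so_hecke hψ, ← h, so_mul, so_hecke hψ, so_hecke hψ]

theorem rank_le_one_of_comm {ι : Type} [Fintype ι] [DecidableEq ι] (P : Matrix ι ι ℂ) (hP : P * P = P)
    (h : ∀ M N, (P * M * P) * (P * N * P) = (P * N * P) * (P * M * P)) : P.rank ≤ 1 := by
  by_cases h0 : P = 0
  · rw [h0]; simp
  have : ∃ u y, P u y ≠ 0 := by
    by_contra hc; push Not at hc; exact h0 (Matrix.ext hc)
  obtain ⟨y, u, hyu⟩ := this
  -- P x yᵀ P u zᵀ P = P u zᵀ P x yᵀ P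
  have key : ∀ p i j q, P p i * P y u * P j q = P p u * P j i * P y q := by
    intro p i j q
    have := h (Matrix.single i y 1) (Matrix.single u j 1)
    have e : ∀ i y u j, (P * Matrix.single i y 1 * P) * (P * Matrix.single u j 1 * P) =
        P * (Matrix.single i y 1 * P * Matrix.single u j 1) * P := by
      intro i y u j
      calc _ = P * Matrix.single i y 1 * (P * P) * Matrix.single u j 1 * P := by simp only [Matrix.mul_assoc]
        _ = _ := by rw [hP]; simp only [Matrix.mul_assoc]
    have e2 : ∀ i y u j, Matrix.single i y (1 : ℂ) * P * Matrix.single u j 1 = Matrix.single i j (P y u) := by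
      intro i y u j
      ext s t
      simp [Matrix.single_mul_mul_single] 
    have e3 : ∀ i j (c : ℂ) p q, (P * Matrix.single i j c * P) p q = P p i * c * P j q := by
      intro i j c p q
      rw [Matrix.mul_apply, Finset.sum_eq_single j]
      · rw [Matrix.mul_single_apply_same]
      · intro k _ hk
        rw [Matrix.mul_single_apply_of_ne _ _ _ _ _ hk, zero_mul]
      · simp
    rw [e, e, e2, e2] at this
    have := congrFun (congrFun this p) q
    rw [e3, e3] at this
    exact this
  have : P = Matrix.vecMulVec (fun p => P p u) (fun q => (∑ i, P i i) * (P y u)⁻¹ * P y q) := by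
    ext p q
    conv_lhs => rw [← hP]
    rw [Matrix.mul_apply, Matrix.vecMulVec_apply]
    have : ∀ i, P p i * P i q = P p u * (P i i * (P y u)⁻¹ * P y q) := by
      intro i
      have := key p i i q
      field_simp
      linear_combination this
    simp only [this, Finset.mul_sum, Finset.sum_mul]
  rw [this]
  exact Matrix.rank_vecMulVec_le _ _

theorem rank_en {ψ : AddChar F ℂ} (hψ : ψ ≠ 1) (k : Irr (GL (Fin n) F)) : (rep k (en ψ n)).rank ≤ 1 := by
  classical
  apply rank_le_one_of_comm
  · rw [← map_mul, ec_idem]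
  · intro M N
    obtain ⟨x, rfl⟩ := rep_surj k M
    obtain ⟨y, rfl⟩ := rep_surj k N
    simp only [← map_mul]
    rw [hecke_comm hψ]

/-- generic -/
def Gen (ψ : AddChar F ℂ) (k : Irr (GL (Fin n) F)) : Prop := rep k (en ψ n) ≠ 0

theorem so_central {x : CG (GL (Fin n) F)} (h : ∀ y, x * y = y * x) (y) : so x * y = y * so x := by
  have := congrArg so (h (so y))
  rw [so_mul, so_mul, so_so] at this
  exact this.symm

theorem so_zz {ψ : AddChar F ℂ} (hψ : ψ ≠ 1) {k : Irr (GL (Fin n) F)} (hk : Gen ψ k) : so (zz k) = zz k := by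
  have h1 : zz k * en ψ n = en ψ n * zz k * en ψ n := by
    rw [← zz_comm, mul_assoc, ec_idem]
  have h2 : so (zz k) * en ψ n = zz k * en ψ n := by
    rw [so_central (zz_comm k)]
    conv_rhs => rw [h1, ← so_hecke hψ, ← h1, so_mul, so_en]
  have h3 : rep k (so (zz k)) ≠ 0 := by
    intro h0
    have := congrArg (rep k) h2
    rw [map_mul, map_mul, h0, zero_mul, rep_zz_self, one_mul] at this
    exact hk this.symm
  have h4 : rep k (so (zz k)) = 1 := by
    have h5 : ∃ c : ℂ, rep k (so (zz k)) = c • 1 := by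
      refine ⟨_, scalar_of_commute k _ ?_⟩
      intro y
      rw [← map_mul, ← map_mul, so_central (zz_comm k)]
    obtain ⟨c, hc⟩ := h5
    have h6 : rep k (so (zz k)) * rep k (so (zz k)) = rep k (so (zz k)) := by
      rw [← map_mul, ← so_mul, zz_mul_self]
    rw [hc] at h6 h3 ⊢
    have hc0 : c ≠ 0 := by rintro rfl; simp at h3
    have : (1 : Matrix (Fin (dm (GL (Fin n) F) k)) (Fin (dm (GL (Fin n) F) k)) ℂ) ≠ 0 := one_ne_zero
    rw [smul_mul_smul_comm, mul_one] at h6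
    have := smul_left_injective ℂ this h6
    have : c = 1 := mul_left_cancel₀ hc0 (by rw [mul_one]; exact this)
    rw [this, one_smul]
  have h5 : zz k * so (zz k) = zz k := by
    apply eq_of_rep
    intro l
    by_cases hl : l = k
    · subst hl; rw [map_mul, rep_zz_self, h4, one_mul]
    · rw [map_mul, rep_zz_ne hl, zero_mul]
  calc so (zz k) = so (zz k * so (zz k)) := by rw [h5]
    _ = zz k * so (zz k) := by rw [so_mul, so_so]
    _ = zz k := h5

theorem Rel.symm {ψ : AddChar F ℂ} (hψ : ψ ≠ 1) {k : Irr (GL (Fin n) F)} {i : Irr (GL (Fin a) F)} {j : Irr (GL (Fin b) F)}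
    (hk : Gen ψ k) (hi : Gen ψ i) (hj : Gen ψ j) (h : Rel k i j) : Rel k j i := by
  obtain ⟨f, g, hc, h0⟩ := h
  refine ⟨rv g, rv f, rv_cpl hc, ?_⟩
  rw [← zz_mul_ne_zero_iff] at h0 ⊢
  intro h1
  apply h0
  rw [← so_so (zz k * _), so_mul, so_eta, so_zz hψ hk, so_zz hψ hi, so_zz hψ hj, ← zz_comm, h1, so_zero]

end Gel
end HRV


namespace HRV

section LW
variable {F : Type} [Field F] [Fintype F] {a b c d m n : ℕ}

theorem exists_mono (f : Fin a ↪ Fin n) : ∃ f' : Fin a ↪ Fin n, StrictMono f' ∧ (∀ i, ∃ j, f' i = f j) ∧ (∀ i, ∃ j, f i = f' j) := by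
  classical
  let S : Finset (Fin n) := Finset.univ.map f
  have hS : S.card = a := by simp [S]
  refine ⟨(S.orderEmbOfFin hS).toEmbedding, (S.orderEmbOfFin hS).strictMono, fun i => ?_, fun i => ?_⟩
  · have := Finset.orderEmbOfFin_mem S hS i
    obtain ⟨j, -, hj⟩ := Finset.mem_map.1 this
    exact ⟨j, hj.symm⟩
  · have : f i ∈ Set.range (S.orderEmbOfFin hS) := by
      rw [Finset.range_orderEmbOfFin]
      exact Finset.mem_coe.2 (Finset.mem_map_of_mem f (Finset.mem_univ i))
    obtain ⟨j, hj⟩ := this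
    exact ⟨j, hj.symm⟩

theorem bruhat_mono {f : Fin a ↪ Fin n} {g : Fin b ↪ Fin n} (h : Std f g) (x : GL (Fin n) F) :
    ∃ u ∈ NN F n, ∃ (w : Equiv.Perm (Fin n)) (y : GL (Fin n) F), StrictMono (cmp w.toEmbedding f) ∧ StrictMono (cmp w.toEmbedding g) ∧
      (∀ i j, y.val (g i) (f j) = 0) ∧ x = u * pm w * y := by
  obtain ⟨u, hu, r, y, hy, rfl⟩ := bruhat_std h x
  obtain ⟨f', hf', hf1, hf2⟩ := exists_mono (cmp r.toEmbedding f)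
  obtain ⟨g', hg', hg1, hg2⟩ := exists_mono (cmp r.toEmbedding g)
  have hc : Cpl f' g' := by
    have hcr := h.cpl.map r
    refine ⟨fun i j hij => ?_, fun x => ?_⟩
    · obtain ⟨i', hi⟩ := hf1 i
      obtain ⟨j', hj⟩ := hg1 j
      exact hcr.1 i' j' (by rw [← hi, ← hj, hij])
    · rcases hcr.2 x with ⟨i, hi⟩ | ⟨i, hi⟩
      · obtain ⟨j, hj⟩ := hf2 i
        left; exact ⟨j, by rw [← hj, hi]⟩
      · obtain ⟨j, hj⟩ := hg2 i
        right; exact ⟨j, by rw [← hj, hi]⟩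
  obtain ⟨w, hw1, hw2⟩ := h.cpl.exists_perm hc
  refine ⟨u, hu, w, pm (w⁻¹ * r) * y, by rw [hw1]; exact hf', by rw [hw2]; exact hg', fun i j => ?_, ?_⟩
  · obtain ⟨i', hi'⟩ := hg1 i
    have e1 : g i = (w⁻¹ * r) (g i') := by
      have : w (g i) = r (g i') := by
        have h1 : g' i = w (g i) := by rw [← hw2]; rfl
        rw [← h1, hi']; rfl
      rw [Equiv.Perm.mul_apply, ← this]; simp
    rw [e1, pm_mul_apply]
    exact hy i' j
  · rw [map_mul, map_inv]; group

/-- total version of `ec` -/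
noncomputable def ecx (ψ : AddChar F ℂ) (C : Matrix (Fin n) (Fin n) F) : CG (GL (Fin n) F) :=
  open Classical in if h : Adm C then ec ψ C h else 0

theorem ecx_eq (ψ : AddChar F ℂ) {C : Matrix (Fin n) (Fin n) F} (hC : Adm C) : ecx ψ C = ec ψ C hC := dif_pos hC

noncomputable def rk (ψ : AddChar F ℂ) (C : Matrix (Fin n) (Fin n) F) (k : Irr (GL (Fin n) F)) : ℕ := (rep k (ecx ψ C)).rank

section general
variable {G : Type} [Group G] [Fintype G]

noncomputable def SS (x y : CG G) : Submodule ℂ (CG G) :=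
  LinearMap.range ((LinearMap.mulLeft ℂ x).comp (LinearMap.mulRight ℂ y))

theorem mem_SS {x y z : CG G} : z ∈ SS x y ↔ ∃ t, x * t * y = z := by
  simp only [SS, LinearMap.mem_range, LinearMap.comp_apply, LinearMap.mulLeft_apply, LinearMap.mulRight_apply, mul_assoc]

/-- column of a representation matrix as a linear map -/
noncomputable def colL (k : Irr G) (q : Fin (dm G k)) : CG G →ₗ[ℂ] (Fin (dm G k) → ℂ) where
  toFun x := fun p => rep k x p q
  map_add' x y := by ext p; simp
  map_smul' c x := by ext p; simp

theorem finrank_SS_le (k : Irr G) (e : CG G) : Module.finrank ℂ (SS e (ep k)) ≤ (rep k e).rank := by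
  have h1 : ∀ z : SS e (ep k), colL k 0 z.1 ∈ LinearMap.range (rep k e).mulVecLin := by
    rintro ⟨z, hz⟩
    obtain ⟨t, rfl⟩ := mem_SS.1 hz
    refine ⟨fun p => rep k (t * ep k) p 0, ?_⟩
    ext p
    simp only [colL, LinearMap.coe_mk, AddHom.coe_mk, Matrix.mulVecLin_apply, mul_assoc]
    rw [map_mul (rep k) e, Matrix.mul_apply]
    rfl
  let T : SS e (ep k) →ₗ[ℂ] LinearMap.range (rep k e).mulVecLin :=
    ((colL k 0).comp (SS e (ep k)).subtype).codRestrict _ h1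
  refine LinearMap.finrank_le_finrank_of_injective (f := T) ?_
  rw [← LinearMap.ker_eq_bot, LinearMap.ker_eq_bot']
  rintro ⟨z, hz⟩ hT
  obtain ⟨t, rfl⟩ := mem_SS.1 hz
  have h2 : colL k 0 (e * t * ep k) = 0 := congrArg Subtype.val hT
  apply Subtype.ext
  apply eq_of_rep
  intro l
  show rep l (e * t * ep k) = rep l 0
  rw [map_zero]
  by_cases hl : l = k
  · subst hl
    ext p q
    by_cases hq : q = 0
    · subst hq; exact congrFun h2 p
    · rw [map_mul, rep_ep_self, Matrix.mul_single_apply_of_ne _ _ _ _ _ hq]; rfl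
  · rw [map_mul, rep_ep_ne hl, mul_zero]

theorem rank_le_finrank_SS (k : Irr G) (e y : CG G) (hy : rep k y ≠ 0) : (rep k e).rank ≤ Module.finrank ℂ (SS e y) := by
  have : ∃ p q, rep k y p q ≠ 0 := by
    by_contra hc; push Not at hc; exact hy (Matrix.ext hc)
  obtain ⟨p, q, hpq⟩ := this
  have h1 : LinearMap.range (rep k e).mulVecLin ≤ (SS e y).map (colL k q) := by
    rintro _ ⟨v, rfl⟩
    obtain ⟨t, ht⟩ := rep_surj k (Matrix.of fun i j => if j = p then v i * (rep k y p q)⁻¹ else 0)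
    refine ⟨e * t * y, mem_SS.2 ⟨t, rfl⟩, ?_⟩
    ext i
    simp only [colL, LinearMap.coe_mk, AddHom.coe_mk, Matrix.mulVecLin_apply, mul_assoc]
    rw [map_mul, map_mul, ht, Matrix.mul_apply]
    refine Finset.sum_congr rfl fun j _ => ?_
    congr 1
    rw [Matrix.mul_apply, Finset.sum_eq_single p]
    · simp [hpq]
    · intro s _ hs; simp [hs]
    · simp
  exact (Submodule.finrank_mono h1).trans (Submodule.finrank_map_le _ _)

end general

/-- survivors -/
def Sv (ψ : AddChar F ℂ) (C : Matrix (Fin n) (Fin n) F) {f : Fin a ↪ Fin n} {g : Fin b ↪ Fin n} (h : Cpl f g) (w : Equiv.Perm (Fin n)) : Prop :=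
  StrictMono (cmp w.toEmbedding f) ∧ StrictMono (cmp w.toEmbedding g) ∧
    ecx ψ C * eu (cmp w.toEmbedding f) (cmp w.toEmbedding g) (h.map w).1 ≠ 0

theorem ec_eta (ψ : AddChar F ℂ) {C : Matrix (Fin n) (Fin n) F} (hC : Adm C) {f : Fin a ↪ Fin n} {g : Fin b ↪ Fin n}
    (hc : Disj f g) (hf : StrictMono f) (hg : StrictMono g) (x y) :
    ecx ψ C * eta f g hc x y = ecx ψ C * eta f g hc (ecx ψ (C.submatrix f f) * x) (ecx ψ (C.submatrix g g) * y) := by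
  rw [← mul_eta, ← mul_assoc, ← mul_assoc, ecx_eq ψ hC, ecx_eq ψ (hC.sub hf), ecx_eq ψ (hC.sub hg), ec_io_left ψ hC hf,
    ec_io_left ψ hC hg]

open Classical in
theorem lemmaW (ψ : AddChar F ℂ) {C : Matrix (Fin n) (Fin n) F} (hC : Adm C) (i : Irr (GL (Fin a) F)) (j : Irr (GL (Fin b) F))
    {f : Fin a ↪ Fin n} {g : Fin b ↪ Fin n} (h : Std f g) :
    Module.finrank ℂ (SS (ecx ψ C) (eta f g h.cpl.1 (ep i) (ep j))) ≤
      ∑ w ∈ Finset.univ.filter (Sv ψ C h.cpl), rk ψ (C.submatrix (w ∘ f) (w ∘ f)) i * rk ψ (C.submatrix (w ∘ g) (w ∘ g)) j := by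
  let Si : Equiv.Perm (Fin n) → Submodule ℂ (CG (GL (Fin a) F)) := fun w => SS (ecx ψ (C.submatrix (w ∘ f) (w ∘ f))) (ep i)
  let Sj : Equiv.Perm (Fin n) → Submodule ℂ (CG (GL (Fin b) F)) := fun w => SS (ecx ψ (C.submatrix (w ∘ g) (w ∘ g))) (ep j)
  let W : Equiv.Perm (Fin n) → Submodule ℂ (CG (GL (Fin n) F)) := fun w =>
    Submodule.span ℂ (Set.range fun pq : Fin (Module.finrank ℂ (Si w)) × Fin (Module.finrank ℂ (Sj w)) =>
      ecx ψ C * eta (cmp w.toEmbedding f) (cmp w.toEmbedding g) (h.cpl.map w).1 (Module.finBasis ℂ (Si w) pq.1).1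
        (Module.finBasis ℂ (Sj w) pq.2).1 * gg (pm w))
  have hW : ∀ w x y, x ∈ Si w → y ∈ Sj w →
      ecx ψ C * eta (cmp w.toEmbedding f) (cmp w.toEmbedding g) (h.cpl.map w).1 x y * gg (pm w) ∈ W w := by
    intro w x y hx hy
    have ex : x = ∑ p, (Module.finBasis ℂ (Si w)).repr ⟨x, hx⟩ p • (Module.finBasis ℂ (Si w) p).1 := by
      have := congrArg Subtype.val ((Module.finBasis ℂ (Si w)).sum_repr ⟨x, hx⟩)
      exact this.symm.trans (by rw [Submodule.coe_sum]; rfl)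
    have ey : y = ∑ p, (Module.finBasis ℂ (Sj w)).repr ⟨y, hy⟩ p • (Module.finBasis ℂ (Sj w) p).1 := by
      have := congrArg Subtype.val ((Module.finBasis ℂ (Sj w)).sum_repr ⟨y, hy⟩)
      exact this.symm.trans (by rw [Submodule.coe_sum]; rfl)
    rw [ex, ey, eta_sum_left, Finset.mul_sum, Finset.sum_mul]
    refine Submodule.sum_mem _ fun p _ => ?_
    rw [eta_sum_right, Finset.mul_sum, Finset.sum_mul]
    refine Submodule.sum_mem _ fun q _ => ?_
    simp only [eta, map_smul, mul_smul_comm, smul_mul_assoc]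
    refine Submodule.smul_mem _ _ (Submodule.smul_mem _ _ ?_)
    exact Submodule.subset_span ⟨(p, q), rfl⟩
  have hfin : ∀ w, Module.finrank ℂ (W w) ≤ rk ψ (C.submatrix (w ∘ f) (w ∘ f)) i * rk ψ (C.submatrix (w ∘ g) (w ∘ g)) j := by
    intro w
    refine (finrank_range_le_card _).trans ?_
    rw [Fintype.card_prod, Fintype.card_fin, Fintype.card_fin]
    exact Nat.mul_le_mul (finrank_SS_le _ _) (finrank_SS_le _ _)
  have hV : SS (ecx ψ C) (eta f g h.cpl.1 (ep i) (ep j)) ≤ ⨆ w ∈ Finset.univ.filter (Sv ψ C h.cpl), W w := by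
    intro z hz
    obtain ⟨t, rfl⟩ := mem_SS.1 hz
    clear hz
    induction t using CG_induction with
    | h1 x =>
      obtain ⟨u, hu, w, y, hw1, hw2, hy, rfl⟩ := bruhat_mono h x
      obtain ⟨p, q, hpq⟩ := gg_eta h.cpl y hy
      have e1 : ecx ψ C * gg (u * pm w * y) * eta f g h.cpl.1 (ep i) (ep j) = ψ (pr C u.val) •
          (ecx ψ C * eta (cmp w.toEmbedding f) (cmp w.toEmbedding g) (h.cpl.map w).1 (gg p * ep i) (gg q * ep j) * gg (pm w)) := by
        rw [gg_mul, gg_mul, mul_assoc, mul_assoc, hpq, mul_assoc (gg u), pm_eta, ← mul_assoc, ecx_eq ψ hC, ec_right ψ hC hu, smul_mul_assoc, mul_assoc]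
      rw [e1]
      refine Submodule.smul_mem _ _ ?_
      by_cases hs : ecx ψ C * eu (cmp w.toEmbedding f) (cmp w.toEmbedding g) (h.cpl.map w).1 = 0
      · rw [eta, ← mul_assoc, ← mul_assoc, hs, zero_mul, zero_mul, zero_mul]
        exact Submodule.zero_mem _
      · have hSv : Sv ψ C h.cpl w := ⟨hw1, hw2, hs⟩
        refine (le_iSup₂_of_le (f := fun w _ => W w) w (by simp [hSv]) le_rfl) ?_
        rw [ec_eta ψ hC _ hw1 hw2]
        apply hW
        · exact mem_SS.2 ⟨gg p, by rw [mul_assoc]; rfl⟩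
        · exact mem_SS.2 ⟨gg q, by rw [mul_assoc]; rfl⟩
    | h2 x y hx hy => rw [mul_add, add_mul]; exact Submodule.add_mem _ hx hy
    | h3 c x hx => rw [mul_smul_comm, smul_mul_assoc]; exact Submodule.smul_mem _ _ hx
  refine (Submodule.finrank_mono hV).trans ?_
  have : ∀ s : Finset (Equiv.Perm (Fin n)), Module.finrank ℂ (⨆ w ∈ s, W w : Submodule ℂ (CG (GL (Fin n) F))) ≤ ∑ w ∈ s, Module.finrank ℂ (W w) := by
    intro s
    induction s using Finset.induction_on with
    | empty => simp
    | insert w s hw ih =>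
      rw [Finset.iSup_insert, Finset.sum_insert hw]
      exact (Submodule.finrank_add_le_finrank_add_finrank _ _).trans (Nat.add_le_add_left ih _)
  exact (this _).trans (Finset.sum_le_sum fun w _ => hfin w)

end LW
end HRV


namespace HRV

section LW2
variable {F : Type} [Field F] [Fintype F] {a b c d m n : ℕ}

theorem psi_ne {ψ : AddChar F ℂ} (hψ : ψ ≠ 1) : ∃ t, ψ t ≠ 1 := by
  by_contra h; push Not at h; exact hψ (by ext t; simp [h t])

theorem ec_eu_zero {ψ : AddChar F ℂ} (hψ : ψ ≠ 1) {C : Matrix (Fin n) (Fin n) F} (hC : Adm C) {f : Fin a ↪ Fin n} {g : Fin b ↪ Fin n}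
    (h : Disj f g) (x : Fin a) (y : Fin b) (hxy : C (f x) (g y) ≠ 0) : ecx ψ C * eu f g h = 0 := by
  obtain ⟨t, ht⟩ := psi_ne hψ
  rcases hC (f x) (g y) with h0 | ⟨h1, h2⟩
  · exact absurd h0 hxy
  have hN : uu f g h (Multiplicative.ofAdd (Matrix.single x y t)) ∈ NN F n := by
    apply uu_NN
    intro i j hij
    by_cases hi : i = x
    · by_cases hj : j = y
      · subst hi; subst hj
        rw [Fin.lt_def] at hij; omega
      · exact Matrix.single_apply_of_col_ne _ _ (Ne.symm hj) _
    · exact Matrix.single_apply_of_row_ne (Ne.symm hi) _ _ _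
  have e1 : ψ (pr C (uu f g h (Multiplicative.ofAdd (Matrix.single x y t))).val) = ψ t := by
    rw [pr_uu hC]
    show ψ (∑ i, ∑ j, C (f i) (g j) * (Matrix.single x y t) i j) = ψ t
    congr 1
    rw [Finset.sum_eq_single x, Finset.sum_eq_single y]
    · simp [h1]
    · intro j _ hj; rw [Matrix.single_apply_of_col_ne _ _ (Ne.symm hj), mul_zero]
    · simp
    · intro i _ hi
      exact Finset.sum_eq_zero fun j _ => by rw [Matrix.single_apply_of_row_ne (Ne.symm hi), mul_zero]
    · simp
  have e2 : ecx ψ C * eu f g h = ψ t • (ecx ψ C * eu f g h) := by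
    conv_lhs => rw [← eu_left f g h (Multiplicative.ofAdd (Matrix.single x y t)), ← mul_assoc, ecx_eq ψ hC, ec_right ψ hC hN, e1,
      smul_mul_assoc]
    rw [ecx_eq ψ hC]
  by_contra hne
  apply ht
  have : (1 : ℂ) • (ecx ψ C * eu f g h) = ψ t • (ecx ψ C * eu f g h) := by rw [one_smul]; exact e2
  exact (smul_left_injective ℂ hne this).symm

theorem Sv.std {ψ : AddChar F ℂ} (hψ : ψ ≠ 1) {f : Fin a ↪ Fin n} {g : Fin b ↪ Fin n} {h : Cpl f g} {w : Equiv.Perm (Fin n)}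
    (hw : Sv ψ (Cn F n) h w) : Std (cmp w.toEmbedding g) (cmp w.toEmbedding f) := by
  obtain ⟨h1, h2, h3⟩ := hw
  have hc := h.map w
  refine ⟨hc.symm, h2, h1, ?_⟩
  intro y x
  by_contra hlt
  have hle := not_lt.1 hlt
  have key : ∀ d : ℕ, ∀ v : Fin n, v.val = (cmp w.toEmbedding f x).val + d → ∃ x', cmp w.toEmbedding f x' = v := by
    intro d
    induction d with
    | zero => intro v hv; exact ⟨x, Fin.ext (by omega)⟩
    | succ d ih =>
      intro v hv
      obtain ⟨x', hx'⟩ := ih ⟨v.val - 1, by omega⟩ (by show v.val - 1 = _; omega)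
      rcases hc.2 v with h | ⟨y', hy'⟩
      · exact h
      · exfalso
        apply h3
        apply ec_eu_zero hψ adm_Cn _ x' y'
        rw [hx', hy']
        have : Cn F n ⟨v.val - 1, by omega⟩ v = 1 := if_pos (by show v.val = v.val - 1 + 1; omega)
        rw [this]; exact one_ne_zero
  rw [Fin.le_def] at hle
  obtain ⟨x', hx'⟩ := key ((cmp w.toEmbedding g y).val - (cmp w.toEmbedding f x).val) (cmp w.toEmbedding g y) (by omega)
  exact hc.1 _ _ hx'

theorem Std.Cn_f {f : Fin a ↪ Fin n} {g : Fin b ↪ Fin n} (h : Std f g) : (Cn F n).submatrix f f = Cn F a := by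
  ext i j
  simp only [Matrix.submatrix_apply, Cn, h.vals.1]

theorem Std.Cn_g {f : Fin a ↪ Fin n} {g : Fin b ↪ Fin n} (h : Std f g) : (Cn F n).submatrix g g = Cn F b := by
  ext i j
  simp only [Matrix.submatrix_apply, Cn, h.vals.2]
  congr 1
  apply propext
  omega

open Classical in
theorem lemmaW_full {ψ : AddChar F ℂ} (hψ : ψ ≠ 1) (i : Irr (GL (Fin a) F)) (j : Irr (GL (Fin b) F))
    {f : Fin a ↪ Fin n} {g : Fin b ↪ Fin n} (h : Std f g) :
    Module.finrank ℂ (SS (ecx ψ (Cn F n)) (eta f g h.cpl.1 (ep i) (ep j))) ≤ rk ψ (Cn F a) i * rk ψ (Cn F b) j := by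
  refine (lemmaW ψ adm_Cn i j h).trans ?_
  have h1 : ∀ w ∈ Finset.univ.filter (Sv ψ (Cn F n) h.cpl),
      rk ψ ((Cn F n).submatrix (w ∘ f) (w ∘ f)) i * rk ψ ((Cn F n).submatrix (w ∘ g) (w ∘ g)) j = rk ψ (Cn F a) i * rk ψ (Cn F b) j := by
    intro w hw
    have hs := (Finset.mem_filter.1 hw).2.std hψ
    have e1 : (Cn F n).submatrix (w ∘ f) (w ∘ f) = Cn F a := hs.Cn_g
    have e2 : (Cn F n).submatrix (w ∘ g) (w ∘ g) = Cn F b := hs.Cn_f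
    rw [e1, e2]
  rw [Finset.sum_congr rfl h1, Finset.sum_const, smul_eq_mul]
  have h2 : (Finset.univ.filter (Sv ψ (Cn F n) h.cpl)).card ≤ 1 := by
    rw [Finset.card_le_one]
    intro w hw w' hw'
    have hs := (Finset.mem_filter.1 hw).2.std hψ
    have hs' := (Finset.mem_filter.1 hw').2.std hψ
    ext x
    rcases h.cpl.2 x with ⟨p, rfl⟩ | ⟨p, rfl⟩
    · have e1 := hs.vals.2 p
      have e2 := hs'.vals.2 p
      exact e1.trans e2.symm
    · have e1 := hs.vals.1 p
      have e2 := hs'.vals.1 p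
      exact e1.trans e2.symm
  calc _ ≤ 1 * (rk ψ (Cn F a) i * rk ψ (Cn F b) j) := Nat.mul_le_mul_right _ h2
    _ = _ := one_mul _

theorem rk_Cn_le {ψ : AddChar F ℂ} (hψ : ψ ≠ 1) (k : Irr (GL (Fin n) F)) : rk ψ (Cn F n) k ≤ 1 := by
  rw [rk, ecx_eq ψ adm_Cn]; exact rank_en hψ k

theorem rk_eq_zero {ψ : AddChar F ℂ} {C : Matrix (Fin n) (Fin n) F} (k : Irr (GL (Fin n) F)) : rk ψ C k = 0 ↔ rep k (ecx ψ C) = 0 := by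
  classical
  rw [rk, Matrix.rank, Submodule.finrank_eq_zero, LinearMap.range_eq_bot]
  constructor
  · intro h
    ext i j
    have := congrFun (LinearMap.congr_fun h (Pi.single j 1)) i
    simpa using this
  · intro h; rw [h]; exact Matrix.mulVecLin_zero

theorem rk_Cn_eq_zero {ψ : AddChar F ℂ} (k : Irr (GL (Fin n) F)) : rk ψ (Cn F n) k = 0 ↔ ¬ Gen ψ k := by
  rw [rk_eq_zero, ecx_eq ψ adm_Cn, Gen, not_not]

theorem gen_of_rel {ψ : AddChar F ℂ} (hψ : ψ ≠ 1) {k : Irr (GL (Fin n) F)} {i : Irr (GL (Fin a) F)} {j : Irr (GL (Fin b) F)}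
    (hk : Gen ψ k) (h : Rel k i j) : Gen ψ i ∧ Gen ψ j := by
  obtain ⟨f, g, hs⟩ := exists_std h.card
  have h1 := rank_le_finrank_SS k (ecx ψ (Cn F n)) (eta f g hs.cpl.1 (ep i) (ep j))
    (h.eta_ne hs.cpl (rep_ep_self_ne_zero i) (rep_ep_self_ne_zero j))
  have h2 := h1.trans (lemmaW_full hψ i j hs)
  have h3 : rk ψ (Cn F n) k ≠ 0 := by rw [Ne, rk_Cn_eq_zero, not_not]; exact hk
  have h4 : rk ψ (Cn F a) i * rk ψ (Cn F b) j ≠ 0 := by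
    intro h0; rw [h0] at h2; exact h3 (Nat.le_zero.1 h2)
  constructor
  · by_contra hi; rw [← rk_Cn_eq_zero] at hi; rw [hi, zero_mul] at h4; exact h4 rfl
  · by_contra hi; rw [← rk_Cn_eq_zero] at hi; rw [hi, mul_zero] at h4; exact h4 rfl

theorem gen_unique {ψ : AddChar F ℂ} (hψ : ψ ≠ 1) {k k' : Irr (GL (Fin n) F)} {i : Irr (GL (Fin a) F)} {j : Irr (GL (Fin b) F)}
    (hk : Gen ψ k) (hk' : Gen ψ k') (h : Rel k i j) (h' : Rel k' i j) : k = k' := by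
  by_contra hne
  obtain ⟨f, g, hs⟩ := exists_std h.card
  have hd : Module.finrank ℂ (SS (ecx ψ (Cn F n)) (eta f g hs.cpl.1 (ep i) (ep j))) ≤ 1 :=
    (lemmaW_full hψ i j hs).trans (Nat.mul_le_mul (rk_Cn_le hψ i) (rk_Cn_le hψ j))
  have hv : ∀ k : Irr (GL (Fin n) F), Gen ψ k → Rel k i j → ∃ v ∈ SS (ecx ψ (Cn F n)) (eta f g hs.cpl.1 (ep i) (ep j)), v ≠ 0 ∧ zz k * v = v := by
    intro k hk h
    have hk1 : rep k (ecx ψ (Cn F n)) ≠ 0 := by rw [ecx_eq ψ adm_Cn]; exact hk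
    obtain ⟨x, hx⟩ := sandwich k hk1 (h.eta_ne hs.cpl (rep_ep_self_ne_zero i) (rep_ep_self_ne_zero j))
    refine ⟨zz k * (ecx ψ (Cn F n) * gg x * eta f g hs.cpl.1 (ep i) (ep j)), mem_SS.2 ⟨zz k * gg x, ?_⟩, (zz_mul_ne_zero_iff k _).2 hx, ?_⟩
    · rw [← mul_assoc, ← zz_comm]; simp only [mul_assoc]
    · rw [← mul_assoc, zz_mul_self]
  obtain ⟨v, hv1, hv2, hv3⟩ := hv k hk h
  obtain ⟨v', hv1', hv2', hv3'⟩ := hv k' hk' h'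
  obtain ⟨u, hu⟩ := finrank_le_one_iff.1 hd
  obtain ⟨c, hc⟩ := hu ⟨v, hv1⟩
  obtain ⟨c', hc'⟩ := hu ⟨v', hv1'⟩
  have hc2 : c • u.1 = v := congrArg Subtype.val hc
  have hc2' : c' • u.1 = v' := congrArg Subtype.val hc'
  have hc0 : c ≠ 0 := by rintro rfl; rw [zero_smul] at hc2; exact hv2 hc2.symm
  have e1 : v' = (c' * c⁻¹) • v := by rw [← hc2, ← hc2', smul_smul, mul_assoc, inv_mul_cancel₀ hc0, mul_one]
  have e2 : zz k' * v = 0 := by rw [← hv3, ← mul_assoc, zz_mul_ne (Ne.symm hne), zero_mul]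
  apply hv2'
  rw [← hv3', e1, mul_smul_comm, e2, smul_zero]

theorem not_atom {k : Irr (GL (Fin n) F)} (hk : ¬ Atom k) : ∃ (a b : ℕ) (i : Irr (GL (Fin a) F)) (j : Irr (GL (Fin b) F)), Rel k i j ∧ a ≠ 0 ∧ b ≠ 0 := by
  unfold Atom at hk
  push Not at hk
  obtain ⟨a, b, i, j, h1, h2, h3⟩ := hk
  exact ⟨a, b, i, j, h1, h2, h3⟩

theorem Atom.rk_zero {ψ : AddChar F ℂ} {k : Irr (GL (Fin n) F)} (hk : Atom k) {C : Matrix (Fin n) (Fin n) F} (hC : Adm C) (hne : C ≠ Cn F n) :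
    rep k (ec ψ C hC) = 0 := by
  obtain ⟨a, b, f, g, ha, hb, hs, h0⟩ := hC.exists_split hne
  rw [ec_split_zero ψ hC hs h0]
  exact eta_eq_zero hk hs.cpl ha hb _ _

theorem rk_le {ψ : AddChar F ℂ} (hψ : ψ ≠ 1) : ∀ (n : ℕ) (k : Irr (GL (Fin n) F)) (C : Matrix (Fin n) (Fin n) F), Adm C →
    rk ψ C k ≤ (n.factorial) ^ (n - 1) := by
  intro n
  induction n using Nat.strong_induction_on with
  | _ n ih =>
    intro k C hC
    by_cases hk : Atom k
    · have h1 : 1 ≤ (n.factorial) ^ (n - 1) := Nat.one_le_pow _ _ (Nat.factorial_pos n)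
      by_cases hCn : C = Cn F n
      · rw [hCn]; exact (rk_Cn_le hψ k).trans h1
      · have := (rk_eq_zero (ψ := ψ) (C := C) k).2 (by rw [ecx_eq ψ hC]; exact hk.rk_zero hC hCn)
        rw [this]; exact Nat.zero_le _
    · obtain ⟨a, b, i, j, hr, ha, hb⟩ := not_atom hk
      have hn := hr.card
      obtain ⟨f, g, hs⟩ := exists_std hn
      have h1 := rank_le_finrank_SS k (ecx ψ C) (eta f g hs.cpl.1 (ep i) (ep j))
        (hr.eta_ne hs.cpl (rep_ep_self_ne_zero i) (rep_ep_self_ne_zero j))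
      refine (h1.trans (lemmaW ψ hC i j hs)).trans ?_
      classical
      have h2 : ∀ w ∈ Finset.univ.filter (Sv ψ C hs.cpl),
          rk ψ (C.submatrix (w ∘ f) (w ∘ f)) i * rk ψ (C.submatrix (w ∘ g) (w ∘ g)) j ≤ n.factorial ^ (a - 1) * n.factorial ^ (b - 1) := by
        intro w hw
        obtain ⟨hw1, hw2, -⟩ := (Finset.mem_filter.1 hw).2
        refine Nat.mul_le_mul ?_ ?_
        · exact (ih a (by omega) i _ (hC.sub hw1)).trans (Nat.pow_le_pow_left (Nat.factorial_le (by omega)) _)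
        · exact (ih b (by omega) j _ (hC.sub hw2)).trans (Nat.pow_le_pow_left (Nat.factorial_le (by omega)) _)
      refine (Finset.sum_le_sum h2).trans ?_
      rw [Finset.sum_const, smul_eq_mul]
      have h3 : (Finset.univ.filter (Sv ψ C hs.cpl)).card ≤ n.factorial := by
        refine (Finset.card_filter_le _ _).trans ?_
        rw [Finset.card_univ, Fintype.card_perm, Fintype.card_fin]
      refine (Nat.mul_le_mul_right _ h3).trans ?_
      rw [← pow_add, ← pow_succ']
      exact le_of_eq (by congr 1; omega)

end LW2
end HRV


namespace HRV

section Exi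
variable {F : Type} [Field F] [Fintype F] {a b c d m n : ℕ}

theorem io_mul_io_val {f : Fin a ↪ Fin n} {g : Fin b ↪ Fin n} (h : Cpl f g) (p : GL (Fin a) F) (q : GL (Fin b) F) :
    (io f p * io g q).val = EE f f p.val + EE g g q.val := by
  rw [Matrix.GeneralLinearGroup.coe_mul, io_val, io_val, EE_sub, EE_sub]
  have e1 := EE_one_add (F := F) h
  have e2 := EE_mul_disj (F := F) f g h.1 (p.val - 1) (q.val - 1)
  rw [EE_sub, EE_sub] at e2
  rw [add_mul, mul_add, mul_add, mul_one, one_mul, mul_one, e2, e1]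
  abel

theorem big_cell {f : Fin a ↪ Fin n} {g : Fin b ↪ Fin n} (h : Cpl f g) (A B) (p : GL (Fin a) F) (q : GL (Fin b) F)
    (e : uu f g h.1 A * (uu g f h.1.symm B * (io f p * io g q)) = 1) : A = 1 ∧ B = 1 ∧ p = 1 ∧ q = 1 := by
  have e1 : uu g f h.1.symm B * (io f p * io g q) = uu f g h.1 A⁻¹ := by
    rw [map_inv]; exact eq_inv_of_mul_eq_one_right e
  have e2 := congrArg Units.val e1
  rw [Matrix.GeneralLinearGroup.coe_mul, io_mul_io_val h, uu_val, uu_val, add_mul, one_mul, mul_add, EE_mul,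
    EE_mul_disj _ _ h.1, add_zero] at e2
  have ff : ∀ i j, p.val i j = (1 : Matrix (Fin a) (Fin a) F) i j := by
    intro i j
    have := congrFun (congrFun e2 (f i)) (f j)
    simp only [Matrix.add_apply, EE_apply_apply] at this
    rw [EE_apply_left g g _ _ _ (fun x hx => h.1 i x hx.symm), EE_apply_left g f _ _ _ (fun x hx => h.1 i x hx.symm),
      EE_apply_right f g _ _ _ (fun x hx => h.1 j x hx.symm)] at this
    simpa [Matrix.one_apply] using this
  have gg' : ∀ i j, q.val i j = (1 : Matrix (Fin b) (Fin b) F) i j := by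
    intro i j
    have := congrFun (congrFun e2 (g i)) (g j)
    simp only [Matrix.add_apply, EE_apply_apply] at this
    rw [EE_apply_left f f _ _ _ (fun x hx => h.1 x i hx), EE_apply_right g f _ _ _ (fun x hx => h.1 x j hx),
      EE_apply_left f g _ _ _ (fun x hx => h.1 x i hx)] at this
    simpa [Matrix.one_apply] using this
  have hp : p = 1 := by ext i j; exact ff i j
  have hq : q = 1 := by ext i j; exact gg' i j
  subst hp; subst hq
  have hA : A = 1 := by
    have : ∀ i j, (A⁻¹).toAdd i j = 0 := by
      intro i j
      have := congrFun (congrFun e2 (f i)) (g j)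
      simp only [Matrix.add_apply, EE_apply_apply] at this
      rw [EE_apply_right f f _ _ _ (fun x hx => h.1 x j hx), EE_apply_left g g _ _ _ (fun x hx => h.1 i x hx.symm),
        EE_apply_left g f _ _ _ (fun x hx => h.1 i x hx.symm), Matrix.one_apply_ne (h.1 i j)] at this
      simpa using this.symm
    have h2 : A⁻¹ = 1 := by
      apply Multiplicative.toAdd.injective; ext i j; exact this i j
    exact inv_eq_one.1 h2
  subst hA
  refine ⟨rfl, ?_, rfl, rfl⟩
  replace e : uu g f h.1.symm B = 1 := by simpa using e
  apply Multiplicative.toAdd.injective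
  show B.toAdd = 0
  ext i j
  have e5 := congrArg Units.val e
  have := congrFun (congrFun e5 (g i)) (f j)
  rw [uu_apply] at this
  rw [this]; exact Matrix.one_apply_ne (h.1 j i).symm

theorem coeff_sum_gg {G ι : Type} [Group G] [Fintype G] [Fintype ι] (e : ι → G) (w : ι → ℂ) (i0 : ι) (h : ∀ i, e i = e i0 → i = i0) :
    (∑ i, w i • gg (e i)).coeff (e i0) = w i0 := by
  classical
  have : (∑ i, w i • gg (e i)).coeff (e i0) = ∑ i, (w i • gg (e i)).coeff (e i0) := by
    rw [MonoidAlgebra.coeff_sum, Finsupp.finset_sum_apply]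
  rw [this, Finset.sum_eq_single i0]
  · simp [gg]
  · intro i _ hi
    have : e i ≠ e i0 := fun h' => hi (h i h')
    simp [gg, Finsupp.single_apply, this]
  · simp

theorem cell_ne_zero {f : Fin a ↪ Fin n} {g : Fin b ↪ Fin n} (h : Cpl f g) (c) {x : CG (GL (Fin a) F)} {y : CG (GL (Fin b) F)}
    (hx : x ≠ 0) (hy : y ≠ 0) :
    avg (uu f g h.1) c * (eu g f h.1.symm * (mp (io f) x * mp (io g) y)) ≠ 0 := by
  classical
  obtain ⟨p, hp⟩ : ∃ p, x.coeff p ≠ 0 := by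
    by_contra h0; push Not at h0; apply hx; rw [CG_span x]; simp [h0]
  obtain ⟨q, hq⟩ : ∃ p, y.coeff p ≠ 0 := by
    by_contra h0; push Not at h0; apply hy; rw [CG_span y]; simp [h0]
  let ι := Multiplicative (Matrix (Fin a) (Fin b) F) × Multiplicative (Matrix (Fin b) (Fin a) F) × GL (Fin a) F × GL (Fin b) F
  let e : ι → GL (Fin n) F := fun t => uu f g h.1 t.1 * (uu g f h.1.symm t.2.1 * (io f t.2.2.1 * io g t.2.2.2))
  let cA : ℂ := (Fintype.card (Multiplicative (Matrix (Fin a) (Fin b) F)) : ℂ)⁻¹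
  let cB : ℂ := (Fintype.card (Multiplicative (Matrix (Fin b) (Fin a) F)) : ℂ)⁻¹
  let w : ι → ℂ := fun t => (cA * c t.1⁻¹) * (cB * (x.coeff t.2.2.1 * y.coeff t.2.2.2))
  have key : avg (uu f g h.1) c * (eu g f h.1.symm * (mp (io f) x * mp (io g) y)) = ∑ t, w t • gg (e t) := by
    conv_lhs => rw [CG_span x, CG_span y]
    simp only [avg, eu, map_sum, map_smul, mp_gg, MonoidHom.one_apply, one_smul]
    have rhs : ∑ t, w t • gg (e t) = ∑ A, ∑ B, ∑ p, ∑ q, w (A, B, p, q) • gg (e (A, B, p, q)) := by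
      show (∑ t : Multiplicative (Matrix (Fin a) (Fin b) F) × Multiplicative (Matrix (Fin b) (Fin a) F) × GL (Fin a) F × GL (Fin b) F, w t • gg (e t)) = _
      simp only [Fintype.sum_prod_type]
    rw [rhs, Finset.smul_sum, Finset.smul_sum, Finset.sum_mul]
    refine Finset.sum_congr rfl fun A _ => ?_
    rw [Finset.sum_mul, Finset.mul_sum]
    refine Finset.sum_congr rfl fun B _ => ?_
    rw [Finset.sum_mul, Finset.mul_sum, Finset.mul_sum]
    refine Finset.sum_congr rfl fun p _ => ?_
    rw [Finset.mul_sum, Finset.mul_sum, Finset.mul_sum]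
    refine Finset.sum_congr rfl fun q _ => ?_
    simp only [smul_mul_smul_comm, smul_smul, e, w, cA, cB, ← gg_mul]
  rw [key]
  intro h0
  have h1 := coeff_sum_gg e w (1, 1, p, q) (by
    rintro ⟨A, B, p', q'⟩ ht
    simp only [e, map_one, one_mul] at ht
    have h2 : uu f g h.1 A * (uu g f h.1.symm B * (io f (p' * p⁻¹) * io g (q' * q⁻¹))) = 1 := by
      have : io f (p' * p⁻¹) * io g (q' * q⁻¹) = (io f p' * io g q') * (io f p * io g q)⁻¹ := by
        rw [map_mul, map_mul, mul_inv_rev, map_inv, map_inv, ← map_inv (io g), ← map_inv (io f)]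
        rw [mul_assoc, mul_assoc, ← map_mul (io g), io_comm h.1 p⁻¹, map_mul, mul_assoc]
      rw [this, ← mul_assoc, ← mul_assoc, mul_assoc (uu f g _ _), ht, mul_inv_cancel]
    obtain ⟨rfl, rfl, h3, h4⟩ := big_cell h _ _ _ _ h2
    rw [mul_inv_eq_one.1 h3, mul_inv_eq_one.1 h4])
  rw [h0] at h1
  have h2 : w (1, 1, p, q) ≠ 0 := by
    simp [w, cA, cB, hp, hq]
  exact h2 (by rw [← h1]; rfl)

theorem exists_gen {ψ : AddChar F ℂ} (hψ : ψ ≠ 1) {i : Irr (GL (Fin a) F)} {j : Irr (GL (Fin b) F)} (hi : Gen ψ i) (hj : Gen ψ j)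
    (hab : a + b = n) : ∃ k : Irr (GL (Fin n) F), Gen ψ k ∧ Rel k i j := by
  obtain ⟨g, f, hs⟩ := exists_std (show b + a = n by omega)
  have hx : en ψ b * zz j ≠ 0 := by
    intro h0; apply hj; have := congrArg (rep j) h0
    rwa [map_mul, rep_zz_self, mul_one, map_zero] at this
  have hy : en ψ a * zz i ≠ 0 := by
    intro h0; apply hi; have := congrArg (rep i) h0
    rwa [map_mul, rep_zz_self, mul_one, map_zero] at this
  have h1 := cell_ne_zero hs.cpl (uc ψ ((Cn F n).submatrix g f)) hx hy
  have h2 : en ψ n * eta f g hs.cpl.1.symm (zz i) (zz j) ≠ 0 := by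
    have : en ψ n * eta f g hs.cpl.1.symm (zz i) (zz j) = avg (uu g f hs.cpl.1) (uc ψ ((Cn F n).submatrix g f)) * (eu f g hs.cpl.1.symm * (mp (io g) (en ψ b * zz j) * mp (io f) (en ψ a * zz i))) := by
      have e3 : ecx ψ ((Cn F n).submatrix g g) = en ψ b := by rw [hs.Cn_f, ecx_eq ψ adm_Cn]
      have e4 : ecx ψ ((Cn F n).submatrix f f) = en ψ a := by rw [hs.Cn_g, ecx_eq ψ adm_Cn]
      rw [ecx_eq ψ (adm_Cn.sub hs.mf)] at e3
      rw [ecx_eq ψ (adm_Cn.sub hs.mg)] at e4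
      show ec ψ (Cn F n) adm_Cn * _ = _
      rw [ec_split ψ adm_Cn hs, e3, e4, eta, map_mul, map_mul]
      have c1 := mp_eu_left f g hs.cpl.1.symm (en ψ a)
      have c2 := mp_eu_right f g hs.cpl.1.symm (en ψ b)
      have c3 := mp_io_comm hs.cpl.1 (en ψ b) (en ψ a)
      have c4 := mp_io_comm hs.cpl.1 (zz j) (en ψ a * zz i)
      rw [map_mul] at c4
      calc _ = avg (uu g f hs.cpl.1) (uc ψ ((Cn F n).submatrix g f)) * (mp (io g) (en ψ b) * (mp (io f) (en ψ a) * eu f g hs.cpl.1.symm) * mp (io f) (zz i) * mp (io g) (zz j)) := by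
            simp only [mul_assoc]
        _ = avg (uu g f hs.cpl.1) (uc ψ ((Cn F n).submatrix g f)) * (eu f g hs.cpl.1.symm * mp (io g) (en ψ b) * (mp (io f) (en ψ a) * mp (io f) (zz i) * mp (io g) (zz j))) := by
            rw [c1, ← mul_assoc (mp (io g) (en ψ b)), c2]; simp only [mul_assoc]
        _ = _ := by rw [← c4]; simp only [mul_assoc]
    rw [this]; exact h1
  obtain ⟨k, hk⟩ := exists_rep_ne_zero h2
  rw [map_mul] at hk
  refine ⟨k, left_ne_zero_of_mul hk, ?_⟩
  obtain ⟨i', j', hr, h5, h6⟩ := exists_rel_of_eu hs.cpl.symm (zz i) (zz j) (right_ne_zero_of_mul hk)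
  rw [irr_eq_of_rep_zz h5, irr_eq_of_rep_zz h6] at hr
  exact hr

end Exi
end HRV


namespace HRV

section MB
variable {F : Type} [Field F] [Fintype F] {a b c d m n : ℕ}

theorem uc_trace (ψ : AddChar F ℂ) (B : Matrix (Fin a) (Fin b) F) (X) :
    uc ψ B X = ψ (Matrix.trace (B.transpose * X.toAdd)) := by
  show ψ (∑ i, ∑ j, B i j * X.toAdd i j) = _
  congr 1
  simp only [Matrix.trace, Matrix.diag, Matrix.mul_apply, Matrix.transpose_apply]
  rw [Finset.sum_comm]

theorem ub_conj (ψ : AddChar F ℂ) {f : Fin a ↪ Fin n} {g : Fin b ↪ Fin n} (h : Disj f g) {B B' : Matrix (Fin a) (Fin b) F}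
    (y : GL (Fin a) F) (hB : y.val.transpose * B' = B) :
    gg (io f y) * avg (uu f g h) (uc ψ B) = avg (uu f g h) (uc ψ B') * gg (io f y) := by
  let e : Multiplicative (Matrix (Fin a) (Fin b) F) ≃ Multiplicative (Matrix (Fin a) (Fin b) F) :=
    ⟨fun X => Multiplicative.ofAdd (y.val * X.toAdd), fun X => Multiplicative.ofAdd ((y⁻¹).val * X.toAdd),
      by intro X; simp [← mul_assoc], by intro X; simp [← mul_assoc]⟩
  refine avg_conj _ _ _ _ _ e ?_ ?_
  · intro X; exact io_uu_left f g h y X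
  · intro X
    rw [uc_trace, uc_trace]
    congr 1
    show Matrix.trace (B'.transpose * (-(y.val * X.toAdd))) = Matrix.trace (B.transpose * (- X.toAdd))
    rw [← hB, Matrix.transpose_mul, Matrix.transpose_transpose, Matrix.mul_neg, Matrix.mul_neg, Matrix.mul_assoc]

theorem sum_ub {ψ : AddChar F ℂ} (hψ : ψ ≠ 1) {f : Fin a ↪ Fin n} {g : Fin b ↪ Fin n} (h : Disj f g) :
    ∑ B : Matrix (Fin a) (Fin b) F, avg (uu f g h) (uc ψ B) = 1 := by
  classical
  simp only [avg]
  rw [← Finset.smul_sum, Finset.sum_comm]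
  have key : ∀ X : Multiplicative (Matrix (Fin a) (Fin b) F), ∑ B : Matrix (Fin a) (Fin b) F, uc ψ B X⁻¹ =
      if X = 1 then (Fintype.card (Matrix (Fin a) (Fin b) F) : ℂ) else 0 := by
    intro X
    let χ : AddChar (Matrix (Fin a) (Fin b) F) ℂ :=
      { toFun := fun B => ψ (Matrix.trace (B.transpose * (X⁻¹).toAdd))
        map_zero_eq_one' := by simp
        map_add_eq_mul' := by
          intro B B'
          rw [Matrix.transpose_add, Matrix.add_mul, Matrix.trace_add, AddChar.map_add_eq_mul] }
    have hχ : ∑ B : Matrix (Fin a) (Fin b) F, uc ψ B X⁻¹ = ∑ B, χ B :=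
      Finset.sum_congr rfl fun B _ => uc_trace ψ B _
    rw [hχ]
    split_ifs with hX
    · subst hX
      have : ∀ B, χ B = 1 := by
        intro B
        show ψ (Matrix.trace (B.transpose * ((1 : Multiplicative (Matrix (Fin a) (Fin b) F))⁻¹).toAdd)) = 1
        rw [inv_one, toAdd_one, Matrix.mul_zero, Matrix.trace_zero, AddChar.map_zero_eq_one]
      simp only [this]; simp
    · rw [AddChar.sum_eq_zero_iff_ne_zero]
      intro h0
      obtain ⟨i, j, hij⟩ : ∃ i j, (X⁻¹).toAdd i j ≠ 0 := by
        by_contra hc; push Not at hc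
        apply hX
        rw [← inv_eq_one]
        apply Multiplicative.toAdd.injective
        show (X⁻¹).toAdd = 0
        ext i j; exact hc i j
      obtain ⟨t, ht⟩ := psi_ne hψ
      apply ht
      have h1 : χ (Matrix.single i j (t / (X⁻¹).toAdd i j)) = 1 := by rw [h0]; rfl
      have h2 : χ (Matrix.single i j (t / (X⁻¹).toAdd i j)) = ψ t := by
        show ψ _ = ψ t
        congr 1
        rw [Matrix.transpose_single, Matrix.trace_single_mul]
        rw [smul_eq_mul, div_mul_cancel₀ _ hij]
      rw [← h2, h1]
  have : ∀ X : Multiplicative (Matrix (Fin a) (Fin b) F), ∑ B : Matrix (Fin a) (Fin b) F, uc ψ B X⁻¹ • gg (uu f g h X) =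
    if X = 1 then (Fintype.card (Matrix (Fin a) (Fin b) F) : ℂ) • (1 : CG (GL (Fin n) F)) else 0 := by
    intro X
    rw [← Finset.sum_smul, key]
    split_ifs with hX
    · rw [hX, map_one, gg_one]
    · rw [zero_smul]
  simp only [this]
  rw [Finset.sum_ite_eq' Finset.univ (1 : Multiplicative (Matrix (Fin a) (Fin b) F)), if_pos (Finset.mem_univ _), smul_smul]
  have e1 : Fintype.card (Multiplicative (Matrix (Fin a) (Fin b) F)) = Fintype.card (Matrix (Fin a) (Fin b) F) := Fintype.card_multiplicative _
  rw [e1, inv_mul_cancel₀, one_smul]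
  exact Nat.cast_ne_zero.2 Fintype.card_ne_zero

/-- last row is the one of the identity -/
def Lr (y : GL (Fin m) F) : Prop := ∀ i j, i.val + 1 = m → y.val i j = (1 : Matrix (Fin m) (Fin m) F) i j

theorem B0_apply {f : Fin m ↪ Fin (m+1)} {g : Fin 1 ↪ Fin (m+1)} (h : Std f g) (i j) :
    (Cn F (m+1)).submatrix f g i j = if i.val + 1 = m then 1 else 0 := by
  simp only [Matrix.submatrix_apply, Cn, h.vals.1, h.vals.2]
  have : j.val = 0 := by omega
  rw [this, add_zero]
  by_cases h' : m = i.val + 1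
  · rw [if_pos h', if_pos h'.symm]
  · rw [if_neg h', if_neg (Ne.symm h')]

theorem mul_B0 {f : Fin m ↪ Fin (m+1)} {g : Fin 1 ↪ Fin (m+1)} (h : Std f g) (M : Matrix (Fin m) (Fin m) F) (l : Fin m)
    (hl : l.val + 1 = m) (i j) : (M.transpose * (Cn F (m+1)).submatrix f g) i j = M l i := by
  rw [Matrix.mul_apply, Finset.sum_eq_single l]
  · rw [B0_apply h, if_pos hl, mul_one]; rfl
  · intro p _ hp
    rw [B0_apply h, if_neg, mul_zero]
    intro h'; apply hp; ext; omega
  · simp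

theorem Lr.B0 {f : Fin m ↪ Fin (m+1)} {g : Fin 1 ↪ Fin (m+1)} (h : Std f g) {y : GL (Fin m) F} (hy : Lr y) :
    y.val.transpose * (Cn F (m+1)).submatrix f g = (Cn F (m+1)).submatrix f g := by
  ext i j
  have hm : 0 < m := by have := i.2; omega
  rw [mul_B0 h y.val ⟨m-1, by omega⟩ (by simp; omega), hy _ _ (by simp; omega), B0_apply h, Matrix.one_apply]
  congr 1
  rw [eq_iff_iff, Fin.ext_iff]; simp only; omega

theorem exists_row {f : Fin m ↪ Fin (m+1)} {g : Fin 1 ↪ Fin (m+1)} (h : Std f g) {B : Matrix (Fin m) (Fin 1) F} (hB : B ≠ 0) :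
    ∃ y : GL (Fin m) F, y.val.transpose * (Cn F (m+1)).submatrix f g = B := by
  classical
  obtain ⟨i, hi⟩ : ∃ i, B i 0 ≠ 0 := by
    by_contra hc; push Not at hc
    apply hB; ext i j
    rw [Subsingleton.elim j 0, hc]; rfl
  have hm : 0 < m := by have := i.2; omega
  let l : Fin m := ⟨m-1, by omega⟩
  let M : Matrix (Fin m) (Fin m) F := ((1 : Matrix (Fin m) (Fin m) F).updateCol i (fun p => B p 0)).transpose
  have hM : M.det = B i 0 := by
    rw [Matrix.det_transpose, ← Matrix.cramer_apply, Matrix.cramer_one]; rfl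
  let y := M.submatrix (Equiv.swap i l) id
  have hy : y.det ≠ 0 := by
    rw [Matrix.det_permute, hM]
    rcases Int.units_eq_one_or (Equiv.Perm.sign (Equiv.swap i l)) with h' | h' <;> rw [h'] <;> simpa using hi
  refine ⟨Matrix.GeneralLinearGroup.mkOfDetNeZero y hy, ?_⟩
  ext p j
  rw [mul_B0 h _ l (by simp [l]; omega)]
  show M (Equiv.swap i l l) p = _
  rw [Equiv.swap_apply_right, Subsingleton.elim j 0]
  simp only [M, Matrix.transpose_apply, Matrix.updateCol_self]

theorem avg_commute {G H : Type} [Group G] [Fintype G] [Group H] [Fintype H] (j : H →* G) (c : H →* ℂ) (Y : CG G)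
    (h : ∀ x, gg (j x) * Y = Y * gg (j x)) : avg j c * Y = Y * avg j c := by
  simp only [avg]
  rw [smul_mul_assoc, mul_smul_comm, Finset.sum_mul, Finset.mul_sum]
  congr 1
  refine Finset.sum_congr rfl fun x _ => ?_
  rw [smul_mul_assoc, mul_smul_comm, h]

theorem en_one (ψ : AddChar F ℂ) : en ψ 1 = 1 := by
  have : ∀ x : NN F 1, x = 1 := by
    rintro ⟨x, hx⟩
    apply Subtype.ext
    ext i j
    exact hx i j (by rw [Subsingleton.elim i j])
  have hu : (Finset.univ : Finset (NN F 1)) = {1} := by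
    ext x; simp [this x]
  have hc : Fintype.card (NN F 1) = 1 := by
    rw [← Finset.card_univ, hu]; rfl
  show avg _ _ = _
  rw [avg, hu, hc, Finset.sum_singleton]
  simp only [inv_one, map_one, one_smul, gg_one, Nat.cast_one]

/-- hypotheses on a linear form on the group algebra of `GL n` -/
structure TF (τ : CG (GL (Fin m) F) →ₗ[ℂ] ℂ) : Prop where
  inv : ∀ y : GL (Fin m) F, Lr y → ∀ x, τ (gg y * x) = τ (x * gg y)
  van : ∀ a b (f : Fin a ↪ Fin m) (g : Fin b ↪ Fin m) (h : Std f g), a ≠ 0 → b ≠ 0 → ∀ x, τ (x * eu f g h.cpl.1) = 0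

theorem Lr_io {f : Fin m ↪ Fin (m+1)} {g : Fin 1 ↪ Fin (m+1)} (h : Std f g) (y : GL (Fin m) F) : Lr (io f y) := by
  intro i j hi
  apply io_apply_left
  intro x hx
  have := h.vals.1 x
  rw [hx] at this
  have := x.2; omega

theorem step_van (ψ : AddChar F ℂ) {f : Fin m ↪ Fin (m+1)} {g : Fin 1 ↪ Fin (m+1)} (h : Std f g) {τ : CG (GL (Fin (m+1)) F) →ₗ[ℂ] ℂ}
    (hτ : TF τ) {f' : Fin a ↪ Fin m} {g' : Fin b ↪ Fin m} (h' : Std f' g') (ha : a ≠ 0) (hb : b ≠ 0) (x) :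
    τ (x * mp (io f) (eu f' g' h'.cpl.1) * avg (uu f g h.cpl.1) (uc ψ ((Cn F (m+1)).submatrix f g))) = 0 := by
  set E := avg (uu f g h.cpl.1) (uc ψ ((Cn F (m+1)).submatrix f g)) with hE
  have hab : a + b = m := by
    have := h'.cpl.card; omega
  obtain ⟨f'', G, hs⟩ := exists_std (show a + (b + 1) = m + 1 by omega)
  have e1 : f'' = cmp f f' := by
    ext p
    show (f'' p).val = (f (f' p)).val
    rw [hs.vals.1, h.vals.1, h'.vals.1]
  obtain ⟨p, r, hpr⟩ := exists_std (show b + 1 = b + 1 from rfl)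
  have e2 : cmp G p = cmp f g' := by
    ext t
    show (G (p t)).val = (f (g' t)).val
    rw [hs.vals.2, hpr.vals.1, h.vals.1, h'.vals.2]
  have e3 : cmp G r = g := by
    ext t
    show (G (r t)).val = (g t).val
    rw [hs.vals.2, hpr.vals.2, h.vals.2]; omega
  subst e1
  have hLr : ∀ Y, Lr (uu f' g' h'.cpl.1 Y : GL (Fin m) F) := by
    intro Y i j hi
    apply uu_apply_left
    intro t ht
    have := h'.vals.1 t
    rw [ht] at this
    have := t.2; omega
  have key : mp (io f) (eu f' g' h'.cpl.1) * E * eu (cmp f f') G hs.cpl.1 = mp (io f) (eu f' g' h'.cpl.1) * E := by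
    apply avg_absorb_right
    intro X
    rw [MonoidHom.one_apply, one_smul]
    obtain ⟨Y, Z, hYZ⟩ := uu_split_right hs.cpl.1 hpr.cpl X
    rw [hYZ, gg_mul]
    have c1 : gg (uu (cmp f f') (cmp G p) (hs.cpl.1.rr p) Y) = gg (io f (uu f' g' h'.cpl.1 Y)) := by
      rw [io_uu]
      congr 2
      simp only [e2]
    have c2 : E * gg (uu (cmp f f') (cmp G r) (hs.cpl.1.rr r) Z) = E := by
      have : uu (cmp f f') (cmp G r) (hs.cpl.1.rr r) Z = uu f g h.cpl.1 (Multiplicative.ofAdd (EE f' (Function.Embedding.refl _) Z.toAdd)) := by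
        apply Units.ext
        rw [uu_val, uu_val, toAdd_ofAdd, EE_EE, e3]
        rfl
      rw [this, hE, avg_right]
      have h1 : uc ψ ((Cn F (m+1)).submatrix f g) (Multiplicative.ofAdd (EE f' (Function.Embedding.refl _) Z.toAdd)) = 1 := by
        show ψ (∑ i, ∑ j, _ * (EE f' (Function.Embedding.refl _) Z.toAdd) i j) = 1
        rw [Finset.sum_eq_zero, AddChar.map_zero_eq_one]
        intro i _
        apply Finset.sum_eq_zero
        intro j _
        by_cases hi : ∃ t, f' t = i
        · obtain ⟨t, rfl⟩ := hi
          rw [B0_apply h, if_neg, zero_mul]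
          rw [h'.vals.1]; have := t.2; omega
        · push Not at hi
          rw [EE_apply_left _ _ _ _ _ hi, mul_zero]
      rw [h1, one_smul]
    rw [c1, mul_assoc, ← mul_assoc E, ← ub_conj ψ h.cpl.1 _ (Lr.B0 h (hLr Y)), mul_assoc (gg _), c2, ← mul_assoc, ← mp_gg, ← map_mul,
      eu_right]
  rw [mul_assoc, ← key, ← mul_assoc]
  exact hτ.van _ _ _ _ hs ha (by omega) _

theorem NN_Lr {y : GL (Fin m) F} (hy : y ∈ NN F m) : Lr y := by
  intro i j hi
  exact hy i j (by rw [Fin.le_def]; have := j.2; omega)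

set_option maxHeartbeats 1000000 in
theorem MB {ψ : AddChar F ℂ} (hψ : ψ ≠ 1) : ∀ (m : ℕ) (τ : CG (GL (Fin (m+1)) F) →ₗ[ℂ] ℂ), TF τ →
    τ 1 = (∏ i ∈ Finset.range m, ((Fintype.card F : ℂ)^(i+1) - 1)) * τ (en ψ (m+1)) := by
  classical
  intro m
  induction m with
  | zero => intro τ _; rw [en_one]; simp
  | succ m ih =>
    intro τ hτ
    obtain ⟨f, g, h⟩ := exists_std (show (m+1) + 1 = m + 1 + 1 from rfl)
    set E : Matrix (Fin (m+1)) (Fin 1) F → CG (GL (Fin (m+1+1)) F) := fun B => avg (uu f g h.cpl.1) (uc ψ B) with hE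
    set B0 := (Cn F (m+1+1)).submatrix f g with hB0
    have h1 : ∑ B, τ (E B) = τ 1 := by rw [← map_sum, sum_ub hψ h.cpl.1]
    have h2 : τ (E 0) = 0 := by
      have := hτ.van _ _ f g h (by omega) (by omega) 1
      rw [one_mul] at this
      simp only [hE, uc_zero]; exact this
    have h3 : ∀ B, B ≠ 0 → τ (E B) = τ (E B0) := by
      intro B hB
      obtain ⟨y, hy⟩ := exists_row h hB
      have c1 := ub_conj ψ h.cpl.1 y hy
      have c2 := hτ.inv (io f y) (Lr_io h y) (E B * gg (io f y)⁻¹)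
      rw [mul_assoc, gg_inv_mul, mul_one, ← mul_assoc] at c2
      rw [← c2]
      simp only [hE]
      rw [c1, mul_assoc, gg_mul_inv, mul_one]
    have h4 : τ 1 = ((Fintype.card F : ℂ)^(m+1) - 1) * τ (E B0) := by
      rw [← h1, ← Finset.add_sum_erase _ _ (Finset.mem_univ 0), h2, zero_add,
        Finset.sum_congr rfl (fun B hB => h3 B (Finset.ne_of_mem_erase hB)), Finset.sum_const,
        Finset.card_erase_of_mem (Finset.mem_univ _), Finset.card_univ, nsmul_eq_mul]
      congr 1
      rw [Nat.cast_sub Fintype.card_pos]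
      have : Fintype.card (Matrix (Fin (m+1)) (Fin 1) F) = Fintype.card F ^ (m+1) := by
        rw [show Fintype.card (Matrix (Fin (m+1)) (Fin 1) F) = Fintype.card (Fin (m+1) → Fin 1 → F) from rfl]
        simp
      rw [this]; push_cast; ring
    let τ' : CG (GL (Fin (m+1)) F) →ₗ[ℂ] ℂ := τ ∘ₗ (LinearMap.mulRight ℂ (E B0)) ∘ₗ (mp (io f)).toLinearMap
    have hτ' : ∀ x, τ' x = τ (mp (io f) x * E B0) := fun x => rfl
    have hT : TF τ' := by
      constructor
      · intro y hy x
        rw [hτ', hτ', map_mul (mp (io f)), map_mul (mp (io f)), mp_gg, mul_assoc, hτ.inv _ (Lr_io h y), mul_assoc, mul_assoc]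
        have c3 : gg (io f y) * E B0 = E B0 * gg (io f y) := ub_conj ψ h.cpl.1 y (Lr.B0 h hy)
        rw [c3]
      · intro a b f' g' h' ha hb x
        rw [hτ', map_mul (mp (io f))]
        exact step_van ψ h hτ h' ha hb _
    have h5 := ih τ' hT
    rw [hτ', map_one, one_mul] at h5
    rw [h4, h5, hτ', Finset.prod_range_succ]
    have h6 : mp (io f) (en ψ (m+1)) * E B0 = en ψ (m+1+1) := by
      have e3 : ecx ψ ((Cn F (m+1+1)).submatrix f f) = en ψ (m+1) := by rw [h.Cn_f, ecx_eq ψ adm_Cn]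
      have e4 : ecx ψ ((Cn F (m+1+1)).submatrix g g) = en ψ 1 := by rw [h.Cn_g, ecx_eq ψ adm_Cn]
      rw [ecx_eq ψ (adm_Cn.sub h.mf)] at e3
      rw [ecx_eq ψ (adm_Cn.sub h.mg)] at e4
      show _ = ec ψ (Cn F (m+1+1)) adm_Cn
      rw [ec_split ψ adm_Cn h, e3, e4, en_one, map_one, mul_one]
      show mp (io f) (avg _ _) * _ = _ * mp (io f) (avg _ _)
      rw [mp_avg]
      apply avg_commute
      intro y
      exact ub_conj ψ h.cpl.1 y.1 (Lr.B0 h (NN_Lr y.2))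
    rw [h6]; ring

theorem trace_idem_rank {ι : Type} [Fintype ι] [DecidableEq ι] (M : Matrix ι ι ℂ) (h : M * M = M) : M.trace = M.rank := by
  have h1 : IsIdempotentElem (Matrix.toLin' M) := by
    show Matrix.toLin' M * Matrix.toLin' M = _
    rw [Module.End.mul_eq_comp, ← Matrix.toLin'_mul, h]
  have h2 := (LinearMap.IsIdempotentElem.isProj_range _ h1).trace
  rw [Matrix.trace_toLin'_eq] at h2
  rw [h2, Matrix.rank]; rfl

theorem atom_dim {ψ : AddChar F ℂ} (hψ : ψ ≠ 1) {k : Irr (GL (Fin (m+1)) F)} (hk : Atom k) :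
    Gen ψ k ∧ (dm _ k : ℂ) = ∏ i ∈ Finset.range m, ((Fintype.card F : ℂ)^(i+1) - 1) := by
  let τ : CG (GL (Fin (m+1)) F) →ₗ[ℂ] ℂ := (Matrix.traceLinearMap _ ℂ ℂ) ∘ₗ (rep k).toLinearMap
  have hτ : ∀ x, τ x = chi k x := fun x => rfl
  have hT : TF τ := by
    constructor
    · intro y _ x
      rw [hτ, hτ, chi_comm]
    · intro a b f g h ha hb x
      rw [hτ, chi, map_mul, hk.eu_zero h.cpl ha hb, mul_zero, Matrix.trace_zero]
  have h1 := MB hψ m τ hT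
  rw [hτ, hτ] at h1
  have h2 : chi k (1 : CG (GL (Fin (m+1)) F)) = dm _ k := by
    rw [chi, map_one, Matrix.trace_one]; simp
  have h3 : chi k (en ψ (m+1)) = (rep k (en ψ (m+1))).rank := by
    rw [chi, trace_idem_rank]
    rw [← map_mul, ec_idem]
  have h4 := rank_en hψ k
  rw [h2, h3] at h1
  have h5 : (rep k (en ψ (m+1))).rank ≠ 0 := by
    intro h0
    rw [h0, Nat.cast_zero, mul_zero] at h1
    exact NeZero.ne (dm _ k) (Nat.cast_eq_zero.1 h1)
  have h6 : (rep k (en ψ (m+1))).rank = 1 := by omega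
  rw [h6, Nat.cast_one, mul_one] at h1
  refine ⟨?_, h1⟩
  intro h0
  rw [h0, Matrix.rank_zero] at h5
  exact h5 rfl

end MB
end HRV


namespace HRV

section Integ
variable {F : Type} [Field F] [Fintype F] {a b c d m n : ℕ}

/-- scalar matrices -/
def sc (F : Type) [Field F] (m : ℕ) : Fˣ →* GL (Fin m) F := Units.map (Matrix.scalar (Fin m) : F →+* Matrix (Fin m) (Fin m) F).toMonoidHom

theorem sc_val (u : Fˣ) : (sc F m u).val = (u : F) • (1 : Matrix (Fin m) (Fin m) F) := by
  show Matrix.scalar (Fin m) (u : F) = _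
  rw [Matrix.smul_one_eq_diagonal]; rfl

theorem sc_comm (u : Fˣ) (x : GL (Fin m) F) : sc F m u * x = x * sc F m u := by
  apply Units.ext
  rw [Matrix.GeneralLinearGroup.coe_mul, Matrix.GeneralLinearGroup.coe_mul, sc_val]; simp

theorem gg_central {G : Type} [Group G] [Fintype G] {z : G} (hz : ∀ x, z * x = x * z) (x : CG G) : gg z * x = x * gg z := by
  induction x using CG_induction with
  | h1 g => rw [← gg_mul, hz, gg_mul]
  | h2 x y hx hy => rw [mul_add, add_mul, hx, hy]
  | h3 c x hx => rw [mul_smul_comm, smul_mul_assoc, hx]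

/-- pairs of scalars -/
noncomputable def dsc {f : Fin a ↪ Fin n} {g : Fin b ↪ Fin n} (h : Disj f g) : Fˣ × Fˣ →* GL (Fin n) F where
  toFun p := io f (sc F a p.1) * io g (sc F b p.2)
  map_one' := by simp
  map_mul' := by
    intro p q
    rw [Prod.fst_mul, Prod.snd_mul, map_mul, map_mul, map_mul, map_mul, mul_assoc, mul_assoc]
    congr 1
    rw [← mul_assoc, ← mul_assoc, io_comm h]

theorem dsc_apply {f : Fin a ↪ Fin n} {g : Fin b ↪ Fin n} (h : Disj f g) (p : Fˣ × Fˣ) :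
    dsc h p = io f (sc F a p.1) * io g (sc F b p.2) := rfl

theorem dsc_inj {f : Fin a ↪ Fin n} {g : Fin b ↪ Fin n} (h : Cpl f g) (ha : a ≠ 0) (hb : b ≠ 0) :
    Function.Injective (dsc h.1 : Fˣ × Fˣ →* GL (Fin n) F) := by
  rintro ⟨s, t⟩ ⟨s', t'⟩ he
  have e1 := congrArg Units.val he
  rw [dsc_apply, dsc_apply, io_mul_io_val h, io_mul_io_val h] at e1
  let i : Fin a := ⟨0, by omega⟩
  let j : Fin b := ⟨0, by omega⟩
  have e2 := congrFun (congrFun e1 (f i)) (f i)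
  have e3 := congrFun (congrFun e1 (g j)) (g j)
  simp only [Matrix.add_apply, EE_apply_apply] at e2 e3
  rw [EE_apply_left g g _ _ _ (fun x hx => h.1 i x hx.symm), EE_apply_left g g _ _ _ (fun x hx => h.1 i x hx.symm), sc_val, sc_val] at e2
  rw [EE_apply_left f f _ _ _ (fun x hx => h.1 x j hx), EE_apply_left f f _ _ _ (fun x hx => h.1 x j hx), sc_val, sc_val] at e3
  simp at e2 e3
  rw [Prod.mk.injEq]
  exact ⟨Units.ext e2, Units.ext e3⟩

theorem eta_central {f : Fin a ↪ Fin n} {g : Fin b ↪ Fin n} (h : Disj f g) {z : GL (Fin a) F} {z' : GL (Fin b) F}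
    (hz : ∀ x, z * x = x * z) (hz' : ∀ x, z' * x = x * z') (x y) :
    gg (io f z * io g z') * eta f g h x y = eta f g h x y * gg (io f z * io g z') := by
  have c1 : Commute (gg (io f z)) (eta f g h x y) := by
    apply Commute.mul_right
    · apply Commute.mul_right
      · exact io_eu_left f g h z
      · have := congrArg (mp (io f)) (gg_central hz x)
        rw [map_mul, map_mul, mp_gg] at this
        exact this
    · have := mp_io_comm h (gg z) y
      rw [mp_gg] at this
      exact this
  have c2 : Commute (gg (io g z')) (eta f g h x y) := by
    apply Commute.mul_right
    · apply Commute.mul_right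
      · exact io_eu_right f g h z'
      · have := mp_io_comm h x (gg z')
        rw [mp_gg] at this
        exact this.symm
    · have := congrArg (mp (io g)) (gg_central hz' y)
      rw [map_mul, map_mul, mp_gg] at this
      exact this
  rw [gg_mul]
  exact (c1.mul_left c2)

theorem exists_block {f : Fin a ↪ Fin n} {g : Fin b ↪ Fin n} (h : Std f g) {C1 : Matrix (Fin a) (Fin a) F} {C2 : Matrix (Fin b) (Fin b) F}
    (h1 : Adm C1) (h2 : Adm C2) : ∃ C : Matrix (Fin n) (Fin n) F, Adm C ∧ C.submatrix f f = C1 ∧ C.submatrix g g = C2 ∧ C.submatrix f g = 0 := by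
  have hd := h.cpl.1
  have v1 := h.vals.1
  have v2 := h.vals.2
  obtain ⟨C, hCe⟩ : ∃ C, C = EE f f C1 + EE g g C2 := ⟨_, rfl⟩
  have ff : ∀ i j, C (f i) (f j) = C1 i j := by
    intro i j
    rw [hCe, Matrix.add_apply, EE_apply_apply, EE_apply_left g g _ _ _ (fun x hx => hd i x hx.symm), add_zero]
  have gg : ∀ i j, C (g i) (g j) = C2 i j := by
    intro i j
    rw [hCe, Matrix.add_apply, EE_apply_apply, EE_apply_left f f _ _ _ (fun x hx => hd x i hx), zero_add]
  have fg : ∀ i j, C (f i) (g j) = 0 := by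
    intro i j
    rw [hCe, Matrix.add_apply, EE_apply_left g g _ _ _ (fun x hx => hd i x hx.symm), EE_apply_right f f _ _ _ (fun x hx => hd x j hx), zero_add]
  have gf : ∀ i j, C (g i) (f j) = 0 := by
    intro i j
    rw [hCe, Matrix.add_apply, EE_apply_right g g _ _ _ (fun x hx => hd j x hx.symm), EE_apply_left f f _ _ _ (fun x hx => hd x i hx), zero_add]
  refine ⟨C, ?_, by ext i j; exact ff i j, by ext i j; exact gg i j, by ext i j; exact fg i j⟩
  intro i j
  rcases h.cpl.2 i with ⟨i, rfl⟩ | ⟨i, rfl⟩ <;> rcases h.cpl.2 j with ⟨j, rfl⟩ | ⟨j, rfl⟩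
  · rw [ff, v1, v1]; exact h1 i j
  · left; exact fg i j
  · left; exact gf i j
  · rw [gg, v2, v2]
    rcases h2 i j with h' | h'
    · left; exact h'
    · right; exact ⟨h'.1, by omega⟩

theorem exists_adm_aux (ψ : AddChar F ℂ) (n : ℕ) (IH : ∀ m < n, ∀ k : Irr (GL (Fin m) F), ∃ C, Adm C ∧ rep k (ecx ψ C) ≠ 0)
    (k : Irr (GL (Fin n) F)) (hk : ¬ Atom k) : ∃ (a b : ℕ) (f : Fin a ↪ Fin n) (g : Fin b ↪ Fin n) (h : Std f g)
      (C : Matrix (Fin n) (Fin n) F), a ≠ 0 ∧ b ≠ 0 ∧ Adm C ∧ C.submatrix f g = 0 ∧ rep k (ecx ψ C) ≠ 0 := by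
  obtain ⟨a, b, i, j, hr, ha, hb⟩ := not_atom hk
  have hab := hr.card
  obtain ⟨C1, hC1, n1⟩ := IH a (by omega) i
  obtain ⟨C2, hC2, n2⟩ := IH b (by omega) j
  obtain ⟨f, g, hs⟩ := exists_std hab
  obtain ⟨C, hC, rfl, rfl, h0⟩ := exists_block hs hC1 hC2
  refine ⟨a, b, f, g, hs, C, ha, hb, hC, h0, ?_⟩
  rw [ecx_eq ψ hC, ec_split_zero ψ hC hs h0]
  rw [ecx_eq ψ hC1] at n1
  rw [ecx_eq ψ hC2] at n2
  exact hr.eta_ne hs.cpl n1 n2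

theorem ut_eq_one_of_le_one (hn : n ≤ 1) (x : NN F n) : x = 1 := by
  apply Subtype.ext
  ext i j
  exact x.2 i j (by rw [Fin.le_def]; omega)

theorem exists_adm {ψ : AddChar F ℂ} (hψ : ψ ≠ 1) : ∀ (n : ℕ) (k : Irr (GL (Fin n) F)), ∃ C, Adm C ∧ rep k (ecx ψ C) ≠ 0 := by
  intro n
  induction n using Nat.strong_induction_on with
  | _ n IH =>
    intro k
    by_cases hk : Atom k
    · rcases n with _ | m
      · refine ⟨Cn F 0, adm_Cn, ?_⟩
        rw [ecx_eq ψ adm_Cn]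
        have : ec ψ (Cn F 0) adm_Cn = 1 := by
          have hu : (Finset.univ : Finset (NN F 0)) = {1} := by
            ext x; simp [ut_eq_one_of_le_one (by omega) x]
          have hc : Fintype.card (NN F 0) = 1 := by
            rw [← Finset.card_univ, hu]; rfl
          rw [ec, avg, hu, hc, Finset.sum_singleton]
          simp only [inv_one, map_one, one_smul, gg_one, Nat.cast_one]
        rw [this, map_one]
        exact one_ne_zero
      · refine ⟨Cn F (m+1), adm_Cn, ?_⟩
        rw [ecx_eq ψ adm_Cn]
        exact (atom_dim hψ hk).1
    · obtain ⟨a, b, f, g, h, C, _, _, hC, _, h1⟩ := exists_adm_aux ψ n IH k hk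
      exact ⟨C, hC, h1⟩

theorem sum_inv_integral {G : Type} [Group G] [Fintype G] (H : Subgroup G) (φ : G → ℂ) (h1 : ∀ g, ∀ h ∈ H, φ (g * h) = φ g)
    (h2 : ∀ g, IsIntegral ℤ (φ g)) : IsIntegral ℤ ((∑ g, φ g) / (Nat.card H : ℂ)) := by
  classical
  haveI : Fintype H := Fintype.ofFinite _
  haveI : Fintype (G ⧸ H) := Fintype.ofFinite _
  have e : ∑ g, φ g = (Nat.card H : ℂ) * ∑ q : G ⧸ H, φ q.out := by
    have hm : ∀ (q : G ⧸ H) (h : H), (QuotientGroup.mk (q.out * h.1) : G ⧸ H) = q := by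
      intro q h
      rw [QuotientGroup.mk_mul_of_mem _ h.2]; exact Quotient.out_eq' q
    let e : (G ⧸ H) × H ≃ G := Equiv.ofBijective (fun p => p.1.out * p.2.1) (by
      constructor
      · rintro ⟨q, h⟩ ⟨q', h'⟩ hq
        simp only at hq
        have : q = q' := by rw [← hm q h, hq, hm]
        subst this
        rw [Subtype.ext (mul_left_cancel hq)]
      · intro y
        have h4 : (QuotientGroup.mk (QuotientGroup.mk y : G ⧸ H).out : G ⧸ H) = QuotientGroup.mk y := Quotient.out_eq' _
        rw [QuotientGroup.eq] at h4
        exact ⟨(QuotientGroup.mk y, ⟨_, h4⟩), by simp⟩)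
    rw [← e.sum_comp, Fintype.sum_prod_type, Finset.mul_sum]
    refine Finset.sum_congr rfl fun q _ => ?_
    have : ∀ h : H, φ (e (q, h)) = φ q.out := fun h => h1 _ _ h.2
    simp only [this]; simp
  have hc : (Nat.card H : ℂ) ≠ 0 := Nat.cast_ne_zero.2 Nat.card_pos.ne'
  rw [e, mul_div_cancel_left₀ _ hc]
  exact IsIntegral.sum _ fun q _ => h2 _

theorem ec_coeff_integral (ψ : AddChar F ℂ) {C : Matrix (Fin n) (Fin n) F} (hC : Adm C) (t) :
    IsIntegral ℤ ((Fintype.card (NN F n) : ℂ) * (ec ψ C hC).coeff t) := by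
  classical
  have hc : (Fintype.card (NN F n) : ℂ) ≠ 0 := Nat.cast_ne_zero.2 Fintype.card_ne_zero
  have e : (Fintype.card (NN F n) : ℂ) * (ec ψ C hC).coeff t = ∑ h : NN F n, th ψ C hC h⁻¹ * (gg h.1).coeff t := by
    rw [ec, avg, MonoidAlgebra.coeff_smul, Finsupp.smul_apply, smul_eq_mul, ← mul_assoc, mul_inv_cancel₀ hc, one_mul,
      MonoidAlgebra.coeff_sum, Finsupp.finset_sum_apply]
    rfl
  rw [e]
  refine IsIntegral.sum _ fun h _ => IsIntegral.mul ?_ ?_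
  · have h1 : (th ψ C hC h⁻¹) ^ (Fintype.card (NN F n)) = 1 := by rw [← map_pow, pow_card_eq_one, map_one]
    exact IsIntegral.of_pow Fintype.card_pos (by rw [h1]; exact isIntegral_one)
  · simp only [MonoidAlgebra.of_apply, MonoidAlgebra.coeff_single, Finsupp.single_apply]
    split_ifs
    · exact isIntegral_one
    · exact isIntegral_zero

theorem coeff_conj {G : Type} [Group G] [Fintype G] (x : CG G) (y t : G) :
    (gg y * x * gg y⁻¹).coeff t = x.coeff (y⁻¹ * t * y) := by
  rw [gg, gg, MonoidAlgebra.of_apply, MonoidAlgebra.of_apply, MonoidAlgebra.coeff_mul_single_eq_coeff_mul (t * y), mul_one,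
    MonoidAlgebra.coeff_single_mul_eq_mul_coeff (y⁻¹ * t * y), one_mul]
  · intro m _
    constructor
    · intro h; rw [mul_assoc, ← h]; simp
    · rintro rfl; simp [mul_assoc]
  · intro m _
    constructor
    · rintro rfl; simp
    · rintro rfl; simp

theorem nonatom_integral {ψ : AddChar F ℂ} (hψ : ψ ≠ 1) (k : Irr (GL (Fin n) F)) (hk : ¬ Atom k) :
    IsIntegral ℤ ((((n.factorial)^(n-1)).factorial : ℂ) * (Fintype.card (NN F n) : ℂ) * (Fintype.card (GL (Fin n) F) : ℂ)
      / (dm _ k * ((Fintype.card F : ℂ) - 1)^2)) := by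
  classical
  obtain ⟨a, b, f, g, h, C, ha, hb, hC, h0, h1⟩ := exists_adm_aux ψ n (fun m _ => exists_adm hψ m) k hk
  rw [ecx_eq ψ hC] at h1
  set e := ec ψ C hC with he
  have hcomm : ∀ z ∈ (dsc h.cpl.1).range, gg z * e = e * gg z := by
    rintro _ ⟨p, rfl⟩
    rw [he, ec_split_zero ψ hC h h0, dsc_apply]
    exact eta_central _ (sc_comm _) (sc_comm _) _ _
  set H : Subgroup (GL (Fin n) F) := (dsc h.cpl.1).range with hH
  have hcard : (Nat.card H : ℂ) = ((Fintype.card F : ℂ) - 1)^2 := by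
    have e1 : Nat.card H = Nat.card (Fˣ × Fˣ) := (Nat.card_congr (MonoidHom.ofInjective (dsc_inj h.cpl ha hb)).toEquiv).symm
    rw [e1, Nat.card_prod, Nat.card_eq_fintype_card, Fintype.card_units, Nat.cast_mul, Nat.cast_sub Fintype.card_pos, Nat.cast_one, sq]
  set N : ℂ := (Fintype.card (NN F n) : ℂ) with hN
  let x : CG (GL (Fin n) F) := (N / (Nat.card H : ℂ)) • ∑ y : GL (Fin n) F, gg y * e * gg y⁻¹
  have hx : ∀ t, IsIntegral ℤ (x.coeff t) := by
    intro t
    have e2 : x.coeff t = (∑ y : GL (Fin n) F, N * e.coeff (y⁻¹ * t * y)) / (Nat.card H : ℂ) := by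
      simp only [x]
      rw [MonoidAlgebra.coeff_smul, Finsupp.smul_apply, MonoidAlgebra.coeff_sum, Finsupp.finset_sum_apply, smul_eq_mul, div_mul_eq_mul_div,
        Finset.mul_sum]
      congr 1
      refine Finset.sum_congr rfl fun y _ => ?_
      rw [coeff_conj]
    rw [e2]
    apply sum_inv_integral
    · intro y z hz
      have c1 : gg z * e * gg z⁻¹ = e := by rw [hcomm z hz, mul_assoc, gg_mul_inv, mul_one]
      have c2 := coeff_conj e z (y⁻¹ * t * y)
      rw [c1] at c2
      rw [c2, mul_inv_rev]
      simp only [mul_assoc]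
    · intro y; exact ec_coeff_integral ψ hC _
  have hr : rep k x = (N / (Nat.card H : ℂ) * ((Fintype.card (GL (Fin n) F) : ℂ) / dm _ k * (rk ψ C k : ℂ))) • 1 := by
    have e3 := schur k (rep k e)
    simp only [x]
    rw [map_smul, map_sum]
    simp only [map_mul]
    rw [e3, smul_smul, trace_idem_rank _ (by rw [← map_mul, ec_idem]), rk, ecx_eq ψ hC]
  have h2 := central_integral k x hx _ hr
  have hw : rk ψ C k ≠ 0 := by rw [Ne, rk_eq_zero, ecx_eq ψ hC]; exact h1
  obtain ⟨r, hr'⟩ : rk ψ C k ∣ ((n.factorial)^(n-1)).factorial :=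
    Nat.dvd_factorial (Nat.pos_of_ne_zero hw) (rk_le hψ n k C hC)
  have h3 : IsIntegral ℤ ((r : ℂ) * (N / (Nat.card H : ℂ) * ((Fintype.card (GL (Fin n) F) : ℂ) / dm _ k * (rk ψ C k : ℂ)))) :=
    IsIntegral.mul (isIntegral_natCast r) h2
  convert h3 using 1
  rw [hr', hcard]
  have hd : (dm (GL (Fin n) F) k : ℂ) ≠ 0 := Nat.cast_ne_zero.2 (NeZero.ne _)
  have hq : (Fintype.card F : ℂ) - 1 ≠ 0 := by
    rw [sub_ne_zero]; exact_mod_cast Fintype.one_lt_card.ne'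
  push_cast
  field_simp

theorem card_NN (n : ℕ) : ∃ e : ℕ, ∀ (F : Type) [Field F] [Fintype F], Fintype.card (NN F n) = Fintype.card F ^ e := by
  classical
  refine ⟨Fintype.card {p : Fin n × Fin n // p.1 < p.2}, ?_⟩
  intro F _ _
  rw [← Fintype.card_fun]
  apply Fintype.card_congr
  let M : ({p : Fin n × Fin n // p.1 < p.2} → F) → Matrix (Fin n) (Fin n) F := fun v i j =>
    if h : i < j then v ⟨(i, j), h⟩ else (1 : Matrix (Fin n) (Fin n) F) i j
  have hM : ∀ v, (M v).det = 1 := by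
    intro v
    rw [Matrix.det_of_upperTriangular]
    · apply Finset.prod_eq_one
      intro i _
      simp [M]
    · intro i j hij
      have h1 : j < i := hij
      simp only [M]
      rw [dif_neg h1.asymm, Matrix.one_apply_ne h1.ne']
  refine ⟨fun x p => x.1.val p.1.1 p.1.2, fun v => ⟨Matrix.GeneralLinearGroup.mkOfDetNeZero (M v) (by rw [hM]; exact one_ne_zero), ?_⟩, ?_, ?_⟩
  · intro i j hij
    show M v i j = _
    simp only [M]
    rw [dif_neg (not_lt.2 hij)]
  · intro x
    apply Subtype.ext
    ext i j
    show M (fun p => x.1.val p.1.1 p.1.2) i j = _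
    simp only [M]
    by_cases h : i < j
    · rw [dif_pos h]
    · rw [dif_neg h]; exact (x.2 i j (not_lt.1 h)).symm
  · intro v
    ext p
    show M v _ _ = _
    simp only [M]
    rw [dif_pos p.2]

theorem om_integral {G : Type} [Group G] [Fintype G] (k : Irr G) {s : G} (hs : ∀ g, s * g = g * s) : IsIntegral ℤ (om k s) := by
  classical
  refine central_integral k (gg s) ?_ _ (rep_central k hs)
  intro t
  simp only [MonoidAlgebra.of_apply, MonoidAlgebra.coeff_single, Finsupp.single_apply]
  split_ifs
  · exact isIntegral_one
  · exact isIntegral_zero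

end Integ
end HRV


namespace HRV

section Abs

/-- graded refinement monoid -/
structure GRM (X : Type) [CommMonoid X] (deg : X → ℕ) : Prop where
  mul : ∀ x y, deg (x * y) = deg x + deg y
  zero : ∀ x, deg x = 0 ↔ x = 1
  ref : ∀ i j i' j', i * j = i' * j' → ∃ p q r s : X, i = p * q ∧ j = r * s ∧ i' = p * r ∧ j' = q * s

variable {X : Type} [CommMonoid X] {deg : X → ℕ}

theorem GRM.cancel (h : GRM X deg) : ∀ (n : ℕ) (x : X), deg x = n → ∀ y y', x * y = x * y' → y = y' := by
  intro n
  induction n using Nat.strong_induction_on with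
  | _ n IH =>
    intro x hx y y' hy
    obtain ⟨p, q, r, s, h1, h2, h3, h4⟩ := h.ref _ _ _ _ hy
    have d1 := h.mul p q
    have d2 := h.mul p r
    rw [← h1] at d1
    rw [← h3] at d2
    by_cases hq : deg q = 0
    · have hr : deg r = 0 := by omega
      rw [h2, h4, (h.zero _).1 hq, (h.zero _).1 hr]
    · have : q = r := IH (deg p) (by omega) p rfl q r (by rw [← h1, ← h3])
      rw [h2, h4, this]

/-- atoms of the monoid -/
def AtM (x : X) : Prop := x ≠ 1 ∧ ∀ y z, x = y * z → y = 1 ∨ z = 1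

theorem GRM.prime (h : GRM X deg) {ρ : X} (hρ : AtM ρ) {x y : X} (hd : ρ ∣ x * y) : ρ ∣ x ∨ ρ ∣ y := by
  obtain ⟨z, hz⟩ := hd
  obtain ⟨p, q, r, s, h1, h2, h3, h4⟩ := h.ref _ _ _ _ hz.symm
  rcases hρ.2 _ _ h1 with h5 | h5
  · rw [h5, one_mul] at h1
    right; rw [h4, ← h1]; exact dvd_mul_right _ _
  · rw [h5, mul_one] at h1
    left; rw [h3, ← h1]; exact dvd_mul_right _ _

theorem GRM.pow (h : GRM X deg) (x : X) (m : ℕ) : deg (x ^ m) = m * deg x := by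
  induction m with
  | zero => rw [pow_zero, zero_mul]; exact (h.zero 1).2 rfl
  | succ m ih => rw [pow_succ, h.mul, ih]; ring

theorem GRM.pos (h : GRM X deg) {ρ : X} (hρ : AtM ρ) : 0 < deg ρ := by
  rw [Nat.pos_iff_ne_zero]; intro h0; exact hρ.1 ((h.zero _).1 h0)

theorem GRM.not_dvd (h : GRM X deg) {ρ σ : X} (hρ : AtM ρ) (hσ : AtM σ) (hne : ρ ≠ σ) : ¬ ρ ∣ σ := by
  rintro ⟨z, hz⟩
  rcases hσ.2 _ _ hz with h1 | h1
  · exact hρ.1 h1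
  · rw [h1, mul_one] at hz; exact hne hz.symm

theorem GRM.pow_dvd_other (h : GRM X deg) {ρ σ : X} (hρ : AtM ρ) (hσ : AtM σ) (hne : ρ ≠ σ) (m : ℕ) :
    ∀ y, ρ ^ m ∣ σ * y ↔ ρ ^ m ∣ y := by
  intro y
  constructor
  · induction m generalizing y with
    | zero => intro _; rw [pow_zero]; exact one_dvd _
    | succ m ih =>
      intro hd
      have h1 : ρ ∣ σ * y := (dvd_pow_self ρ (Nat.succ_ne_zero m)).trans hd
      obtain ⟨z, rfl⟩ := (h.prime hρ h1).resolve_left (h.not_dvd hρ hσ hne)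
      obtain ⟨t, ht⟩ := hd
      have : σ * z = ρ ^ m * t := by
        apply h.cancel _ ρ rfl
        rw [← mul_assoc ρ (ρ^m), ← pow_succ', ← ht, mul_left_comm]
      obtain ⟨t', ht'⟩ := ih z ⟨t, this⟩
      exact ⟨t', by rw [pow_succ', mul_assoc, ← ht']⟩
  · intro hd; exact hd.trans (dvd_mul_left _ _)

theorem GRM.pow_dvd_self (h : GRM X deg) (ρ : X) (m : ℕ) (y : X) : ρ ^ (m+1) ∣ ρ * y ↔ ρ ^ m ∣ y := by
  constructor
  · rintro ⟨t, ht⟩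
    refine ⟨t, h.cancel _ ρ rfl _ _ ?_⟩
    rw [ht, pow_succ', mul_assoc]
  · rintro ⟨t, rfl⟩
    exact ⟨t, by rw [pow_succ', mul_assoc]⟩

theorem GRM.deg_le (h : GRM X deg) {x y : X} (hd : x ∣ y) : deg x ≤ deg y := by
  obtain ⟨z, rfl⟩ := hd
  rw [h.mul]; omega

theorem GRM.exists_atom (h : GRM X deg) : ∀ (n : ℕ) (x : X), deg x = n → x ≠ 1 → ∃ ρ, AtM ρ ∧ ρ ∣ x := by
  intro n
  induction n using Nat.strong_induction_on with
  | _ n IH =>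
    intro x hx h1
    by_cases ha : AtM x
    · exact ⟨x, ha, dvd_rfl⟩
    · simp only [AtM, not_and, not_forall, not_or] at ha
      obtain ⟨y, z, rfl, hy, hz⟩ := ha h1
      have d := h.mul y z
      have hz' : deg z ≠ 0 := fun h0 => hz ((h.zero _).1 h0)
      obtain ⟨ρ, h2, h3⟩ := IH (deg y) (by omega) y rfl hy
      exact ⟨ρ, h2, h3.trans (dvd_mul_right _ _)⟩

open scoped Classical in
theorem GRM.deg_sum (h : GRM X deg) (L : ℕ → Finset X) (hL : ∀ n x, x ∈ L n ↔ deg x = n) (N : ℕ) :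
    ∀ (n : ℕ) (x : X), deg x = n → n ≤ N →
      (n = ∑ d ∈ Finset.Icc 1 N, ∑ ρ ∈ (L d).filter AtM, d * ((Finset.Icc 1 N).filter (fun m => ρ ^ m ∣ x)).card) := by
  intro n
  induction n using Nat.strong_induction_on with
  | _ n IH =>
    intro x hx hn
    by_cases h1 : x = 1
    · subst h1
      have : n = 0 := by rw [← hx]; exact (h.zero 1).2 rfl
      subst this
      symm
      apply Finset.sum_eq_zero; intro d hd
      apply Finset.sum_eq_zero; intro ρ hρ
      rw [Finset.mem_filter] at hρ
      rw [Finset.card_eq_zero.2, mul_zero]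
      rw [Finset.filter_eq_empty_iff]
      intro m hm hd
      rw [Finset.mem_Icc] at hm
      have e1 := h.deg_le hd
      rw [h.pow, (h.zero 1).2 rfl] at e1
      have e2 := h.pos hρ.2
      have := Nat.mul_pos hm.1 e2
      omega
    · obtain ⟨σ, hσ, y, rfl⟩ := h.exists_atom n x hx h1
      have d1 := h.mul σ y
      have pσ := h.pos hσ
      have ih := IH (deg y) (by omega) y rfl (by omega)
      have key : ∀ d, ∀ ρ ∈ (L d).filter AtM, d * ((Finset.Icc 1 N).filter (fun m => ρ ^ m ∣ σ * y)).card =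
          d * ((Finset.Icc 1 N).filter (fun m => ρ ^ m ∣ y)).card + if ρ = σ then d else 0 := by
        intro d ρ hρ
        rw [Finset.mem_filter] at hρ
        split_ifs with he
        · subst he
          have : (Finset.Icc 1 N).filter (fun m => ρ ^ m ∣ ρ * y) =
              insert 1 (((Finset.Icc 1 N).filter (fun m => ρ ^ m ∣ y)).image (· + 1)) := by
            ext m
            simp only [Finset.mem_filter, Finset.mem_Icc, Finset.mem_insert, Finset.mem_image]
            constructor
            · rintro ⟨⟨h2, h3⟩, h4⟩
              obtain ⟨m, rfl⟩ : ∃ m', m = m' + 1 := ⟨m-1, by omega⟩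
              rw [h.pow_dvd_self] at h4
              by_cases hm : m = 0
              · left; omega
              · right; exact ⟨m, ⟨⟨by omega, by omega⟩, h4⟩, rfl⟩
            · rintro (rfl | ⟨m, ⟨⟨h2, h3⟩, h4⟩, rfl⟩)
              · refine ⟨⟨le_refl _, by omega⟩, ?_⟩
                rw [pow_one]; exact dvd_mul_right _ _
              · refine ⟨⟨by omega, ?_⟩, (h.pow_dvd_self _ _ _).2 h4⟩
                have e1 := h.deg_le h4
                rw [h.pow] at e1
                have := Nat.le_mul_of_pos_right m pσ
                omega
          rw [this, Finset.card_insert_of_notMem, Finset.card_image_of_injective _ (add_left_injective 1)]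
          · ring
          · simp only [Finset.mem_image, Finset.mem_filter, Finset.mem_Icc]
            rintro ⟨m, ⟨⟨h2, _⟩, _⟩, h3⟩
            omega
        · rw [add_zero]
          congr 2
          apply Finset.filter_congr
          intro m _
          exact h.pow_dvd_other hρ.2 hσ he m y
      have e3 : ∑ d ∈ Finset.Icc 1 N, ∑ ρ ∈ (L d).filter AtM, (if ρ = σ then d else 0) = deg σ := by
        rw [Finset.sum_eq_single (deg σ)]
        · rw [Finset.sum_ite_eq', if_pos]
          rw [Finset.mem_filter, hL]; exact ⟨rfl, hσ⟩
        · intro d _ hd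
          rw [Finset.sum_ite_eq', if_neg]
          rw [Finset.mem_filter, hL]; rintro ⟨h5, _⟩; exact hd h5.symm
        · intro hh
          exfalso; apply hh; rw [Finset.mem_Icc]; omega
      rw [Finset.sum_congr rfl (fun d _ => Finset.sum_congr rfl (key d))]
      simp only [Finset.sum_add_distrib]
      rw [e3, ← ih]; omega

open scoped Classical in
theorem GRM.newton (h : GRM X deg) (L : ℕ → Finset X) (hL : ∀ n x, x ∈ L n ↔ deg x = n) (w : X → ℂ) (w1 : w 1 = 1)
    (wm : ∀ x y, w (x * y) = w x * w y) (w0 : ∀ n, 1 ≤ n → ∑ x ∈ L n, w x = 0) (n : ℕ) (hn : 1 ≤ n) :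
    ∑ d ∈ n.divisors, (d : ℂ) * ∑ ρ ∈ (L d).filter AtM, w ρ ^ (n / d) = 0 := by
  have wp : ∀ x m, w (x ^ m) = w x ^ m := by
    intro x m
    induction m with
    | zero => rw [pow_zero, pow_zero, w1]
    | succ m ih => rw [pow_succ, pow_succ, wm, ih]
  have inner : ∀ d, ∀ ρ ∈ (L d).filter AtM, ∀ m ∈ Finset.Icc 1 n, ∑ x ∈ (L n).filter (fun x => ρ ^ m ∣ x), w x = if m * d = n then w ρ ^ m else 0 := by
    intro d ρ hρ m hm
    rw [Finset.mem_filter, hL] at hρ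
    by_cases hle : m * d ≤ n
    · have e1 : ∑ x ∈ (L n).filter (fun x => ρ ^ m ∣ x), w x = ∑ y ∈ L (n - m * d), w ρ ^ m * w y := by
        symm
        apply Finset.sum_bij (fun y _ => ρ ^ m * y)
        · intro y hy
          rw [hL] at hy
          rw [Finset.mem_filter, hL, h.mul, h.pow, hρ.1, hy]
          exact ⟨by omega, dvd_mul_right _ _⟩
        · intro y _ y' _ hy
          exact h.cancel _ _ rfl _ _ hy
        · intro x hx
          rw [Finset.mem_filter, hL] at hx
          obtain ⟨h1, y, rfl⟩ := hx
          refine ⟨y, ?_, rfl⟩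
          rw [h.mul, h.pow, hρ.1] at h1
          rw [hL]; omega
        · intro y _
          rw [wm, wp]
      rw [e1, ← Finset.mul_sum]
      split_ifs with he
      · have : L (n - m * d) = {1} := by
          ext x; rw [hL, he, Nat.sub_self, h.zero, Finset.mem_singleton]
        rw [this, Finset.sum_singleton, w1, mul_one]
      · rw [w0 _ (by omega), mul_zero]
    · rw [if_neg (by omega)]
      apply Finset.sum_eq_zero
      intro x hx
      rw [Finset.mem_filter, hL] at hx
      have := h.deg_le hx.2
      rw [h.pow, hρ.1] at this
      omega
  have outer : ∀ d ∈ Finset.Icc 1 n, ∀ z : ℂ, ∑ m ∈ Finset.Icc 1 n, (if m * d = n then z ^ m else 0) = if d ∣ n then z ^ (n / d) else 0 := by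
    intro d hd z
    rw [Finset.mem_Icc] at hd
    split_ifs with hdn
    · obtain ⟨c, rfl⟩ := hdn
      rw [Nat.mul_div_cancel_left _ hd.1, Finset.sum_eq_single c]
      · rw [if_pos (mul_comm _ _)]
      · intro m _ hm
        rw [if_neg]
        intro h'; apply hm
        rw [mul_comm] at h'
        exact Nat.eq_of_mul_eq_mul_left hd.1 h'
      · intro hc; exfalso; apply hc
        rw [Finset.mem_Icc]
        exact ⟨Nat.pos_of_ne_zero (by rintro rfl; omega), Nat.le_mul_of_pos_left _ hd.1⟩
    · apply Finset.sum_eq_zero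
      intro m _
      rw [if_neg]
      rintro rfl; exact hdn (dvd_mul_left _ _)
  have tot : (0 : ℂ) = ∑ x ∈ L n, (n : ℂ) * w x := by rw [← Finset.mul_sum, w0 n hn, mul_zero]
  have e2 : ∑ x ∈ L n, (n : ℂ) * w x = ∑ d ∈ Finset.Icc 1 n, ∑ ρ ∈ (L d).filter AtM, (d : ℂ) * ∑ m ∈ Finset.Icc 1 n, ∑ x ∈ (L n).filter (fun x => ρ ^ m ∣ x), w x := by
    have e3 : ∀ x ∈ L n, (n : ℂ) * w x = ∑ d ∈ Finset.Icc 1 n, ∑ ρ ∈ (L d).filter AtM, ∑ m ∈ Finset.Icc 1 n, (d : ℂ) * (if ρ ^ m ∣ x then w x else 0) := by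
      intro x hx
      have := h.deg_sum L hL n n x ((hL _ _).1 hx) le_rfl
      conv_lhs => rw [this]
      push_cast
      rw [Finset.sum_mul]
      refine Finset.sum_congr rfl fun d _ => ?_
      rw [Finset.sum_mul]
      refine Finset.sum_congr rfl fun ρ _ => ?_
      rw [← Finset.mul_sum, ← Finset.sum_filter, Finset.sum_const, nsmul_eq_mul, mul_assoc]
    rw [Finset.sum_congr rfl e3, Finset.sum_comm]
    refine Finset.sum_congr rfl fun d _ => ?_
    rw [Finset.sum_comm]
    refine Finset.sum_congr rfl fun ρ _ => ?_
    rw [Finset.sum_comm, Finset.mul_sum]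
    refine Finset.sum_congr rfl fun m _ => ?_
    rw [← Finset.mul_sum, ← Finset.sum_filter]
  rw [tot, e2]
  have e4 : ∀ d ∈ Finset.Icc 1 n, ∑ ρ ∈ (L d).filter AtM, (d : ℂ) * ∑ m ∈ Finset.Icc 1 n, ∑ x ∈ (L n).filter (fun x => ρ ^ m ∣ x), w x =
      if d ∣ n then (d : ℂ) * ∑ ρ ∈ (L d).filter AtM, w ρ ^ (n / d) else 0 := by
    intro d hd
    have : ∀ ρ ∈ (L d).filter AtM, (d : ℂ) * ∑ m ∈ Finset.Icc 1 n, ∑ x ∈ (L n).filter (fun x => ρ ^ m ∣ x), w x = (d : ℂ) * if d ∣ n then w ρ ^ (n/d) else 0 := by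
      intro ρ hρ
      rw [Finset.sum_congr rfl (inner d ρ hρ), outer d hd]
    rw [Finset.sum_congr rfl this]
    split_ifs
    · rw [Finset.mul_sum]
    · simp
  rw [Finset.sum_congr rfl e4, ← Finset.sum_filter]
  apply Finset.sum_congr _ (fun _ _ => rfl)
  ext d
  simp only [Nat.mem_divisors, Finset.mem_filter, Finset.mem_Icc]
  constructor
  · rintro ⟨h1, h2⟩
    exact ⟨⟨Nat.pos_of_dvd_of_pos h1 hn, Nat.le_of_dvd hn h1⟩, h1⟩
  · rintro ⟨_, h1⟩; exact ⟨h1, by omega⟩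

end Abs
end HRV


namespace HRV

section CC0
variable {G : Type} [Group G] [Fintype G]

theorem irr_nonempty : Nonempty (Irr G) := by
  by_contra h
  rw [not_nonempty_iff] at h
  have h1 := sum_zz (G := G)
  rw [Finset.univ_eq_empty, Finset.sum_empty] at h1
  have := congrArg (fun x : CG G => x.coeff 1) h1
  simp [MonoidAlgebra.one_def] at this

theorem irr_subsingleton [Subsingleton G] : Subsingleton (Irr G) := by
  have key : ∀ x : CG G, x = x.coeff 1 • 1 := by
    intro x
    conv_lhs => rw [CG_span x]
    rw [Finset.sum_eq_single 1]
    · rw [gg_one]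
    · intro b _ hb; exact absurd (Subsingleton.elim _ _) hb
    · simp
  constructor
  intro i j
  by_contra h
  have h1 := zz_mul_ne h
  rw [key (zz j), mul_smul_comm, mul_one] at h1
  rcases smul_eq_zero.1 h1 with h2 | h2
  · exact zz_ne_zero j (by rw [key (zz j), h2, zero_smul])
  · exact zz_ne_zero i h2

theorem gg_mul_zz (k : Irr G) {s : G} (hs : ∀ g, s * g = g * s) : gg s * zz k = om k s • zz k := by
  apply eq_of_rep
  intro l
  rw [map_mul, map_smul]
  by_cases h : l = k
  · subst h; rw [rep_central l hs, rep_zz_self]; simp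
  · rw [rep_zz_ne h]; simp

theorem om_one (k : Irr G) : om k (1 : G) = 1 := by
  have h := rep_central k (s := (1 : G)) (by simp)
  rw [gg_one, map_one] at h
  have := congrFun (congrFun h 0) 0
  simpa using this.symm

end CC0

section CC1
variable {F : Type} [Field F] [Fintype F] {a b c d m n : ℕ}

theorem en_zero (ψ : AddChar F ℂ) : en ψ 0 = 1 := by
  have : ∀ x : NN F 0, x = 1 := by
    rintro ⟨x, hx⟩
    apply Subtype.ext
    ext i j
    exact i.elim0
  have hu : (Finset.univ : Finset (NN F 0)) = {1} := by
    ext x; simp [this x]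
  have hc : Fintype.card (NN F 0) = 1 := by
    rw [← Finset.card_univ, hu]; rfl
  show avg _ _ = _
  rw [avg, hu, hc, Finset.sum_singleton]
  simp only [inv_one, map_one, one_smul, gg_one, Nat.cast_one]

theorem gl0_sub : Subsingleton (GL (Fin 0) F) := ⟨fun x y => by ext i j; exact i.elim0⟩

instance irr0_sub : Subsingleton (Irr (GL (Fin 0) F)) := by
  haveI := gl0_sub (F := F); exact irr_subsingleton

theorem gen_zero (ψ : AddChar F ℂ) (k : Irr (GL (Fin 0) F)) : Gen ψ k := by
  rw [Gen, en_zero, map_one]; exact one_ne_zero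

theorem rel_zero {k i : Irr (GL (Fin n) F)} {j : Irr (GL (Fin 0) F)} : Rel k i j ↔ k = i := by
  have hc : Cpl (Function.Embedding.refl (Fin n)) (⟨Fin.elim0, fun x => x.elim0⟩ : Fin 0 ↪ Fin n) :=
    ⟨fun i j => j.elim0, fun x => Or.inl ⟨x, rfl⟩⟩
  have hj : zz j = 1 := by
    have := sum_zz (G := GL (Fin 0) F)
    rwa [Fintype.sum_subsingleton _ j] at this
  have e1 : (eu _ _ hc.1 : CG (GL (Fin n) F)) = 1 := by
    have hu : (Finset.univ : Finset (Multiplicative (Matrix (Fin n) (Fin 0) F))) = {1} := by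
      ext x
      simp only [Finset.mem_univ, Finset.mem_singleton, true_iff]
      apply Multiplicative.toAdd.injective
      ext i j; exact j.elim0
    have hc : Fintype.card (Multiplicative (Matrix (Fin n) (Fin 0) F)) = 1 := by
      rw [← Finset.card_univ, hu]; rfl
    rw [eu, avg, hu, hc, Finset.sum_singleton]
    simp only [inv_one, map_one, one_smul, gg_one, Nat.cast_one]
  have e2 : (io (F := F) (Function.Embedding.refl (Fin n))) = MonoidHom.id _ := by
    ext x i j
    have := io_apply (F := F) (Function.Embedding.refl (Fin n)) x i j
    exact this
  have e3 : mp (MonoidHom.id (GL (Fin n) F)) (zz i) = zz i := by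
    conv_lhs => rw [CG_span (zz i), map_sum]
    conv_rhs => rw [CG_span (zz i)]
    refine Finset.sum_congr rfl fun x _ => ?_
    rw [map_smul, mp_gg]; rfl
  have e4 : eta _ _ hc.1 (zz i) (zz j) = zz i := by
    rw [eta, e1, e2, e3, hj, map_one, one_mul, mul_one]
  constructor
  · intro h
    have := h.all hc
    rw [e4] at this
    exact irr_eq_of_rep_zz this
  · rintro rfl
    refine ⟨_, _, hc, ?_⟩
    rw [e4, rep_zz_self]; exact one_ne_zero

theorem om_rel {k : Irr (GL (Fin n) F)} {i : Irr (GL (Fin a) F)} {j : Irr (GL (Fin b) F)} (h : Rel k i j) (s : Fˣ) :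
    om k (sc F n s) = om i (sc F a s) * om j (sc F b s) := by
  obtain ⟨f, g, hc, hk⟩ := h
  have e1 : sc F n s = io f (sc F a s) * io g (sc F b s) := by
    apply Units.ext
    rw [io_mul_io_val hc, sc_val, sc_val, sc_val]
    ext x y
    rw [Matrix.add_apply]
    rcases hc.2 x with ⟨x, rfl⟩ | ⟨x, rfl⟩
    · rw [EE_apply_left g g _ _ _ (fun z hz => hc.1 _ _ hz.symm), add_zero]
      rcases hc.2 y with ⟨y, rfl⟩ | ⟨y, rfl⟩
      · rw [EE_apply_apply]; simp [Matrix.one_apply]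
      · rw [EE_apply_right f f _ _ _ (fun z hz => hc.1 _ _ hz)]
        simp [Matrix.one_apply, hc.1 x y]
    · rw [EE_apply_left f f _ _ _ (fun z hz => hc.1 _ _ hz), zero_add]
      rcases hc.2 y with ⟨y, rfl⟩ | ⟨y, rfl⟩
      · rw [EE_apply_right g g _ _ _ (fun z hz => hc.1 _ _ hz.symm)]
        simp [Matrix.one_apply, (hc.1 y x).symm]
      · rw [EE_apply_apply]; simp [Matrix.one_apply]
  have hs := sc_comm (F := F) (m := n) s
  have e2 : eta f g hc.1 (zz i) (zz j) * gg (sc F n s) = (om i (sc F a s) * om j (sc F b s)) • eta f g hc.1 (zz i) (zz j) := by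
    rw [e1, gg_mul, ← mp_gg (io f), ← mp_gg (io g), eta_mul, ← gg_central (sc_comm s), ← gg_central (sc_comm s), gg_mul_zz _ (sc_comm s), gg_mul_zz _ (sc_comm s)]
    simp only [eta, map_smul, mul_smul_comm, smul_mul_assoc, smul_smul]
    rw [mul_comm]
  have e3 := congrArg (rep k) e2
  rw [map_mul, rep_central k hs, map_smul, mul_smul_comm, mul_one] at e3
  exact smul_left_injective ℂ hk e3

end CC1
end HRV


namespace HRV

section CC2
variable {F : Type} [Field F] [Fintype F] {a b c d m n : ℕ}

theorem no_conj (hn : 1 ≤ n) {s : Fˣ} (hs : s ≠ 1) {x y : GL (Fin n) F} (hx : x ∈ NN F n) (hy : y ∈ NN F n) (g : GL (Fin n) F) :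
    sc F n s * x * g * y ≠ g := by
  intro h
  have e1 : sc F n s * x = g * y⁻¹ * g⁻¹ := by
    rw [eq_mul_inv_iff_mul_eq, eq_mul_inv_iff_mul_eq]; exact h
  have hy' := (NN F n).inv_mem hy
  have e2 : ((s : F) • x.val - 1) = g.val * (y⁻¹.val - 1) * g⁻¹.val := by
    have := congrArg Units.val e1
    rw [Units.val_mul, sc_val, Units.val_mul, Units.val_mul, smul_mul_assoc, one_mul] at this
    rw [this, mul_sub, sub_mul, mul_one, ← Units.val_mul g g⁻¹, mul_inv_cancel, Units.val_one]
  have d1 : ((s : F) • x.val - 1).det = ((s : F) - 1) ^ n := by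
    rw [Matrix.det_of_upperTriangular]
    · have : ∀ i : Fin n, ((s : F) • x.val - 1) i i = (s : F) - 1 := by
        intro i
        rw [Matrix.sub_apply, Matrix.smul_apply, hx i i le_rfl]
        simp
      rw [Finset.prod_congr rfl (fun i _ => this i)]; simp
    · intro i j hij
      have hij : j < i := hij
      rw [Matrix.sub_apply, Matrix.smul_apply, hx i j hij.le, Matrix.one_apply_ne hij.ne']
      simp
  have d2 : (y⁻¹.val - 1).det = 0 := by
    rw [Matrix.det_of_upperTriangular]
    · apply Finset.prod_eq_zero (Finset.mem_univ (⟨0, hn⟩ : Fin n))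
      rw [Matrix.sub_apply, hy' _ _ le_rfl, sub_self]
    · intro i j hij
      have hij : j < i := hij
      rw [Matrix.sub_apply, hy' i j hij.le, sub_self]
  have d3 := congrArg Matrix.det e2
  rw [d1, Matrix.det_mul, Matrix.det_mul, d2, mul_zero, zero_mul] at d3
  exact hs (Units.ext (sub_eq_zero.1 (pow_eq_zero_iff (by omega) |>.1 d3)))

theorem rank_zero {ι : Type} [Fintype ι] [DecidableEq ι] (M : Matrix ι ι ℂ) (h : M.rank = 0) : M = 0 := by
  rw [Matrix.rank, Submodule.finrank_eq_zero, LinearMap.range_eq_bot] at h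
  ext i j
  have := congrFun (LinearMap.congr_fun h (Pi.single j 1)) i
  simpa using this

open scoped Classical in
theorem chi_en {ψ : AddChar F ℂ} (hψ : ψ ≠ 1) (k : Irr (GL (Fin n) F)) : chi k (en ψ n) = if Gen ψ k then 1 else 0 := by
  have h1 : rep k (en ψ n) * rep k (en ψ n) = rep k (en ψ n) := by
    rw [← map_mul, ec_idem]
  have h2 := rank_en hψ k
  split_ifs with h
  · rw [chi, trace_idem_rank _ h1]
    have : (rep k (en ψ n)).rank ≠ 0 := by
      intro h0
      exact h (by exact rank_zero _ h0)
    have : (rep k (en ψ n)).rank = 1 := by omega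
    rw [this]; simp
  · have : rep k (en ψ n) = 0 := by by_contra h3; exact h h3
    rw [chi, this, Matrix.trace_zero]

open scoped Classical in
theorem om_sum_zero {ψ : AddChar F ℂ} (hψ : ψ ≠ 1) (hn : 1 ≤ n) {s : Fˣ} (hs : s ≠ 1) :
    ∑ k : Irr (GL (Fin n) F), (if Gen ψ k then om k (sc F n s) else 0) = 0 := by
  have h1 := trace_lemma (gg (sc F n s) * en ψ n) (en ψ n)
  have h2 : ∀ k : Irr (GL (Fin n) F), chi k (gg (sc F n s) * en ψ n) * chi k (en ψ n) = if Gen ψ k then om k (sc F n s) else 0 := by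
    intro k
    have : chi k (gg (sc F n s) * en ψ n) = om k (sc F n s) * chi k (en ψ n) := by
      rw [chi, map_mul, rep_central k (sc_comm s), smul_mul_assoc, one_mul, Matrix.trace_smul, smul_eq_mul]
    rw [this, chi_en hψ]
    split_ifs <;> simp
  rw [Finset.sum_congr rfl (fun k _ => (h2 k).symm), h1]
  apply Finset.sum_eq_zero
  intro g _
  have e : en ψ n = (Fintype.card (NN F n) : ℂ)⁻¹ • ∑ h : NN F n, th ψ (Cn F n) adm_Cn h⁻¹ • gg (h : GL (Fin n) F) := rfl
  rw [e]
  simp only [mul_smul_comm, smul_mul_assoc, Finset.mul_sum, Finset.sum_mul, ← gg_mul, MonoidAlgebra.coeff_smul, MonoidAlgebra.coeff_sum,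
    Finsupp.smul_apply, Finsupp.finset_sum_apply]
  have key : ∀ x y : NN F n, (gg (sc F n s * x * g * y)).coeff g = 0 := by
    intro x y
    rw [gg, MonoidAlgebra.of_apply, MonoidAlgebra.coeff_single, Finsupp.single_apply, if_neg (no_conj hn hs x.2 y.2 g)]
  simp only [key, smul_zero, Finset.sum_const_zero]

theorem om_mul {G : Type} [Group G] [Fintype G] (k : Irr G) {s t : G} (hs : ∀ g, s * g = g * s) (ht : ∀ g, t * g = g * t) :
    om k (s * t) = om k s * om k t := by
  have h := rep_central k (s := s * t) (fun g => by rw [mul_assoc, ht, ← mul_assoc, hs, mul_assoc])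
  rw [gg_mul, map_mul, rep_central k hs, rep_central k ht] at h
  have := congrFun (congrFun h 0) 0
  simp at this
  rw [mul_comm]; exact this.symm

theorem om_sc_pow (k : Irr (GL (Fin n) F)) (s : Fˣ) (m : ℕ) : om k (sc F n s) ^ m = om k (sc F n (s ^ m)) := by
  induction m with
  | zero => rw [pow_zero, pow_zero, map_one, om_one]
  | succ m ih => rw [pow_succ, pow_succ, map_mul, om_mul _ (sc_comm _) (sc_comm _), ih]

/-- the set of generic irreducibles -/
def GX (ψ : AddChar F ℂ) : Type := Σ n : ℕ, {k : Irr (GL (Fin n) F) // Gen ψ k}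

def RX {ψ : AddChar F ℂ} (z x y : GX ψ) : Prop := Rel z.2.1 x.2.1 y.2.1

theorem RX.deg {ψ : AddChar F ℂ} {z x y : GX ψ} (h : RX z x y) : z.1 = x.1 + y.1 := (Rel.card h).symm

theorem RX.uniq {ψ : AddChar F ℂ} (hψ : ψ ≠ 1) {z z' x y : GX ψ} (h : RX z x y) (h' : RX z' x y) : z = z' := by
  have hd : z.1 = z'.1 := by rw [h.deg, h'.deg]
  obtain ⟨n, k, hk⟩ := z
  obtain ⟨n', k', hk'⟩ := z'
  obtain rfl : n = n' := hd
  obtain rfl : k = k' := gen_unique hψ hk hk' h h'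
  rfl

theorem RX.ex {ψ : AddChar F ℂ} (hψ : ψ ≠ 1) (x y : GX ψ) : ∃ z, RX z x y := by
  obtain ⟨k, hk, h⟩ := exists_gen hψ x.2.2 y.2.2 rfl
  exact ⟨⟨_, k, hk⟩, h⟩

noncomputable def RX.mm {ψ : AddChar F ℂ} (hψ : ψ ≠ 1) (x y : GX ψ) : GX ψ := (RX.ex hψ x y).choose

theorem RX.m_spec {ψ : AddChar F ℂ} (hψ : ψ ≠ 1) (x y : GX ψ) : RX (RX.mm hψ x y) x y := (RX.ex hψ x y).choose_spec

theorem RX.m_iff {ψ : AddChar F ℂ} (hψ : ψ ≠ 1) {z x y : GX ψ} : z = RX.mm hψ x y ↔ RX z x y := by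
  constructor
  · rintro rfl; exact RX.m_spec hψ x y
  · intro h; exact h.uniq hψ (RX.m_spec hψ x y)

theorem RX.symm {ψ : AddChar F ℂ} (hψ : ψ ≠ 1) {z x y : GX ψ} (h : RX z x y) : RX z y x :=
  Rel.symm hψ z.2.2 x.2.2 y.2.2 h

noncomputable def GX.one (ψ : AddChar F ℂ) : GX ψ := ⟨0, irr_nonempty.some, gen_zero ψ _⟩

theorem GX.deg0 {ψ : AddChar F ℂ} (x : GX ψ) (h : x.1 = 0) : x = GX.one ψ := by
  obtain ⟨n, k, hk⟩ := x
  obtain rfl : n = 0 := h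
  obtain rfl : k = irr_nonempty.some := Subsingleton.elim _ _
  rfl

theorem RX.one {ψ : AddChar F ℂ} (x : GX ψ) : RX x x (GX.one ψ) := rel_zero.2 rfl

noncomputable def gmon {ψ : AddChar F ℂ} (hψ : ψ ≠ 1) : CommMonoid (GX ψ) where
  mul := RX.mm hψ
  one := GX.one ψ
  mul_assoc := by
    intro x y z
    show RX.mm hψ (RX.mm hψ x y) z = RX.mm hψ x (RX.mm hψ y z)
    rw [RX.m_iff]
    have h1 := RX.m_spec hψ (RX.mm hψ x y) z
    have h2 := RX.m_spec hψ x y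
    obtain ⟨t, h3, h4⟩ := Rel.assoc h1 h2
    have ht := (gen_of_rel hψ (RX.mm hψ (RX.mm hψ x y) z).2.2 h3).2
    have h5 : (⟨_, t, ht⟩ : GX ψ) = RX.mm hψ y z := (RX.m_iff hψ).2 h4
    rw [← h5]; exact h3
  one_mul := by
    intro x
    exact ((RX.m_iff hψ).2 (RX.symm hψ (RX.one x))).symm
  mul_one := by
    intro x
    exact ((RX.m_iff hψ).2 (RX.one x)).symm
  mul_comm := by
    intro x y
    exact (RX.m_iff hψ).2 (RX.symm hψ (RX.m_spec hψ x y))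

theorem grm_GX {ψ : AddChar F ℂ} (hψ : ψ ≠ 1) : @GRM (GX ψ) (gmon hψ) Sigma.fst := by
  letI := gmon hψ
  refine ⟨fun x y => (RX.m_spec hψ x y).deg, fun x => ⟨GX.deg0 x, ?_⟩, ?_⟩
  · rintro rfl; rfl
  · intro i j i' j' h
    have h1 : RX (i * j) i j := RX.m_spec hψ i j
    have h2 : RX (i * j) i' j' := (RX.m_iff hψ).1 h
    obtain ⟨α, β, γ, δ, p, q, r, s, e1, e2, e3, e4⟩ := Rel.refine h1 h2
    have g1 := gen_of_rel hψ i.2.2 e1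
    have g2 := gen_of_rel hψ j.2.2 e2
    refine ⟨⟨_, p, g1.1⟩, ⟨_, q, g1.2⟩, ⟨_, r, g2.1⟩, ⟨_, s, g2.2⟩, ?_, ?_, ?_, ?_⟩
    · exact (RX.m_iff hψ).2 e1
    · exact (RX.m_iff hψ).2 e2
    · exact (RX.m_iff hψ).2 e3
    · exact (RX.m_iff hψ).2 e4

theorem atm_iff {ψ : AddChar F ℂ} (hψ : ψ ≠ 1) (x : GX ψ) (hx : 1 ≤ x.1) : @AtM _ (gmon hψ) x ↔ Atom x.2.1 := by
  letI := gmon hψ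
  have H := grm_GX hψ
  constructor
  · intro h a b i j hr
    have g1 := gen_of_rel hψ x.2.2 hr
    rcases h.2 ⟨_, i, g1.1⟩ ⟨_, j, g1.2⟩ ((RX.m_iff hψ).2 hr) with h2 | h2
    · exact Or.inl ((H.zero _).2 h2)
    · exact Or.inr ((H.zero _).2 h2)
  · intro h
    refine ⟨?_, ?_⟩
    · intro h1; have := (H.zero _).2 h1; omega
    · intro y z hyz
      rcases h _ _ _ _ ((RX.m_iff hψ).1 hyz) with h2 | h2
      · exact Or.inl ((H.zero _).1 h2)
      · exact Or.inr ((H.zero _).1 h2)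

open scoped Classical in
noncomputable def asum (F : Type) [Field F] [Fintype F] (d : ℕ) (s : Fˣ) : ℂ :=
  ∑ k : Irr (GL (Fin d) F), if Atom k then om k (sc F d s) else 0

open scoped Classical in
theorem asum_newton {ψ : AddChar F ℂ} (hψ : ψ ≠ 1) {s : Fˣ} (hs : s ≠ 1) (n : ℕ) (hn : 1 ≤ n) :
    ∑ d ∈ n.divisors, (d : ℂ) * asum F d (s ^ (n / d)) = 0 := by
  letI := gmon hψ
  have H := grm_GX hψ
  have inj : ∀ m, Function.Injective (fun k : {k : Irr (GL (Fin m) F) // Gen ψ k} => (⟨m, k⟩ : GX ψ)) := by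
    intro m k l h
    exact eq_of_heq (Sigma.mk.inj h).2
  let L : ℕ → Finset (GX ψ) := fun m => (Finset.univ : Finset {k : Irr (GL (Fin m) F) // Gen ψ k}).map ⟨_, inj m⟩
  have hL : ∀ m x, x ∈ L m ↔ x.1 = m := by
    intro m x
    simp only [L, Finset.mem_map, Finset.mem_univ, true_and, Function.Embedding.coeFn_mk]
    constructor
    · rintro ⟨k, rfl⟩; rfl
    · rintro rfl; exact ⟨x.2, rfl⟩
  have hsum : ∀ m (f : GX ψ → ℂ) (f' : Irr (GL (Fin m) F) → ℂ), (∀ k, f ⟨m, k⟩ = f' k.1) → ∑ x ∈ L m, f x = ∑ k : Irr (GL (Fin m) F), if Gen ψ k then f' k else 0 := by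
    intro m f f' hf
    rw [Finset.sum_map, ← Finset.sum_filter]
    refine (Finset.sum_congr rfl (fun k _ => hf k)).trans ?_
    exact (Finset.sum_subtype (p := fun k => Gen ψ k) _ (by simp) f').symm
  have h := H.newton L hL (fun x => om x.2.1 (sc F x.1 s)) ?_ ?_ ?_ n hn
  · rw [← h]
    refine Finset.sum_congr rfl fun d hd => ?_
    congr 1
    have hd1 : 1 ≤ d := Nat.pos_of_mem_divisors hd
    rw [Finset.sum_filter, hsum d _ (fun k => if Atom k then om k (sc F d s) ^ (n / d) else 0), asum]
    · refine Finset.sum_congr rfl fun k _ => ?_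
      rw [om_sc_pow]
      by_cases hk : Atom k
      · have : Gen ψ k := by
          obtain ⟨m, rfl⟩ : ∃ m, d = m + 1 := ⟨d - 1, by omega⟩
          exact (atom_dim hψ hk).1
        rw [if_pos this]
      · rw [if_neg hk]; simp
    · intro k
      have := atm_iff hψ ⟨d, k⟩ hd1
      by_cases hk : Atom k.1
      · rw [if_pos (this.2 hk), if_pos hk]
      · rw [if_neg (fun h => hk (this.1 h)), if_neg hk]
  · have : ∀ k : Irr (GL (Fin 0) F), om k (sc F 0 s) = 1 := by
      intro k
      haveI := gl0_sub (F := F)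
      rw [Subsingleton.elim (sc F 0 s) 1, om_one]
    exact this _
  · intro x y
    exact om_rel (RX.m_spec hψ x y) s
  · intro m hm
    rw [hsum m _ (fun k => om k (sc F m s)) (fun k => rfl)]
    exact om_sum_zero hψ hm hs

theorem asum_one {ψ : AddChar F ℂ} (hψ : ψ ≠ 1) : asum F 1 (1 : Fˣ) = (Fintype.card F : ℂ) - 1 := by
  have hat : ∀ k : Irr (GL (Fin 1) F), Atom k := by
    intro k a b i j h
    have := h.card; omega
  have hd : ∀ k : Irr (GL (Fin 1) F), dm _ k = 1 := by
    intro k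
    have := (atom_dim (m := 0) hψ (hat k)).2
    simp only [Finset.range_zero, Finset.prod_empty] at this
    exact_mod_cast this
  have h1 := trace_lemma (1 : CG (GL (Fin 1) F)) 1
  have h2 : ∀ k : Irr (GL (Fin 1) F), chi k 1 = 1 := by
    intro k
    rw [chi, map_one, Matrix.trace_one, Fintype.card_fin, hd]; simp
  have h3 : ∀ g : GL (Fin 1) F, ((1 : CG (GL (Fin 1) F)) * gg g * 1).coeff g = 1 := by
    intro g
    rw [mul_one, one_mul, gg, MonoidAlgebra.of_apply, MonoidAlgebra.coeff_single, Finsupp.single_eq_same]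
  rw [asum]
  simp only [hat, if_true, map_one, om_one]
  simp only [h3] at h1
  simp only [h2, mul_one] at h1
  rw [h1, Finset.sum_const, Finset.card_univ, nsmul_eq_mul, mul_one, ← Nat.card_eq_fintype_card, Matrix.card_GL_field]
  simp [Nat.cast_sub (show 1 ≤ Fintype.card F from Fintype.card_pos)]

open ArithmeticFunction in
theorem asum_mu {ψ : AddChar F ℂ} (hψ : ψ ≠ 1) (n : ℕ) (hn : 1 ≤ n) : ∀ (s : Fˣ), orderOf s = n →
    (n : ℂ) * asum F n s = ((moebius n : ℤ) : ℂ) * ((Fintype.card F : ℂ) - 1) := by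
  induction n using Nat.strong_induction_on with
  | _ n IH =>
    intro s hs
    by_cases h1 : n = 1
    · subst h1
      rw [orderOf_eq_one_iff] at hs
      subst hs
      rw [asum_one hψ]; simp
    have h2 := asum_newton hψ (s := s) (by rintro rfl; rw [orderOf_one] at hs; omega) n hn
    have h3 : ∑ d ∈ n.divisors, ((moebius d : ℤ) : ℂ) = 0 := by
      have h4 := congrArg (fun f : ArithmeticFunction ℂ => f n) (coe_moebius_mul_coe_zeta (R := ℂ))
      simp only [coe_mul_zeta_apply, one_apply_ne h1] at h4
      exact h4
    rw [← Finset.sum_erase_add _ _ (Nat.mem_divisors_self n (by omega))] at h2 h3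
    rw [Nat.div_self hn, pow_one] at h2
    rw [Finset.sum_congr rfl (g := fun d => ((moebius d : ℤ) : ℂ) * ((Fintype.card F : ℂ) - 1)), ← Finset.sum_mul] at h2
    · linear_combination h2 - ((Fintype.card F : ℂ) - 1) * h3
    · intro d hd
      have hd1 := Finset.mem_of_mem_erase hd
      have hd2 := Finset.ne_of_mem_erase hd
      have hdn := Nat.dvd_of_mem_divisors hd1
      refine IH d (lt_of_le_of_ne (Nat.le_of_dvd hn hdn) hd2) (Nat.pos_of_mem_divisors hd1) _ ?_
      rw [orderOf_pow, hs, Nat.gcd_eq_right (Nat.div_dvd_of_dvd hdn), Nat.div_div_self hdn (by omega)]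

end CC2
end HRV


namespace HRV

section PL
open Polynomial

theorem poly_int (T : ℤ[X]) (m c e : ℕ) (hc : c ≠ 0)
    (h : ∀ N : ℕ, ∃ q : ℕ, N < q ∧ ∃ z : ℤ, (c : ℤ) * q ^ e * T.eval (q : ℤ) = ((q : ℤ) - 1) ^ m * z) :
    (X - 1) ^ m ∣ T := by
  suffices H : ∀ j ≤ m, (X - 1) ^ j ∣ T from H m le_rfl
  intro j
  induction j with
  | zero => intro _; simp
  | succ j ih =>
    intro hj
    obtain ⟨S, hS⟩ := ih (by omega)
    have h1 : S.eval 1 = 0 := by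
      by_contra h1
      obtain ⟨q, hq, z, hz⟩ := h ((c * S.eval 1).natAbs + 2)
      have hq1 : ((q : ℤ) - 1) ≠ 0 := by omega
      rw [hS, eval_mul, eval_pow, eval_sub, eval_X, eval_one] at hz
      have e1 : (c : ℤ) * q ^ e * S.eval (q : ℤ) = ((q : ℤ) - 1) ^ (m - j) * z := by
        apply mul_left_cancel₀ (pow_ne_zero j hq1)
        rw [← mul_assoc _ _ z, ← pow_add, show j + (m - j) = m by omega, ← hz]; ring
      have d1 : ((q : ℤ) - 1) ∣ (c : ℤ) * q ^ e * S.eval (q : ℤ) := by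
        rw [e1]; exact Dvd.dvd.mul_right (dvd_pow_self _ (by omega)) _
      have d2 : ((q : ℤ) - 1) ∣ S.eval (q : ℤ) - S.eval 1 := sub_dvd_eval_sub _ _ _
      have d3 : IsCoprime ((q : ℤ) - 1) ((q : ℤ) ^ e) := by
        apply IsCoprime.pow_right
        exact ⟨-1, 1, by ring⟩
      have d4 : ((q : ℤ) - 1) ∣ (c : ℤ) * S.eval (q : ℤ) :=
        d3.dvd_of_dvd_mul_left (by rw [show (q : ℤ) ^ e * ((c : ℤ) * S.eval (q : ℤ)) = (c : ℤ) * q ^ e * S.eval (q : ℤ) by ring]; exact d1)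
      have d5 : ((q : ℤ) - 1) ∣ (c : ℤ) * S.eval 1 := by
        have := dvd_sub d4 (d2.mul_left (c : ℤ))
        rwa [show (c : ℤ) * S.eval (q : ℤ) - c * (S.eval (q : ℤ) - S.eval 1) = (c : ℤ) * S.eval 1 by ring] at this
      have h0 : (c : ℤ) * S.eval 1 ≠ 0 := mul_ne_zero (by exact_mod_cast hc) h1
      have := Int.natAbs_le_of_dvd_ne_zero d5 h0
      omega
    have h2 : (X - 1) ∣ S := by
      have := dvd_iff_isRoot.2 (show S.IsRoot 1 from h1)
      simpa using this
    rw [hS, pow_succ]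
    exact mul_dvd_mul_left _ h2

theorem poly_rat (T : ℚ[X]) (m c e : ℕ) (hc : c ≠ 0)
    (h : ∀ N : ℕ, ∃ q : ℕ, N < q ∧ ∃ z : ℤ, (c : ℚ) * q ^ e * T.eval (q : ℚ) = ((q : ℚ) - 1) ^ m * z) :
    (X - 1) ^ m ∣ T := by
  obtain ⟨b, hb⟩ := IsLocalization.integerNormalization_map_to_map (nonZeroDivisors ℤ) T
  set T' := IsLocalization.integerNormalization (nonZeroDivisors ℤ) T with hT'
  have hb0 : ((b : ℤ) : ℚ) ≠ 0 := by
    exact_mod_cast nonZeroDivisors.coe_ne_zero b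
  have hb1 : T'.map (algebraMap ℤ ℚ) = C ((b : ℤ) : ℚ) * T := by
    rw [hb]
    ext i
    simp [Submonoid.smul_def]
  have ev : ∀ q : ℕ, ((T'.eval (q : ℤ) : ℤ) : ℚ) = (b : ℤ) * T.eval (q : ℚ) := by
    intro q
    have := congrArg (eval (q : ℚ)) hb1
    rw [eval_mul, eval_C] at this
    rw [← this]
    have := eval_map_apply (algebraMap ℤ ℚ) (q : ℤ) (p := T')
    simpa using this.symm
  have h1 : (X - 1) ^ m ∣ T' := by
    apply poly_int T' m c e hc
    intro N
    obtain ⟨q, hq, z, hz⟩ := h N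
    refine ⟨q, hq, (b : ℤ) * z, ?_⟩
    have : ((c : ℤ) * q ^ e * T'.eval (q : ℤ) : ℚ) = ((((q : ℤ) - 1) ^ m * ((b : ℤ) * z) : ℤ) : ℚ) := by
      push_cast
      rw [ev]
      linear_combination ((b : ℤ) : ℚ) * hz
    exact_mod_cast this
  obtain ⟨S, hS⟩ := h1
  refine ⟨C (((b : ℤ) : ℚ)⁻¹) * S.map (algebraMap ℤ ℚ), ?_⟩
  have h2 := hb1
  rw [hS, Polynomial.map_mul, Polynomial.map_pow, Polynomial.map_sub, Polynomial.map_X, Polynomial.map_one] at h2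
  have h3 : T = C (((b : ℤ) : ℚ)⁻¹) * (C ((b : ℤ) : ℚ) * T) := by
    rw [← mul_assoc, ← C_mul, inv_mul_cancel₀ hb0, C_1, one_mul]
  rw [h3, ← h2]; ring

/-- the polynomial for atoms -/
noncomputable def RR (n : ℕ) : ℚ[X] := X ^ (n * (n - 1) / 2) * ∑ i ∈ Finset.range n, X ^ i

theorem RR_one (n : ℕ) : (RR n).eval 1 = n := by simp [RR, eval_finset_sum]

theorem poly_final (g n : ℕ) (hg : 2 ≤ g) (hn : 1 ≤ n) (P : ℚ[X]) (μ : ℤ) (c e : ℕ) (hc : c ≠ 0)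
    (h : ∀ N : ℕ, ∃ q : ℕ, N < q ∧ ∃ z : ℤ, (c : ℚ) * q ^ e * (P.eval (q : ℚ) - ((q : ℚ) - 1) ^ (2 * g) * (RR n).eval (q : ℚ) ^ (2 * g - 2) * (μ / n))
      = ((q : ℚ) - 1) ^ (4 * g - 3) * z) :
    ∃ Q : ℚ[X], P = (X - 1) ^ (2 * g) * Q ∧ Q.eval 1 = (μ : ℚ) * (n : ℚ) ^ (2 * g - 3) := by
  obtain ⟨S, hS⟩ := poly_rat (P - (X - 1) ^ (2 * g) * RR n ^ (2 * g - 2) * C ((μ : ℚ) / n)) (4 * g - 3) c e hc (by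
    intro N
    obtain ⟨q, hq, z, hz⟩ := h N
    refine ⟨q, hq, z, ?_⟩
    simpa using hz)
  refine ⟨(X - 1) ^ (2 * g - 3) * S + RR n ^ (2 * g - 2) * C ((μ : ℚ) / n), ?_, ?_⟩
  · rw [mul_add, ← mul_assoc, ← pow_add, show 2 * g + (2 * g - 3) = 4 * g - 3 by omega, ← hS]; ring
  · have hn0 : (n : ℚ) ≠ 0 := by exact_mod_cast (by omega : n ≠ 0)
    rw [eval_add, eval_mul, eval_mul, eval_pow, eval_pow, RR_one, eval_C]
    simp only [eval_sub, eval_X, eval_one, sub_self]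
    rw [zero_pow (by omega), show 2 * g - 2 = (2 * g - 3) + 1 by omega, pow_succ]
    field_simp
    ring

end PL
end HRV


namespace HRV

section Fin
variable {F : Type} [Field F] [Fintype F] {m n : ℕ}

theorem prod_id (x : ℂ) (n : ℕ) : ∏ i ∈ Finset.range n, (x ^ n - x ^ i) = x ^ (n * (n - 1) / 2) * ∏ i ∈ Finset.range n, (x ^ (i + 1) - 1) := by
  rw [← Finset.sum_range_id, ← Finset.prod_pow_eq_pow_sum, ← Finset.prod_range_reflect (fun i => x ^ (i + 1) - 1), ← Finset.prod_mul_distrib]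
  refine Finset.prod_congr rfl fun i hi => ?_
  have hi := Finset.mem_range.1 hi
  rw [mul_sub, mul_one, ← pow_add, show i + (n - 1 - i + 1) = n by omega]

theorem card_GL_C (n : ℕ) : (Fintype.card (GL (Fin n) F) : ℂ) = ∏ i ∈ Finset.range n, ((Fintype.card F : ℂ) ^ n - (Fintype.card F : ℂ) ^ i) := by
  rw [← Nat.card_eq_fintype_card, Matrix.card_GL_field, Nat.cast_prod, ← Fin.prod_univ_eq_prod_range (fun i => (Fintype.card F : ℂ) ^ n - (Fintype.card F : ℂ) ^ i)]
  refine Finset.prod_congr rfl fun i _ => ?_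
  rw [Nat.cast_sub (Nat.pow_le_pow_right Fintype.card_pos i.2.le)]
  push_cast; rfl

theorem q_pow_ne (j : ℕ) : (Fintype.card F : ℂ) ^ (j + 1) - 1 ≠ 0 := by
  have h : 1 < Fintype.card F := Fintype.one_lt_card
  have : 1 < Fintype.card F ^ (j + 1) := Nat.one_lt_pow (by omega) h
  rw [sub_ne_zero]
  exact_mod_cast this.ne'

theorem atom_h {ψ : AddChar F ℂ} (hψ : ψ ≠ 1) (hn : 1 ≤ n) {k : Irr (GL (Fin n) F)} (hk : Atom k) :
    (Fintype.card (GL (Fin n) F) : ℂ) / dm _ k = ((Fintype.card F : ℂ) - 1) * (((RR n).eval (Fintype.card F : ℚ) : ℚ) : ℂ) := by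
  obtain ⟨m, rfl⟩ : ∃ m, n = m + 1 := ⟨n - 1, by omega⟩
  rw [(atom_dim hψ hk).2, card_GL_C, prod_id, Finset.prod_range_succ]
  have h0 : ∏ i ∈ Finset.range m, ((Fintype.card F : ℂ) ^ (i + 1) - 1) ≠ 0 := Finset.prod_ne_zero_iff.2 fun i _ => q_pow_ne i
  rw [← mul_geom_sum, mul_div_assoc, mul_div_cancel_left₀ _ h0]
  simp only [RR, Polynomial.eval_mul, Polynomial.eval_pow, Polynomial.eval_X, Polynomial.eval_finset_sum]
  push_cast
  ring

open scoped Classical in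
theorem field_eq {ψ : AddChar F ℂ} (hψ : ψ ≠ 1) (g n : ℕ) (hg : 2 ≤ g) (hn : 1 ≤ n) (P : Polynomial ℚ) (e : ℕ) (he : Fintype.card (NN F n) = Fintype.card F ^ e)
    (ζ : Fˣ) (hζ : orderOf ζ = n)
    (hc : (Nat.card {p : (Fin g → GL (Fin n) F) × (Fin g → GL (Fin n) F) //
            (List.ofFn fun i => p.1 i * p.2 i * (p.1 i)⁻¹ * (p.2 i)⁻¹).prod = sc F n ζ} : ℚ)
          = (Nat.card (GL (Fin n) F) : ℚ) / ((Fintype.card F : ℚ) - 1)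
              * P.eval (Fintype.card F : ℚ)) :
    ∃ z : ℤ, (((((n.factorial)^(n-1)).factorial ^ (2 * g - 2) : ℕ)) : ℚ) * (Fintype.card F : ℚ) ^ (e * (2 * g - 2)) *
      (P.eval (Fintype.card F : ℚ) - ((Fintype.card F : ℚ) - 1) ^ (2 * g) * (RR n).eval (Fintype.card F : ℚ) ^ (2 * g - 2) * (((ArithmeticFunction.moebius n : ℤ) : ℚ) / n))
      = ((Fintype.card F : ℚ) - 1) ^ (4 * g - 3) * z := by
  set q := Fintype.card F with hq
  set B := ((n.factorial)^(n-1)).factorial with hB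
  set N := Fintype.card (GL (Fin n) F) with hN
  have hN0 : (N : ℂ) ≠ 0 := by
    have : 0 < N := Fintype.card_pos
    exact_mod_cast this.ne'
  have hq1 : (q : ℂ) - 1 ≠ 0 := by simpa using q_pow_ne (F := F) 0
  have hq1' : (q : ℚ) - 1 ≠ 0 := by
    intro h; apply hq1; exact_mod_cast congrArg (fun x : ℚ => (x : ℂ)) h
  have hd : ∀ k : Irr (GL (Fin n) F), (dm _ k : ℂ) ≠ 0 := fun k => by exact_mod_cast NeZero.ne (dm _ k)
  have hn0 : (n : ℂ) ≠ 0 := by exact_mod_cast (by omega : n ≠ 0)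
  have f1 := frob g (sc_comm (F := F) (m := n) ζ)
  rw [coeff_Om_pow] at f1
  have hc' := congrArg (fun x : ℚ => (x : ℂ)) hc
  simp only [Rat.cast_natCast, Rat.cast_mul, Rat.cast_div, Rat.cast_sub, Rat.cast_one] at hc'
  rw [hc', Nat.card_eq_fintype_card, ← hN] at f1
  -- the main formula
  have f2 : ((P.eval (q : ℚ) : ℚ) : ℂ) = ((q : ℂ) - 1) * ∑ k : Irr (GL (Fin n) F), ((N : ℂ) / dm _ k) ^ (2 * g - 2) * om k (sc F n ζ⁻¹) := by
    have e1 : ∀ k : Irr (GL (Fin n) F), (N : ℂ) ^ (2 * g) / (dm _ k : ℂ) ^ (2 * g) * (dm _ k) ^ 2 * om k (sc F n ζ)⁻¹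
        = (N : ℂ) ^ 2 * (((N : ℂ) / dm _ k) ^ (2 * g - 2) * om k (sc F n ζ⁻¹)) := by
      intro k
      obtain ⟨t, ht⟩ : ∃ t, 2 * g = t + 2 := ⟨2 * g - 2, by omega⟩
      have := hd k
      rw [ht, Nat.add_sub_cancel, map_inv, div_pow, pow_add, pow_add]
      field_simp
    rw [Finset.sum_congr rfl (fun k _ => e1 k), ← Finset.mul_sum] at f1
    have h2 : (N : ℂ) ^ 2 ≠ 0 := pow_ne_zero _ hN0
    apply mul_left_cancel₀ h2
    field_simp at f1
    rw [f1]
  have f3 : ∑ k : Irr (GL (Fin n) F), (if Atom k then ((N : ℂ) / dm _ k) ^ (2 * g - 2) * om k (sc F n ζ⁻¹) else 0)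
      = (((q : ℂ) - 1) * (((RR n).eval (q : ℚ) : ℚ) : ℂ)) ^ (2 * g - 2) * asum F n ζ⁻¹ := by
    rw [asum, Finset.mul_sum]
    refine Finset.sum_congr rfl fun k _ => ?_
    split_ifs with hk
    · rw [atom_h hψ hn hk]
    · simp
  have f4 := asum_mu hψ n hn ζ⁻¹ (by rw [orderOf_inv, hζ])
  set I : ℂ := ∑ k : Irr (GL (Fin n) F), (if Atom k then 0 else
    ((B : ℂ) * (Fintype.card (NN F n) : ℂ) * (N : ℂ) / (dm _ k * ((q : ℂ) - 1)^2)) ^ (2 * g - 2) * om k (sc F n ζ⁻¹)) with hI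
  have hInt : IsIntegral ℤ I := by
    apply IsIntegral.sum
    intro k _
    split_ifs with hk
    · exact isIntegral_zero
    · exact ((nonatom_integral hψ k hk).pow _).mul (om_integral k (sc_comm _))
  have f5 : ((B : ℂ) * (q : ℂ) ^ e) ^ (2 * g - 2) * ∑ k : Irr (GL (Fin n) F), (if Atom k then 0 else ((N : ℂ) / dm _ k) ^ (2 * g - 2) * om k (sc F n ζ⁻¹))
      = (((q : ℂ) - 1) ^ 2) ^ (2 * g - 2) * I := by
    rw [hI, Finset.mul_sum, Finset.mul_sum]
    refine Finset.sum_congr rfl fun k _ => ?_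
    split_ifs with hk
    · simp
    · rw [he, ← mul_assoc, ← mul_assoc, ← mul_pow, ← mul_pow]
      congr 2
      have := hd k
      push_cast
      field_simp
  have f6 : ∑ k : Irr (GL (Fin n) F), ((N : ℂ) / dm _ k) ^ (2 * g - 2) * om k (sc F n ζ⁻¹)
     = ∑ k : Irr (GL (Fin n) F), (if Atom k then ((N : ℂ) / dm _ k) ^ (2 * g - 2) * om k (sc F n ζ⁻¹) else 0)
      + ∑ k : Irr (GL (Fin n) F), (if Atom k then 0 else ((N : ℂ) / dm _ k) ^ (2 * g - 2) * om k (sc F n ζ⁻¹)) := by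
    rw [← Finset.sum_add_distrib]
    refine Finset.sum_congr rfl fun k _ => ?_
    split_ifs <;> simp
  set R : ℚ := (RR n).eval (q : ℚ) with hR
  set p : ℚ := P.eval (q : ℚ) with hp
  set μ : ℤ := ArithmeticFunction.moebius n with hμ
  set r : ℚ := ((B : ℚ) * (q : ℚ) ^ e) ^ (2 * g - 2) * (p - ((q : ℚ) - 1) ^ (2 * g) * R ^ (2 * g - 2) * ((μ : ℚ) / n)) / ((q : ℚ) - 1) ^ (4 * g - 3) with hr
  have f7 : (r : ℂ) = I := by
    rw [hr]
    push_cast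
    rw [div_eq_iff (pow_ne_zero _ hq1), f2, f6, f3]
    have e3 : asum F n ζ⁻¹ = (μ : ℂ) / n * ((q : ℂ) - 1) := by
      field_simp; linear_combination f4
    rw [e3]
    obtain ⟨t, ht⟩ : ∃ t, 2 * g - 2 = t := ⟨_, rfl⟩
    rw [show 2 * g = t + 2 by omega, show 4 * g - 3 = 2 * t + 1 by omega]
    rw [ht] at f5
    rw [Nat.add_sub_cancel]
    rw [mul_pow _ (R : ℂ)]
    rw [← pow_mul] at f5
    linear_combination ((q : ℂ) - 1) * f5
  have hrInt : IsIntegral ℤ r := by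
    rw [← f7] at hInt
    exact (isIntegral_algebraMap_iff (algebraMap ℚ ℂ).injective).1 hInt
  obtain ⟨z, hz⟩ := IsIntegrallyClosed.isIntegral_iff.1 hrInt
  refine ⟨z, ?_⟩
  have hz' : (z : ℚ) = r := hz
  rw [hz', hr, mul_div_cancel₀ _ (pow_ne_zero _ hq1'), mul_pow, ← pow_mul]
  push_cast
  ring

end Fin
end HRV

theorem statement13 (g n : ℕ) (hg : 2 ≤ g) (hn : 1 ≤ n) (P : Polynomial ℚ)
    (hP : ∀ (F : Type) [Field F] [Fintype F], n ∣ Fintype.card F - 1 →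
      ∃ ζ : F, orderOf ζ = n ∧
        (Nat.card {p : (Fin g → GL (Fin n) F) × (Fin g → GL (Fin n) F) //
            (↑((List.ofFn fun i => p.1 i * p.2 i * (p.1 i)⁻¹ * (p.2 i)⁻¹).prod) :
              Matrix (Fin n) (Fin n) F) = ζ • (1 : Matrix (Fin n) (Fin n) F)} : ℚ)
          = (Nat.card (GL (Fin n) F) : ℚ) / ((Fintype.card F : ℚ) - 1)
              * P.eval (Fintype.card F : ℚ)) :
    ∃ Q : Polynomial ℚ, P = (Polynomial.X - 1) ^ (2 * g) * Q ∧
      Q.eval 1 = ((ArithmeticFunction.moebius n : ℤ) : ℚ) * (n : ℚ) ^ (2 * g - 3) := by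
  obtain ⟨e, he⟩ := HRV.card_NN n
  refine HRV.poly_final g n hg hn P (ArithmeticFunction.moebius n) (((n.factorial)^(n-1)).factorial ^ (2 * g - 2)) (e * (2 * g - 2))
    (pow_ne_zero _ (Nat.factorial_ne_zero _)) ?_
  intro N
  obtain ⟨q, hq, hqN, hmod⟩ := Nat.exists_prime_gt_modEq_one (k := n) N (by omega)
  refine ⟨q, hqN, ?_⟩
  haveI : Fact q.Prime := ⟨hq⟩
  have hcard : Fintype.card (ZMod q) = q := ZMod.card q
  obtain ⟨ζ, hζ, hc⟩ := hP (ZMod q) (by rw [hcard]; exact (Nat.modEq_iff_dvd' hq.one_le).1 hmod.symm)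
  have hζ0 : ζ ≠ 0 := by
    rintro rfl
    have := pow_orderOf_eq_one (0 : ZMod q)
    rw [hζ, zero_pow (by omega)] at this
    exact zero_ne_one this
  have hu : orderOf (Units.mk0 ζ hζ0) = n := by rw [← orderOf_units, Units.val_mk0, hζ]
  have hψ : (ZMod.stdAddChar : AddChar (ZMod q) ℂ) ≠ 1 := by
    have := ZMod.isPrimitive_stdAddChar q
    have h1 := this (a := 1) one_ne_zero
    simpa using h1
  have := HRV.field_eq hψ g n hg hn P e (he (ZMod q)) (Units.mk0 ζ hζ0) hu (by
    rw [← hc]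
    congr 1
    apply Nat.card_congr
    refine Equiv.subtypeEquivRight fun p => ?_
    rw [← Units.val_inj, HRV.sc_val, Units.val_mk0])
  rw [hcard] at this
  exact this
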